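/- Suppose V ∈ Ĉ(D) is a viscosity subsolution of the HJB equation satisfying (S1) and (S2), and V̂ ∈ Ĉ(D) is a viscosity supersolution of the HJB equation satisfying (S1) and (S2). Then V(t,r,x) ≤ V̂(t,r,x) for all (t,r,x) ∈ D. Consequently, any two viscosity solutions of the HJB equation in Ĉ(D) satisfying (S1) and (S2) coincide on D. -/

import Mathlib

open Set Matrix

open scoped RealInnerProductSpace

/-- Frobenius norm of a real matrix. -/
noncomputable def frobNorm (n d : ℕ) (A : Matrix (Fin n) (Fin d) ℝ) : ℝ :=
  Real.sqrt (∑ i, ∑ j, (A i j) ^ 2)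

/-- The Hamiltonian `H(t,x,p,P) = ⟨b(t,x),p⟩ + (1/2) tr(σ(t,x)ᵀ P σ(t,x)) + g(t,x)`. -/
noncomputable def Ham (n d : ℕ)
    (b : ℝ → EuclideanSpace ℝ (Fin n) → EuclideanSpace ℝ (Fin n))
    (σ : ℝ → EuclideanSpace ℝ (Fin n) → Matrix (Fin n) (Fin d) ℝ)
    (g : ℝ → EuclideanSpace ℝ (Fin n) → ℝ)
    (t : ℝ) (x p : EuclideanSpace ℝ (Fin n)) (P : Matrix (Fin n) (Fin n) ℝ) : ℝ :=
  ⟪b t x, p⟫ + (1/2) * ((σ t x)ᵀ * P * σ t x).trace + g t x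

/-- The intervention operator `N[V](t,0,x) = inf_{ξ ∈ K} [V(t,0,x+ξ) + ℓ(t,ξ)]`. -/
noncomputable def Nop (n : ℕ) (K : Set (EuclideanSpace ℝ (Fin n)))
    (ℓ : ℝ → EuclideanSpace ℝ (Fin n) → ℝ)
    (V : ℝ → ℝ → EuclideanSpace ℝ (Fin n) → ℝ)
    (t : ℝ) (x : EuclideanSpace ℝ (Fin n)) : ℝ :=
  sInf {y : ℝ | ∃ ξ ∈ K, y = V t 0 (x + ξ) + ℓ t ξ}

/-- The modified obstacle `N̂[V](t,r,x)`: equals `N[V](t,0,x)` for `r ≥ δ` and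
`2L(T+1)` for `r < δ`. -/
noncomputable def Nhat (n : ℕ) (T δ L : ℝ) (K : Set (EuclideanSpace ℝ (Fin n)))
    (ℓ : ℝ → EuclideanSpace ℝ (Fin n) → ℝ)
    (V : ℝ → ℝ → EuclideanSpace ℝ (Fin n) → ℝ)
    (t r : ℝ) (x : EuclideanSpace ℝ (Fin n)) : ℝ :=
  if δ ≤ r then Nop n K ℓ V t x else 2 * L * (T + 1)

/-- The domain `D = [0,T] × [0,T] × ℝⁿ`. -/
def Dom (n : ℕ) (T : ℝ) : Set (ℝ × ℝ × EuclideanSpace ℝ (Fin n)) :=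
  Icc 0 T ×ˢ Icc 0 T ×ˢ univ

/-- The terminal value `min{h(x), inf_{ξ∈K}[h(x+ξ) + ℓ(T,ξ)]}`. -/
noncomputable def termVal (n : ℕ) (T : ℝ) (K : Set (EuclideanSpace ℝ (Fin n)))
    (h : EuclideanSpace ℝ (Fin n) → ℝ) (ℓ : ℝ → EuclideanSpace ℝ (Fin n) → ℝ)
    (x : EuclideanSpace ℝ (Fin n)) : ℝ :=
  min (h x) (sInf {y : ℝ | ∃ ξ ∈ K, y = h (x + ξ) + ℓ T ξ})

/-- A test function: continuous on `D`, `C¹` in `(t,r)`, `C²` in `x`, and constant in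
`r` on `[δ,T]`, with its partial derivatives `φt, φr`, gradient `φx` and Hessian `φxx`
bundled. -/
structure TestFn (n : ℕ) (T δ : ℝ) where
  φ : ℝ → ℝ → EuclideanSpace ℝ (Fin n) → ℝ
  φt : ℝ → ℝ → EuclideanSpace ℝ (Fin n) → ℝ
  φr : ℝ → ℝ → EuclideanSpace ℝ (Fin n) → ℝ
  φx : ℝ → ℝ → EuclideanSpace ℝ (Fin n) → EuclideanSpace ℝ (Fin n)
  φxx : ℝ → ℝ → EuclideanSpace ℝ (Fin n) → Matrix (Fin n) (Fin n) ℝ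
  cont : Continuous fun p : ℝ × ℝ × EuclideanSpace ℝ (Fin n) => φ p.1 p.2.1 p.2.2
  hasφt : ∀ t r x, HasDerivAt (fun s => φ s r x) (φt t r x) t
  hasφr : ∀ t r x, HasDerivAt (fun s => φ t s x) (φr t r x) r
  hasφx : ∀ t r x, HasGradientAt (fun y => φ t r y) (φx t r x) x
  hasφxx : ∀ t r x, HasFDerivAt (fun y => φx t r y)
      (LinearMap.toContinuousLinearMap (Matrix.toEuclideanLin (φxx t r x))) x
  contφt : Continuous fun p : ℝ × ℝ × EuclideanSpace ℝ (Fin n) => φt p.1 p.2.1 p.2.2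
  contφr : Continuous fun p : ℝ × ℝ × EuclideanSpace ℝ (Fin n) => φr p.1 p.2.1 p.2.2
  contφx : Continuous fun p : ℝ × ℝ × EuclideanSpace ℝ (Fin n) => φx p.1 p.2.1 p.2.2
  contφxx : Continuous fun p : ℝ × ℝ × EuclideanSpace ℝ (Fin n) => φxx p.1 p.2.1 p.2.2
  symm : ∀ t r x, (φxx t r x).IsSymm
  flat : ∀ t r x, δ ≤ r → φ t r x = φ t δ x

/-- Membership in the class `Ĉ(D)`: continuous on `D`, bounded above by `L(T+1)`, and
constant in `r` on `[δ,T]`. -/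
def InCHat (n : ℕ) (T δ L : ℝ) (V : ℝ → ℝ → EuclideanSpace ℝ (Fin n) → ℝ) : Prop :=
  ContinuousOn (fun p : ℝ × ℝ × EuclideanSpace ℝ (Fin n) => V p.1 p.2.1 p.2.2)
      (Dom n T) ∧
  (∀ t ∈ Icc (0:ℝ) T, ∀ r ∈ Icc (0:ℝ) T, ∀ x, V t r x ≤ L * (T + 1)) ∧
  (∀ t r x, δ ≤ r → r ≤ T → V t r x = V t δ x)

/-- Condition (S1): `|V| ≤ L(T+1)` on `D`. -/
def CondS1 (n : ℕ) (T L : ℝ) (V : ℝ → ℝ → EuclideanSpace ℝ (Fin n) → ℝ) : Prop :=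
  ∀ t ∈ Icc (0:ℝ) T, ∀ r ∈ Icc (0:ℝ) T, ∀ x, |V t r x| ≤ L * (T + 1)

/-- Condition (S2): a Hölder-Lipschitz modulus of continuity on `D` (with `r` entering
through `min(r,δ)`). -/
def CondS2 (n : ℕ) (T δ : ℝ) (V : ℝ → ℝ → EuclideanSpace ℝ (Fin n) → ℝ) : Prop :=
  ∃ C > 0, ∀ t ∈ Icc (0:ℝ) T, ∀ r ∈ Icc (0:ℝ) T, ∀ x : EuclideanSpace ℝ (Fin n),
    ∀ th ∈ Icc (0:ℝ) T, ∀ rh ∈ Icc (0:ℝ) T, ∀ xh : EuclideanSpace ℝ (Fin n),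
    |V t r x - V th rh xh|
      ≤ C * (Real.sqrt |t - th| + Real.sqrt |min r δ - min rh δ| + ‖x - xh‖)

/-- Viscosity subsolution of the HJB equation (HJB3). -/
def IsSubsol (n d : ℕ) (T δ L : ℝ) (K : Set (EuclideanSpace ℝ (Fin n)))
    (b : ℝ → EuclideanSpace ℝ (Fin n) → EuclideanSpace ℝ (Fin n))
    (σ : ℝ → EuclideanSpace ℝ (Fin n) → Matrix (Fin n) (Fin d) ℝ)
    (g : ℝ → EuclideanSpace ℝ (Fin n) → ℝ)
    (h : EuclideanSpace ℝ (Fin n) → ℝ)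
    (ℓ : ℝ → EuclideanSpace ℝ (Fin n) → ℝ)
    (V : ℝ → ℝ → EuclideanSpace ℝ (Fin n) → ℝ) : Prop :=
  (∀ r ∈ Icc (0:ℝ) T, ∀ x, V T r x ≤ termVal n T K h ℓ x) ∧
  (∀ ψ : TestFn n T δ, ∀ t₀ ∈ Ico (0:ℝ) T, ∀ r₀ ∈ Ico (0:ℝ) T,
    ∀ x₀ : EuclideanSpace ℝ (Fin n),
    IsLocalMaxOn
      (fun p : ℝ × ℝ × EuclideanSpace ℝ (Fin n) =>
        V p.1 p.2.1 p.2.2 - ψ.φ p.1 p.2.1 p.2.2)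
      (Dom n T) (t₀, r₀, x₀) →
    0 ≤ min
      (ψ.φt t₀ r₀ x₀ + ψ.φr t₀ r₀ x₀
        + Ham n d b σ g t₀ x₀ (ψ.φx t₀ r₀ x₀) (ψ.φxx t₀ r₀ x₀))
      (Nhat n T δ L K ℓ V t₀ r₀ x₀ - V t₀ r₀ x₀))

/-- Viscosity supersolution of the HJB equation (HJB3). -/
def IsSupersol (n d : ℕ) (T δ L : ℝ) (K : Set (EuclideanSpace ℝ (Fin n)))
    (b : ℝ → EuclideanSpace ℝ (Fin n) → EuclideanSpace ℝ (Fin n))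
    (σ : ℝ → EuclideanSpace ℝ (Fin n) → Matrix (Fin n) (Fin d) ℝ)
    (g : ℝ → EuclideanSpace ℝ (Fin n) → ℝ)
    (h : EuclideanSpace ℝ (Fin n) → ℝ)
    (ℓ : ℝ → EuclideanSpace ℝ (Fin n) → ℝ)
    (V : ℝ → ℝ → EuclideanSpace ℝ (Fin n) → ℝ) : Prop :=
  (∀ r ∈ Icc (0:ℝ) T, ∀ x, termVal n T K h ℓ x ≤ V T r x) ∧
  (∀ ψ : TestFn n T δ, ∀ t₀ ∈ Ico (0:ℝ) T, ∀ r₀ ∈ Ico (0:ℝ) T,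
    ∀ x₀ : EuclideanSpace ℝ (Fin n),
    IsLocalMinOn
      (fun p : ℝ × ℝ × EuclideanSpace ℝ (Fin n) =>
        V p.1 p.2.1 p.2.2 - ψ.φ p.1 p.2.1 p.2.2)
      (Dom n T) (t₀, r₀, x₀) →
    min
      (ψ.φt t₀ r₀ x₀ + ψ.φr t₀ r₀ x₀
        + Ham n d b σ g t₀ x₀ (ψ.φx t₀ r₀ x₀) (ψ.φxx t₀ r₀ x₀))
      (Nhat n T δ L K ℓ V t₀ r₀ x₀ - V t₀ r₀ x₀) ≤ 0)

open Filter Topology in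
lemma taylor_of_subgrad {E : Type*} [NormedAddCommGroup E] [InnerProductSpace ℝ E]
    (G : E → ℝ) (C : ℝ) (hC : 0 < C) (p : E → E)
    (hp : ∀ z y, G z + ⟪p z, y - z⟫ - C / 2 * ‖y - z‖ ^ 2 ≤ G y) (z : E) (A : E →L[ℝ] E)
    (hA : ∀ κ > 0, ∀ᶠ h in 𝓝 (0 : E), ‖p (z + h) - p z - A h‖ ≤ κ * ‖h‖) :
    ∀ κ > 0, ∀ᶠ h in 𝓝 (0 : E),
      |G (z + h) - G z - ⟪p z, h⟫ - 1 / 2 * ⟪A h, h⟫| ≤ κ * ‖h‖ ^ 2 := by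
  intro κ hκ
  obtain ⟨ρ, hρ, hb⟩ := Metric.eventually_nhds_iff.1 (hA (κ / 2) (by positivity))
  obtain ⟨m, hm⟩ := exists_nat_gt ((‖A‖ + C) / κ)
  have hm0 : (0 : ℝ) < m := lt_of_le_of_lt (by positivity) hm
  refine Metric.eventually_nhds_iff.2 ⟨ρ, hρ, fun h hh => ?_⟩
  rw [dist_zero_right] at hh
  set a := ⟪A h, h⟫ with ha
  set N := ‖h‖ ^ 2 with hN
  have hN0 : 0 ≤ N := by positivity
  have ha' : |a| ≤ ‖A‖ * N := by
    calc |a| ≤ ‖A h‖ * ‖h‖ := abs_real_inner_le_norm _ _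
      _ ≤ (‖A‖ * ‖h‖) * ‖h‖ := by gcongr; exact A.le_opNorm h
      _ = _ := by rw [hN]; ring
  -- estimate of the subgradient along the segment
  have key : ∀ s : ℝ, 0 ≤ s → s ≤ 1 →
      |⟪p (z + s • h), h⟫ - ⟪p z, h⟫ - s * a| ≤ κ / 2 * N := by
    intro s hs0 hs1
    have hs : ‖s • h‖ ≤ ‖h‖ := by
      rw [norm_smul, Real.norm_of_nonneg hs0]; nlinarith [norm_nonneg h]
    have h1 := hb (y := s • h) (by rw [dist_zero_right]; linarith)
    have h2 : ⟪p (z + s • h), h⟫ - ⟪p z, h⟫ - s * a = ⟪p (z + s • h) - p z - A (s • h), h⟫ := by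
      rw [inner_sub_left, inner_sub_left, map_smul, inner_smul_left]; simp [ha]
    rw [h2]
    calc _ ≤ ‖p (z + s • h) - p z - A (s • h)‖ * ‖h‖ := abs_real_inner_le_norm _ _
      _ ≤ (κ / 2 * ‖s • h‖) * ‖h‖ := by gcongr
      _ ≤ (κ / 2 * ‖h‖) * ‖h‖ := by gcongr
      _ = _ := by rw [hN]; ring
  have step : ∀ i : ℕ, i + 1 ≤ m →
      G (z + ((i : ℝ) / m) • h) + ⟪p (z + ((i : ℝ) / m) • h), h⟫ / m - C / 2 * (N / m ^ 2)
        ≤ G (z + (((i + 1 : ℕ) : ℝ) / m) • h) ∧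
      G (z + (((i + 1 : ℕ) : ℝ) / m) • h) ≤ G (z + ((i : ℝ) / m) • h)
        + ⟪p (z + (((i + 1 : ℕ) : ℝ) / m) • h), h⟫ / m + C / 2 * (N / m ^ 2) := by
    intro i _
    have e1 : (z + (((i + 1 : ℕ) : ℝ) / m) • h) - (z + ((i : ℝ) / m) • h) = (1 / (m : ℝ)) • h := by
      push_cast; rw [add_sub_add_left_eq_sub, ← sub_smul]; congr 1; field_simp; ring
    have e2 : (z + ((i : ℝ) / m) • h) - (z + (((i + 1 : ℕ) : ℝ) / m) • h) = -((1 / (m : ℝ)) • h) := by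
      rw [← e1]; abel
    have n1 : ‖(1 / (m : ℝ)) • h‖ ^ 2 = N / m ^ 2 := by
      rw [norm_smul, mul_pow, Real.norm_of_nonneg (by positivity), hN]; field_simp
    constructor
    · have := hp (z + ((i : ℝ) / m) • h) (z + (((i + 1 : ℕ) : ℝ) / m) • h)
      rw [e1, n1, inner_smul_right] at this
      linarith [this, (by ring : 1 / (m : ℝ) * ⟪p (z + ((i : ℝ) / m) • h), h⟫ = ⟪p (z + ((i : ℝ) / m) • h), h⟫ / m)]
    · have := hp (z + (((i + 1 : ℕ) : ℝ) / m) • h) (z + ((i : ℝ) / m) • h)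
      rw [e2, norm_neg, n1, inner_neg_right, inner_smul_right] at this
      linarith [this, (by ring : 1 / (m : ℝ) * ⟪p (z + (((i + 1 : ℕ) : ℝ) / m) • h), h⟫ = ⟪p (z + (((i + 1 : ℕ) : ℝ) / m) • h), h⟫ / m)]
  have ind : ∀ i : ℕ, i ≤ m →
      (i : ℝ) / m * ⟪p z, h⟫ + (i * (i - 1) / (2 * m ^ 2)) * a - i / m * (κ / 2 * N)
        - i / m ^ 2 * (C / 2 * N) ≤ G (z + ((i : ℝ) / m) • h) - G z ∧
      G (z + ((i : ℝ) / m) • h) - G z ≤ (i : ℝ) / m * ⟪p z, h⟫ + (i * (i + 1) / (2 * m ^ 2)) * a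
        + i / m * (κ / 2 * N) + i / m ^ 2 * (C / 2 * N) := by
    intro i
    induction i with
    | zero => intro _; simp
    | succ i ih =>
      intro hi
      obtain ⟨ih1, ih2⟩ := ih (by omega)
      obtain ⟨s1, s2⟩ := step i hi
      have hi' : ((i + 1 : ℕ) : ℝ) ≤ m := by exact_mod_cast hi
      have k1 := abs_le.1 (key ((i : ℝ) / m) (by positivity)
        (by rw [div_le_one hm0]; push_cast at hi'; linarith))
      have k2 := abs_le.1 (key (((i + 1 : ℕ) : ℝ) / m) (by positivity) (by rw [div_le_one hm0]; exact hi'))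
      have d1 : (⟪p z, h⟫ + (i : ℝ) / m * a - κ / 2 * N) / m ≤ ⟪p (z + ((i : ℝ) / m) • h), h⟫ / m := by
        gcongr; linarith [k1.1]
      have d2 : ⟪p (z + (((i + 1 : ℕ) : ℝ) / m) • h), h⟫ / m ≤
          (⟪p z, h⟫ + ((i + 1 : ℕ) : ℝ) / m * a + κ / 2 * N) / m := by
        gcongr; linarith [k2.2]
      constructor
      · refine le_trans (le_of_eq ?_) (by linarith [d1, s1, ih1] :
          ((i : ℝ) / m * ⟪p z, h⟫ + (i * (i - 1) / (2 * m ^ 2)) * a - i / m * (κ / 2 * N)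
        - i / m ^ 2 * (C / 2 * N)) + (⟪p z, h⟫ + (i : ℝ) / m * a - κ / 2 * N) / m
          - C / 2 * (N / m ^ 2) ≤ _)
        push_cast; field_simp; ring
      · refine le_trans (by linarith [d2, s2, ih2] : _ ≤
          ((i : ℝ) / m * ⟪p z, h⟫ + (i * (i + 1) / (2 * m ^ 2)) * a + i / m * (κ / 2 * N)
        + i / m ^ 2 * (C / 2 * N)) + (⟪p z, h⟫ + ((i + 1 : ℕ) : ℝ) / m * a + κ / 2 * N) / m
          + C / 2 * (N / m ^ 2)) (le_of_eq ?_)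
        push_cast; field_simp; ring
  obtain ⟨i1, i2⟩ := ind m le_rfl
  rw [div_self hm0.ne', one_smul] at i1 i2
  have hmk : ‖A‖ + C ≤ κ * m := by
    rw [div_lt_iff₀ hκ] at hm; linarith
  have hb1 : (|a| + C * N) / (2 * m) ≤ κ / 2 * N := by
    rw [div_le_iff₀ (by positivity)]
    nlinarith
  have r1 : (m : ℝ) * (m - 1) / (2 * m ^ 2) * a = a / 2 - a / (2 * m) := by field_simp
  have r2 : (m : ℝ) * (m + 1) / (2 * m ^ 2) * a = a / 2 + a / (2 * m) := by field_simp
  have r3 : (m : ℝ) / m ^ 2 * (C / 2 * N) = C * N / (2 * m) := by field_simp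
  have r4 : (|a| + C * N) / (2 * m) = |a| / (2 * m) + C * N / (2 * m) := by ring
  have r5 : |a / (2 * m)| = |a| / (2 * m) := by rw [abs_div, abs_of_pos (by positivity : (0:ℝ) < 2 * m)]
  have r6 := abs_le.1 (le_of_eq r5)
  rw [r1, r3] at i1
  rw [r2, r3] at i2
  rw [abs_le]
  constructor <;> linarith [r6.1, r6.2]

/-- If `⟪a,h⟫ ≤ c‖h‖²` for every `h` then `a = 0`. -/
lemma eq_zero_of_inner_le_sq {E : Type*} [NormedAddCommGroup E] [InnerProductSpace ℝ E]
    (a : E) (c : ℝ) (hc : 0 < c) (h : ∀ h : E, ⟪a, h⟫ ≤ c * ‖h‖ ^ 2) : a = 0 := by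
  have := h ((1 / (2 * c)) • a)
  rw [inner_smul_right, norm_smul, mul_pow, real_inner_self_eq_norm_sq,
    Real.norm_of_nonneg (by positivity)] at this
  have e : c * ((1 / (2 * c)) ^ 2 * ‖a‖ ^ 2) = 1 / (2 * c) * ‖a‖ ^ 2 / 2 := by field_simp
  rw [e] at this
  have h2 : 1 / (2 * c) * ‖a‖ ^ 2 ≤ 0 := by linarith
  have h3 : 0 < 1 / (2 * c) := by positivity
  have : ‖a‖ ^ 2 ≤ 0 := by
    by_contra hh
    push Not at hh
    have := mul_pos h3 hh
    linarith
  have : ‖a‖ = 0 := by nlinarith [norm_nonneg a]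
  exact norm_eq_zero.1 this

open Filter Topology MeasureTheory in
theorem jensen_alexandrov {E : Type*} [NormedAddCommGroup E] [InnerProductSpace ℝ E]
    [FiniteDimensional ℝ E] (G : E → ℝ) (C : ℝ) (hC : 0 < C)
    (hsupp : ∀ z, ∃ p : E, ∀ y, G z + ⟪p, y - z⟫ - C / 2 * ‖y - z‖ ^ 2 ≤ G y)
    (ν : ℝ) (hν : 0 < ν)
    (hmax : ∀ q : E, ‖q‖ < ν → ∃ z, ∀ y, G y ≤ G z + ⟪q, y - z⟫) :
    ∃ (q z : E) (A : E →L[ℝ] E), ‖q‖ < ν ∧ (∀ y, G y ≤ G z + ⟪q, y - z⟫) ∧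
      ∀ κ > 0, ∀ᶠ h in 𝓝 (0 : E),
        |G (z + h) - G z - ⟪q, h⟫ - 1 / 2 * ⟪A h, h⟫| ≤ κ * ‖h‖ ^ 2 := by
  choose p hp using hsupp
  -- monotonicity
  have mono : ∀ z y, -(C * ‖y - z‖ ^ 2) ≤ ⟪p y - p z, y - z⟫ := by
    intro z y
    have h1 := hp z y
    have h2 := hp y z
    rw [← neg_sub y z, inner_neg_right, norm_neg] at h2
    rw [inner_sub_left]; linarith
  set e : E → E := fun z => z + (1 / (2 * C)) • p z with he
  have anti : ∀ z y, ‖y - z‖ ≤ 2 * ‖e y - e z‖ := by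
    intro z y
    have h1 : e y - e z = (y - z) + (1 / (2 * C)) • (p y - p z) := by
      simp only [he]; rw [smul_sub]; abel
    have h2 : ⟪e y - e z, y - z⟫ = ‖y - z‖ ^ 2 + 1 / (2 * C) * ⟪p y - p z, y - z⟫ := by
      rw [h1, inner_add_left, real_inner_self_eq_norm_sq, inner_smul_left]; simp
    have h3 : 1 / (2 * C) * (-(C * ‖y - z‖ ^ 2)) ≤ 1 / (2 * C) * ⟪p y - p z, y - z⟫ := by
      gcongr; exact mono z y
    have h4 : 1 / (2 * C) * (-(C * ‖y - z‖ ^ 2)) = - (‖y - z‖ ^ 2 / 2) := by field_simp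
    have h5 := real_inner_le_norm (e y - e z) (y - z)
    have h6 : ‖y - z‖ ^ 2 / 2 ≤ ‖e y - e z‖ * ‖y - z‖ := by linarith
    rcases (norm_nonneg (y - z)).eq_or_lt with h | h
    · rw [← h]; positivity
    · nlinarith
  have einj : Function.Injective e := by
    intro y z h
    have := anti z y
    rw [h, sub_self, norm_zero, mul_zero] at this
    exact sub_eq_zero.1 (norm_le_zero_iff.1 this)
  have hL : LipschitzOnWith 2 (Function.invFun e) (range e) := by
    refine LipschitzOnWith.of_dist_le_mul ?_
    rintro _ ⟨y, rfl⟩ _ ⟨z, rfl⟩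
    rw [Function.leftInverse_invFun einj, Function.leftInverse_invFun einj, dist_eq_norm, dist_eq_norm]
    simpa using anti z y
  obtain ⟨J, hJL, hJ⟩ := hL.extend_finite_dimension
  have hJe : ∀ z, J (e z) = z := fun z => by
    rw [← hJ (mem_range_self z), Function.leftInverse_invFun einj]
  -- slopes
  have slope : ∀ q z, (∀ y, G y ≤ G z + ⟪q, y - z⟫) → p z = q := by
    intro q z hq
    rw [← sub_eq_zero]
    refine eq_zero_of_inner_le_sq _ (C / 2) (by positivity) fun h => ?_
    have h1 := hp z (z + h)
    have h2 := hq (z + h)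
    rw [add_sub_cancel_left] at h1 h2
    rw [inner_sub_left]; linarith
  -- measure theory
  obtain ⟨q, z, hqν, hq, hdiff⟩ : ∃ q z, ‖q‖ < ν ∧ (∀ y, G y ≤ G z + ⟪q, y - z⟫) ∧
      DifferentiableAt ℝ J (e z) := by
    by_contra hcon
    push Not at hcon
    borelize E
    let μ : Measure E := μH[Module.finrank ℝ E]
    have hae : ∀ᵐ x ∂μ, DifferentiableAt ℝ J x := hJL.ae_differentiableAt
    have hnull : μ {x | ¬ DifferentiableAt ℝ J x} = 0 := hae
    let k : E → E := fun x => (2 * C) • (x - J x)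
    obtain ⟨K, hK⟩ : ∃ K, LipschitzWith K k :=
      ⟨_, (lipschitzWith_smul (2 * C)).comp (LipschitzWith.id.sub hJL)⟩
    have himg : μ (k '' {x | ¬ DifferentiableAt ℝ J x}) = 0 := by
      refine le_antisymm (le_trans (hK.hausdorffMeasure_image_le (by positivity) _) ?_) zero_le
      change _ * μ _ ≤ 0
      rw [hnull, mul_zero]
    have hsub : Metric.ball (0 : E) ν ⊆ k '' {x | ¬ DifferentiableAt ℝ J x} := by
      intro q hq
      rw [mem_ball_zero_iff] at hq
      obtain ⟨z, hz⟩ := hmax q hq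
      refine ⟨e z, hcon q z hq hz, ?_⟩
      simp only [k, hJe]
      simp only [he, slope q z hz, add_sub_cancel_left, smul_smul]
      rw [mul_one_div_cancel (by positivity), one_smul]
    have : 0 < μ (Metric.ball (0 : E) ν) := Metric.measure_ball_pos μ 0 hν
    exact absurd (measure_mono_null hsub himg) this.ne'
  have hpz := slope q z hq
  -- Lipschitz estimate of subgradients at the contact point
  have hlip : ∀ h, ‖p (z + h) - q‖ ≤ C * ‖h‖ := by
    intro h
    set d := p (z + h) - q with hd
    have a1 := hp (z + h) (z + h + (1 / C) • d)
    have a2 := hq (z + h + (1 / C) • d)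
    have a3 := hp z (z + h)
    rw [hpz] at a3
    rw [add_sub_cancel_left] at a1 a3
    have e1 : z + h + (1 / C) • d - z = h + (1 / C) • d := by abel
    rw [e1, inner_add_right] at a2
    have e2 : ⟪p (z + h), (1 / C) • d⟫ - ⟪q, (1 / C) • d⟫ = 1 / C * ‖d‖ ^ 2 := by
      rw [← inner_sub_left, ← hd, inner_smul_right, real_inner_self_eq_norm_sq]
    have e3 : C / 2 * ‖(1 / C) • d‖ ^ 2 = 1 / C * ‖d‖ ^ 2 / 2 := by
      rw [norm_smul, Real.norm_of_nonneg (by positivity)]; field_simp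
    rw [e3] at a1
    have e4 : 1 / C * ‖d‖ ^ 2 ≤ C * ‖h‖ ^ 2 := by linarith
    have e5 : ‖d‖ ^ 2 ≤ (C * ‖h‖) ^ 2 := by
      rw [one_div, inv_mul_le_iff₀ hC] at e4; nlinarith
    exact (abs_le_of_sq_le_sq' e5 (by positivity)).2
  set M := fderiv ℝ J (e z) with hM
  have hMd : HasFDerivAt J M (e z) := hdiff.hasFDerivAt
  set k : E → E := fun h => e (z + h) - e z with hk
  have hkeq : ∀ h, k h = h + (1 / (2 * C)) • (p (z + h) - q) := by
    intro h; simp only [hk, he, hpz]; rw [smul_sub]; abel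
  have hkn : ∀ h, ‖k h‖ ≤ 2 * ‖h‖ := by
    intro h
    rw [hkeq]
    refine (norm_add_le _ _).trans ?_
    rw [norm_smul, Real.norm_of_nonneg (by positivity)]
    have : 1 / (2 * C) * ‖p (z + h) - q‖ ≤ 1 / (2 * C) * (C * ‖h‖) := by gcongr; exact hlip h
    have e1 : 1 / (2 * C) * (C * ‖h‖) = ‖h‖ / 2 := by field_simp
    linarith [norm_nonneg h]
  have hko : ∀ κ > 0, ∀ᶠ h in 𝓝 (0 : E), ‖h - M (k h)‖ ≤ κ * ‖h‖ := by
    intro κ hκ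
    have h1 := (hasFDerivAt_iff_isLittleO_nhds_zero.1 hMd).def (half_pos hκ)
    have hk0 : Tendsto k (𝓝 0) (𝓝 0) := by
      refine squeeze_zero_norm hkn ?_
      have : Tendsto (fun h : E => 2 * ‖h‖) (𝓝 0) (𝓝 (2 * ‖(0 : E)‖)) :=
        (continuous_const.mul continuous_norm).tendsto _
      simpa using this
    filter_upwards [hk0.eventually h1] with h hh
    have e1 : e z + k h = e (z + h) := by simp [hk]
    rw [e1, hJe, hJe, add_sub_cancel_left] at hh
    refine hh.trans ?_
    nlinarith [hkn h]
  have hsurj : Function.Surjective M := by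
    have : (LinearMap.range (M : E →ₗ[ℝ] E))ᗮ = ⊥ := by
      rw [Submodule.eq_bot_iff]
      intro v hv
      by_contra hv0
      have hvpos : 0 < ‖v‖ := norm_pos_iff.2 hv0
      obtain ⟨ρ, hρ, hb⟩ := Metric.eventually_nhds_iff.1 (hko (1 / 2) (by norm_num))
      set s := ρ / (2 * ‖v‖) with hs
      have hs0 : 0 < s := by positivity
      have h1 := hb (y := s • v) (by
        rw [dist_zero_right, norm_smul, Real.norm_of_nonneg hs0.le, hs]; field_simp; norm_num)
      have h2 : ⟪s • v - M (k (s • v)), v⟫ = s * ‖v‖ ^ 2 := by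
        rw [inner_sub_left, inner_smul_left, real_inner_self_eq_norm_sq]
        have : ⟪M (k (s • v)), v⟫ = 0 := by
          rw [Submodule.mem_orthogonal] at hv
          exact hv _ ⟨k (s • v), rfl⟩
        rw [this]; simp
      have h3 := real_inner_le_norm (s • v - M (k (s • v))) v
      rw [h2] at h3
      rw [norm_smul, Real.norm_of_nonneg hs0.le] at h1
      have h4 : s * ‖v‖ ^ 2 ≤ 1 / 2 * (s * ‖v‖) * ‖v‖ := h3.trans (by gcongr)
      have : 0 < s * ‖v‖ ^ 2 := by positivity
      nlinarith
    rw [Submodule.orthogonal_eq_bot_iff] at this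
    exact LinearMap.range_eq_top.1 this
  have hinj : Function.Injective M :=
    (LinearMap.injective_iff_surjective (f := (M : E →ₗ[ℝ] E))).2 hsurj
  let Me : E ≃L[ℝ] E := (LinearEquiv.ofBijective (M : E →ₗ[ℝ] E) ⟨hinj, hsurj⟩).toContinuousLinearEquiv
  have hMe : ∀ v, Me.symm (M v) = v := fun v => Me.symm_apply_apply v
  set N : E →L[ℝ] E := (Me.symm : E →L[ℝ] E) with hN
  have hNM : ∀ v, N (M v) = v := hMe
  set A : E →L[ℝ] E := (2 * C) • (N - ContinuousLinearMap.id ℝ E) with hA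
  refine ⟨q, z, A, hqν, hq, ?_⟩
  have := taylor_of_subgrad G C hC p hp z A ?_
  · rw [hpz] at this; exact this
  intro κ hκ
  have hden : 0 < 2 * C * (‖N‖ + 1) := by positivity
  filter_upwards [hko (κ / (2 * C * (‖N‖ + 1))) (by positivity)] with h hh
  have e0 : p (z + h) - p z = (2 * C) • (k h - h) := by
    rw [hkeq, hpz, add_sub_cancel_left, smul_smul, mul_one_div_cancel (by positivity), one_smul]
  have e1 : p (z + h) - p z - A h = -((2 * C) • N (h - M (k h))) := by
    rw [e0, map_sub, hNM, hA]
    simp only [_root_.smul_apply, _root_.sub_apply, ContinuousLinearMap.id_apply]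
    rw [← smul_neg, ← smul_sub]; congr 1; abel
  rw [e1, norm_neg, norm_smul, Real.norm_of_nonneg (by positivity)]
  calc 2 * C * ‖N (h - M (k h))‖ ≤ 2 * C * (‖N‖ * (κ / (2 * C * (‖N‖ + 1)) * ‖h‖)) := by
        gcongr; exact (N.le_opNorm _).trans (by gcongr)
    _ ≤ 2 * C * ((‖N‖ + 1) * (κ / (2 * C * (‖N‖ + 1)) * ‖h‖)) := by gcongr; linarith
    _ = κ * ‖h‖ := by field_simp

lemma phi_expand {E : Type*} [NormedAddCommGroup E] [InnerProductSpace ℝ E]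
    (Λ : E →L[ℝ] E) (hsym : ∀ x y, ⟪Λ x, y⟫ = ⟪x, Λ y⟫) (β : ℝ) (z ζ h k : E) :
    1 / 2 * ⟪Λ ((z + h) - (ζ + k)), (z + h) - (ζ + k)⟫ + β * (‖z + h‖ ^ 2 + ‖ζ + k‖ ^ 2)
    = 1 / 2 * ⟪Λ (z - ζ), z - ζ⟫ + β * (‖z‖ ^ 2 + ‖ζ‖ ^ 2)
      + ⟪Λ (z - ζ) + (2 * β) • z, h⟫ + ⟪-Λ (z - ζ) + (2 * β) • ζ, k⟫
      + 1 / 2 * ⟪Λ (h - k), h - k⟫ + β * (‖h‖ ^ 2 + ‖k‖ ^ 2) := by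
  have e1 : (z + h) - (ζ + k) = (z - ζ) + (h - k) := by abel
  rw [e1, map_add, inner_add_left, inner_add_right, inner_add_right]
  have e2 : ⟪Λ (h - k), z - ζ⟫ = ⟪Λ (z - ζ), h - k⟫ := by
    rw [hsym, real_inner_comm]
  rw [e2, norm_add_sq_real, norm_add_sq_real, inner_add_left, inner_add_left, inner_neg_left,
    inner_smul_left, inner_smul_left, inner_sub_right (Λ (z - ζ)) h k]
  simp only [conj_trivial]
  ring

set_option maxHeartbeats 1000000 in
open Filter Topology in
theorem theorem_on_sums {E : Type*} [NormedAddCommGroup E] [InnerProductSpace ℝ E]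
    [FiniteDimensional ℝ E] (F1 F2 : E → ℝ) (hc1 : Continuous F1) (hc2 : Continuous F2)
    (B : ℝ) (hB1 : ∀ x, F1 x ≤ B) (hB2 : ∀ x, F2 x ≤ B) (C : ℝ) (hC : 0 < C)
    (hs1 : ∀ z, ∃ p : E, ∀ y, F1 z + ⟪p, y - z⟫ - C / 2 * ‖y - z‖ ^ 2 ≤ F1 y)
    (hs2 : ∀ z, ∃ p : E, ∀ y, F2 z + ⟪p, y - z⟫ - C / 2 * ‖y - z‖ ^ 2 ≤ F2 y)
    (Λ : E →L[ℝ] E) (hsym : ∀ x y, ⟪Λ x, y⟫ = ⟪x, Λ y⟫) (hpos : ∀ x, 0 ≤ ⟪Λ x, x⟫)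
    (β ν : ℝ) (hβ : 0 < β) (hν : 0 < ν) :
    ∃ (z ζ q1 q2 : E) (A1 A2 : E →L[ℝ] E), ‖q1‖ ≤ ν ∧ ‖q2‖ ≤ ν ∧
      (∀ h k, F1 (z + h) + F2 (ζ + k) ≤ F1 z + F2 ζ
        + ⟪Λ (z - ζ) + (2 * β) • z + q1, h⟫ + ⟪-Λ (z - ζ) + (2 * β) • ζ + q2, k⟫
        + 1 / 2 * ⟪Λ (h - k), h - k⟫ + β * (‖h‖ ^ 2 + ‖k‖ ^ 2)) ∧
      (∀ κ > 0, ∀ᶠ h in 𝓝 (0 : E), F1 (z + h) ≤ F1 z + ⟪Λ (z - ζ) + (2 * β) • z + q1, h⟫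
        + 1 / 2 * ⟪A1 h, h⟫ + κ * ‖h‖ ^ 2) ∧
      (∀ κ > 0, ∀ᶠ h in 𝓝 (0 : E), F2 (ζ + h) ≤ F2 ζ + ⟪-Λ (z - ζ) + (2 * β) • ζ + q2, h⟫
        + 1 / 2 * ⟪A2 h, h⟫ + κ * ‖h‖ ^ 2) ∧
      (∀ h k, ⟪A1 h, h⟫ + ⟪A2 k, k⟫ ≤ ⟪Λ (h - k), h - k⟫ + 2 * β * (‖h‖ ^ 2 + ‖k‖ ^ 2)) := by
  let G : WithLp 2 (E × E) → ℝ := fun Z => F1 Z.fst + F2 Z.snd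
    - (1 / 2 * ⟪Λ (Z.fst - Z.snd), Z.fst - Z.snd⟫ + β * (‖Z.fst‖ ^ 2 + ‖Z.snd‖ ^ 2))
  have hGadd : ∀ Z H : WithLp 2 (E × E), G (Z + H) = F1 (Z.fst + H.fst) + F2 (Z.snd + H.snd)
      - (1 / 2 * ⟪Λ (Z.fst - Z.snd), Z.fst - Z.snd⟫ + β * (‖Z.fst‖ ^ 2 + ‖Z.snd‖ ^ 2)
      + ⟪Λ (Z.fst - Z.snd) + (2 * β) • Z.fst, H.fst⟫ + ⟪-Λ (Z.fst - Z.snd) + (2 * β) • Z.snd, H.snd⟫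
      + 1 / 2 * ⟪Λ (H.fst - H.snd), H.fst - H.snd⟫ + β * (‖H.fst‖ ^ 2 + ‖H.snd‖ ^ 2)) := by
    intro Z H
    simp only [G, WithLp.add_fst, WithLp.add_snd]
    rw [phi_expand Λ hsym]
  have hGc : Continuous G := by
    have c1 : Continuous fun Z : WithLp 2 (E × E) => Z.fst := by fun_prop
    have c2 : Continuous fun Z : WithLp 2 (E × E) => Z.snd := by fun_prop
    simp only [G]
    fun_prop
  have hΛn : ∀ h k : E, 1 / 2 * ⟪Λ (h - k), h - k⟫ ≤ ‖Λ‖ * (‖h‖ ^ 2 + ‖k‖ ^ 2) := by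
    intro h k
    have h1 : ⟪Λ (h - k), h - k⟫ ≤ ‖Λ‖ * ‖h - k‖ * ‖h - k‖ :=
      (real_inner_le_norm _ _).trans (by gcongr; exact Λ.le_opNorm _)
    have h2 : ‖h - k‖ * ‖h - k‖ ≤ 2 * (‖h‖ ^ 2 + ‖k‖ ^ 2) := by
      have := norm_sub_le h k
      nlinarith [norm_nonneg (h - k), norm_nonneg h, norm_nonneg k, sq_nonneg (‖h‖ - ‖k‖)]
    nlinarith [norm_nonneg Λ]
  have hJA := jensen_alexandrov G (C + 2 * ‖Λ‖ + 2 * β) (by positivity) ?_ ν hν ?_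
  rotate_left
  · intro Z
    obtain ⟨p1, hp1⟩ := hs1 Z.fst
    obtain ⟨p2, hp2⟩ := hs2 Z.snd
    refine ⟨WithLp.toLp 2 (p1 - (Λ (Z.fst - Z.snd) + (2 * β) • Z.fst),
      p2 - (-Λ (Z.fst - Z.snd) + (2 * β) • Z.snd)), fun Y => ?_⟩
    obtain ⟨H, rfl⟩ : ∃ H, Y = Z + H := ⟨Y - Z, by abel⟩
    rw [hGadd, add_sub_cancel_left, WithLp.prod_inner_apply, WithLp.prod_norm_sq_eq_of_L2]
    have a1 := hp1 (Z.fst + H.fst)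
    have a2 := hp2 (Z.snd + H.snd)
    rw [add_sub_cancel_left] at a1 a2
    have a3 := hΛn H.fst H.snd
    simp only [G]
    rw [inner_sub_left, inner_sub_left]
    change _ + (⟪p1, H.fst⟫ - _ + (⟪p2, H.snd⟫ - _)) - _ ≤ _
    change _ + (_ - ⟪Λ (Z.fst - Z.snd) + (2 * β) • Z.fst, H.fst⟫ + (_ - ⟪-Λ (Z.fst - Z.snd) + (2 * β) • Z.snd, H.snd⟫)) - _ ≤ _
    linarith
  · intro q hq
    have hc : Continuous fun Z => G Z - ⟪q, Z⟫ := by fun_prop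
    obtain ⟨Z, hZ⟩ := hc.exists_forall_ge' 0 (by
      have ht := tendsto_norm_cocompact_atTop (E := WithLp 2 (E × E))
      set R := (ν + |2 * B - (G 0 - ⟪q, 0⟫)|) / β + 1 with hR
      have hR1 : 1 ≤ R := by rw [hR]; have : 0 ≤ (ν + |2 * B - (G 0 - ⟪q, 0⟫)|) / β := by positivity
                             linarith
      filter_upwards [ht.eventually_ge_atTop R] with Y hY
      have b1 : G Y ≤ 2 * B - β * ‖Y‖ ^ 2 := by
        simp only [G]
        rw [WithLp.prod_norm_sq_eq_of_L2]
        linarith [hB1 Y.fst, hB2 Y.snd, hpos (Y.fst - Y.snd)]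
      have b2 : -⟪q, Y⟫ ≤ ν * ‖Y‖ := by
        have := (abs_le.1 (abs_real_inner_le_norm q Y)).1
        nlinarith [norm_nonneg Y]
      have b3 : ν + |2 * B - (G 0 - ⟪q, 0⟫)| ≤ β * ‖Y‖ := by
        have : (ν + |2 * B - (G 0 - ⟪q, 0⟫)|) / β ≤ ‖Y‖ := by linarith
        rw [div_le_iff₀ hβ] at this; linarith
      have b4 := le_abs_self (2 * B - (G 0 - ⟪q, 0⟫))
      have b5 : |2 * B - (G 0 - ⟪q, 0⟫)| ≤ |2 * B - (G 0 - ⟪q, 0⟫)| * ‖Y‖ :=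
        le_mul_of_one_le_right (abs_nonneg _) (by linarith)
      nlinarith [norm_nonneg Y])
    refine ⟨Z, fun Y => ?_⟩
    have := hZ Y
    rw [inner_sub_right]; linarith
  obtain ⟨q, Z, D, hq, hmax, hexp⟩ := hJA
  have hq2 : ‖q.fst‖ ^ 2 + ‖q.snd‖ ^ 2 = ‖q‖ ^ 2 := (WithLp.prod_norm_sq_eq_of_L2 q).symm
  have hq1' : ‖q.fst‖ ≤ ‖q‖ := abs_le_of_sq_le_sq' (by nlinarith [sq_nonneg ‖q.snd‖]) (norm_nonneg _) |>.2
  have hq2' : ‖q.snd‖ ≤ ‖q‖ := abs_le_of_sq_le_sq' (by nlinarith [sq_nonneg ‖q.fst‖]) (norm_nonneg _) |>.2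
  set z := Z.fst with hz
  set ζ := Z.snd with hζ
  let i1 : E →L[ℝ] WithLp 2 (E × E) := LinearMap.toContinuousLinearMap
    { toFun := fun h => WithLp.toLp 2 (h, 0)
      map_add' := fun x y => by simp [← WithLp.toLp_add]
      map_smul' := fun c x => by simp [← WithLp.toLp_smul] }
  let i2 : E →L[ℝ] WithLp 2 (E × E) := LinearMap.toContinuousLinearMap
    { toFun := fun h => WithLp.toLp 2 (0, h)
      map_add' := fun x y => by simp [← WithLp.toLp_add]
      map_smul' := fun c x => by simp [← WithLp.toLp_smul] }
  let j1 : WithLp 2 (E × E) →L[ℝ] E := LinearMap.toContinuousLinearMap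
    { toFun := fun H => H.fst
      map_add' := fun x y => by simp
      map_smul' := fun c x => by simp }
  let j2 : WithLp 2 (E × E) →L[ℝ] E := LinearMap.toContinuousLinearMap
    { toFun := fun H => H.snd
      map_add' := fun x y => by simp
      map_smul' := fun c x => by simp }
  have i1f : ∀ h, (i1 h).fst = h := fun _ => rfl
  have i1s : ∀ h, (i1 h).snd = 0 := fun _ => rfl
  have i2f : ∀ h, (i2 h).fst = 0 := fun _ => rfl
  have i2s : ∀ h, (i2 h).snd = h := fun _ => rfl
  have i1n : ∀ h, ‖i1 h‖ ^ 2 = ‖h‖ ^ 2 := fun h => by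
    rw [WithLp.prod_norm_sq_eq_of_L2, i1f, i1s]; simp
  have i2n : ∀ h, ‖i2 h‖ ^ 2 = ‖h‖ ^ 2 := fun h => by
    rw [WithLp.prod_norm_sq_eq_of_L2, i2f, i2s]; simp
  have i1i : ∀ (Y : WithLp 2 (E × E)) h, ⟪Y, i1 h⟫ = ⟪Y.fst, h⟫ := fun Y h => by
    rw [WithLp.prod_inner_apply]; change ⟪Y.fst, h⟫ + ⟪Y.snd, 0⟫ = _; simp
  have i2i : ∀ (Y : WithLp 2 (E × E)) h, ⟪Y, i2 h⟫ = ⟪Y.snd, h⟫ := fun Y h => by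
    rw [WithLp.prod_inner_apply]; change ⟪Y.fst, 0⟫ + ⟪Y.snd, h⟫ = _; simp
  let A1 : E →L[ℝ] E := j1 ∘L D ∘L i1 + Λ + (2 * β) • ContinuousLinearMap.id ℝ E
  let A2 : E →L[ℝ] E := j2 ∘L D ∘L i2 + Λ + (2 * β) • ContinuousLinearMap.id ℝ E
  have hA1 : ∀ h, ⟪A1 h, h⟫ = ⟪D (i1 h), i1 h⟫ + ⟪Λ h, h⟫ + 2 * β * ‖h‖ ^ 2 := by
    intro h
    have : A1 h = (D (i1 h)).fst + Λ h + (2 * β) • h := rfl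
    rw [this, inner_add_left, inner_add_left, inner_smul_left, real_inner_self_eq_norm_sq, i1i]; simp
  have hA2 : ∀ h, ⟪A2 h, h⟫ = ⟪D (i2 h), i2 h⟫ + ⟪Λ h, h⟫ + 2 * β * ‖h‖ ^ 2 := by
    intro h
    have : A2 h = (D (i2 h)).snd + Λ h + (2 * β) • h := rfl
    rw [this, inner_add_left, inner_add_left, inner_smul_left, real_inner_self_eq_norm_sq, i2i]; simp
  have hGZ : G Z = F1 z + F2 ζ - (1 / 2 * ⟪Λ (z - ζ), z - ζ⟫ + β * (‖z‖ ^ 2 + ‖ζ‖ ^ 2)) := rfl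
  have ex1 : ∀ κ > 0, ∀ᶠ h in 𝓝 (0 : E), |F1 (z + h) - F1 z - ⟪Λ (z - ζ) + (2 * β) • z + q.fst, h⟫
        - 1 / 2 * ⟪A1 h, h⟫| ≤ κ * ‖h‖ ^ 2 := by
    intro κ hκ
    have ht : Tendsto i1 (𝓝 0) (𝓝 0) := by simpa using i1.continuous.tendsto 0
    filter_upwards [ht.eventually (hexp κ hκ)] with h hh
    rw [i1n, hGadd, hGZ, i1f, i1s, i1i] at hh
    rw [hA1]
    convert hh using 2
    simp only [← hz, ← hζ]
    rw [inner_add_left _ q.fst]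
    simp
    ring
  have ex2 : ∀ κ > 0, ∀ᶠ h in 𝓝 (0 : E), |F2 (ζ + h) - F2 ζ - ⟪-Λ (z - ζ) + (2 * β) • ζ + q.snd, h⟫
        - 1 / 2 * ⟪A2 h, h⟫| ≤ κ * ‖h‖ ^ 2 := by
    intro κ hκ
    have ht : Tendsto i2 (𝓝 0) (𝓝 0) := by simpa using i2.continuous.tendsto 0
    filter_upwards [ht.eventually (hexp κ hκ)] with h hh
    rw [i2n, hGadd, hGZ, i2f, i2s, i2i] at hh
    rw [hA2]
    convert hh using 2
    simp only [← hz, ← hζ]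
    rw [inner_add_left _ q.snd]
    simp
    ring
  have hm : ∀ h k, F1 (z + h) + F2 (ζ + k) ≤ F1 z + F2 ζ
        + ⟪Λ (z - ζ) + (2 * β) • z + q.fst, h⟫ + ⟪-Λ (z - ζ) + (2 * β) • ζ + q.snd, k⟫
        + 1 / 2 * ⟪Λ (h - k), h - k⟫ + β * (‖h‖ ^ 2 + ‖k‖ ^ 2) := by
    intro h k
    have := hmax (Z + WithLp.toLp 2 (h, k))
    rw [hGadd, hGZ, add_sub_cancel_left, WithLp.prod_inner_apply] at this
    change F1 (z + h) + F2 (ζ + k) - (_ + ⟪Λ (z - ζ) + (2 * β) • z, h⟫ + ⟪-Λ (z - ζ) + (2 * β) • ζ, k⟫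
      + 1 / 2 * ⟪Λ (h - k), h - k⟫ + β * (‖h‖ ^ 2 + ‖k‖ ^ 2)) ≤ _ + (⟪q.fst, h⟫ + ⟪q.snd, k⟫) at this
    rw [inner_add_left _ q.fst, inner_add_left _ q.snd]
    linarith
  refine ⟨z, ζ, q.fst, q.snd, A1, A2, hq1'.trans hq.le, hq2'.trans hq.le, hm, ?_, ?_, ?_⟩
  · intro κ hκ
    filter_upwards [ex1 κ hκ] with h hh
    linarith [(abs_le.1 hh).2]
  · intro κ hκ
    filter_upwards [ex2 κ hκ] with h hh
    linarith [(abs_le.1 hh).2]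
  · intro h k
    refine le_of_forall_pos_le_add fun e he => ?_
    set κ := e / (2 * (‖h‖ ^ 2 + ‖k‖ ^ 2 + 1)) with hκ
    have hκ0 : 0 < κ := by positivity
    have t1 : Tendsto (fun s : ℝ => s • h) (𝓝 0) (𝓝 0) := by
      have : Continuous fun s : ℝ => s • h := by fun_prop
      simpa using this.tendsto 0
    have t2 : Tendsto (fun s : ℝ => s • k) (𝓝 0) (𝓝 0) := by
      have : Continuous fun s : ℝ => s • k := by fun_prop
      simpa using this.tendsto 0
    obtain ⟨ρ, hρ, hb⟩ := Metric.eventually_nhds_iff.1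
      ((t1.eventually (ex1 κ hκ0)).and (t2.eventually (ex2 κ hκ0)))
    set s := ρ / 2 with hs
    have hs0 : 0 < s := by positivity
    obtain ⟨b1, b2⟩ := hb (y := s) (by rw [Real.dist_eq, sub_zero, abs_of_pos hs0]; linarith)
    have b3 := hm (s • h) (s • k)
    have b1 := (abs_le.1 b1).1
    have b2 := (abs_le.1 b2).1
    rw [← smul_sub] at b3
    simp only [map_smul, inner_smul_left, inner_smul_right, norm_smul, mul_pow, conj_trivial,
      Real.norm_of_nonneg hs0.le] at b1 b2 b3
    have c1 : s ^ 2 * (⟪A1 h, h⟫ + ⟪A2 k, k⟫) ≤ s ^ 2 * (⟪Λ (h - k), h - k⟫ + 2 * β * (‖h‖ ^ 2 + ‖k‖ ^ 2)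
        + 2 * κ * (‖h‖ ^ 2 + ‖k‖ ^ 2)) := by linarith only [b1, b2, b3]
    have c2 := le_of_mul_le_mul_left c1 (by positivity)
    have c3 : 2 * κ * (‖h‖ ^ 2 + ‖k‖ ^ 2) ≤ e := by
      have : 2 * κ * (‖h‖ ^ 2 + ‖k‖ ^ 2 + 1) = e := by rw [hκ]; field_simp
      linarith only [this, hκ0]
    linarith

open Filter Topology in
lemma supconv_exists {E : Type*} [NormedAddCommGroup E] [InnerProductSpace ℝ E]
    [FiniteDimensional ℝ E] (f : E → ℝ) (hc : Continuous f) (B : ℝ) (hB : ∀ x, |f x| ≤ B)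
    (lam : ℝ) (hl : 0 < lam) :
    ∃ (F : E → ℝ) (m : E → E), (∀ z y, f y - lam / 2 * ‖y - z‖ ^ 2 ≤ F z) ∧
      (∀ z, F z = f (m z) - lam / 2 * ‖m z - z‖ ^ 2) := by
  have key : ∀ z, ∃ w, ∀ y, f y - lam / 2 * ‖y - z‖ ^ 2 ≤ f w - lam / 2 * ‖w - z‖ ^ 2 := by
    intro z
    have hcont : Continuous fun y => f y - lam / 2 * ‖y - z‖ ^ 2 := by fun_prop
    apply hcont.exists_forall_ge' z
    have ht := tendsto_norm_cocompact_atTop (E := E)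
    filter_upwards [ht.eventually_ge_atTop (‖z‖ + 1 + 4 * B / lam)] with y hy
    have hB0 : 0 ≤ B := (abs_nonneg _).trans (hB z)
    have h1 := (abs_le.1 (hB y)).2
    have h2 := (abs_le.1 (hB z)).1
    have h3 : 1 + 4 * B / lam ≤ ‖y - z‖ := by
      have := norm_sub_norm_le y z; linarith
    have h4 : 4 * B / lam ≤ ‖y - z‖ ^ 2 := by
      have : 0 ≤ 4 * B / lam := by positivity
      nlinarith
    rw [div_le_iff₀ hl] at h4
    simp only [sub_self, norm_zero]
    nlinarith
  choose m hm using key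
  exact ⟨fun z => f (m z) - lam / 2 * ‖m z - z‖ ^ 2, m, fun z y => hm z y, fun z => rfl⟩

lemma supconv_props {E : Type*} [NormedAddCommGroup E] [InnerProductSpace ℝ E]
    (f : E → ℝ) (B : ℝ) (hB : ∀ x, |f x| ≤ B)
    (lam : ℝ) (hl : 0 < lam) (F : E → ℝ) (m : E → E)
    (h1 : ∀ z y, f y - lam / 2 * ‖y - z‖ ^ 2 ≤ F z)
    (h2 : ∀ z, F z = f (m z) - lam / 2 * ‖m z - z‖ ^ 2) :
    (∀ z, f z ≤ F z) ∧ (∀ z, F z ≤ f (m z)) ∧ (∀ z, F z ≤ B) ∧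
    (∀ z, ‖m z - z‖ ^ 2 ≤ 4 * B / lam) ∧
    (∀ z y, F z + ⟪lam • (m z - z), y - z⟫ - lam / 2 * ‖y - z‖ ^ 2 ≤ F y) ∧
    (∀ z h, f (m z + h) - f (m z) ≤ F (z + h) - F z) ∧ Continuous F := by
  have a1 : ∀ z, f z ≤ F z := fun z => by simpa using h1 z z
  have a2 : ∀ z, F z ≤ f (m z) := fun z => by
    rw [h2]; have : 0 ≤ lam / 2 * ‖m z - z‖ ^ 2 := by positivity
    linarith
  have a3 : ∀ z, ‖m z - z‖ ^ 2 ≤ 4 * B / lam := fun z => by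
    rw [le_div_iff₀ hl]
    have b1 := a1 z
    rw [h2] at b1
    have := (abs_le.1 (hB z)).1
    have := (abs_le.1 (hB (m z))).2
    linarith
  have a4 : ∀ z y, F z + ⟪lam • (m z - z), y - z⟫ - lam / 2 * ‖y - z‖ ^ 2 ≤ F y := by
    intro z y
    have b1 := h1 y (m z)
    have e : m z - y = (m z - z) - (y - z) := by abel
    rw [e, norm_sub_sq_real] at b1
    rw [h2, inner_smul_left]
    simp only [conj_trivial]
    linarith
  refine ⟨a1, a2, fun z => (a2 z).trans ((le_abs_self _).trans (hB _)), a3, a4, ?_, ?_⟩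
  · intro z h
    have b1 := h1 (z + h) (m z + h)
    rw [h2 z]
    have e : m z + h - (z + h) = m z - z := by abel
    rw [e] at b1
    linarith
  · have hlow : ∀ z y, F z - F y ≤ (lam * Real.sqrt (4 * B / lam)) * ‖y - z‖ + lam / 2 * ‖y - z‖ ^ 2 := by
      intro z y
      have b1 := a4 z y
      have b2 := (abs_le.1 (abs_real_inner_le_norm (lam • (m z - z)) (y - z))).1
      rw [norm_smul, Real.norm_of_nonneg hl.le] at b2
      have b3 : ‖m z - z‖ ≤ Real.sqrt (4 * B / lam) := Real.le_sqrt_of_sq_le (a3 z)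
      have b4 : lam * ‖m z - z‖ * ‖y - z‖ ≤ lam * Real.sqrt (4 * B / lam) * ‖y - z‖ := by gcongr
      linarith
    rw [continuous_iff_continuousAt]
    intro z
    rw [ContinuousAt, tendsto_iff_dist_tendsto_zero]
    have hb : Filter.Tendsto (fun y : E => (lam * Real.sqrt (4 * B / lam)) * ‖y - z‖ + lam / 2 * ‖y - z‖ ^ 2)
        (nhds z) (nhds 0) := by
      have : Continuous (fun y : E => (lam * Real.sqrt (4 * B / lam)) * ‖y - z‖ + lam / 2 * ‖y - z‖ ^ 2) := by
        fun_prop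
      simpa using this.tendsto z
    refine squeeze_zero (fun _ => dist_nonneg) (fun y => ?_) hb
    rw [Real.dist_eq, abs_le]
    have c1 := hlow z y
    have c2 := hlow y z
    rw [norm_sub_rev z y] at c2
    constructor <;> linarith

open Filter Topology in
theorem doubling_general {E : Type*} [NormedAddCommGroup E] [InnerProductSpace ℝ E]
    [FiniteDimensional ℝ E] (f1 f2 : E → ℝ) (hc1 : Continuous f1) (hc2 : Continuous f2)
    (B : ℝ) (hB1 : ∀ x, |f1 x| ≤ B) (hB2 : ∀ x, |f2 x| ≤ B)
    (Λ : E →L[ℝ] E) (hsym : ∀ x y, ⟪Λ x, y⟫ = ⟪x, Λ y⟫) (hpos : ∀ x, 0 ≤ ⟪Λ x, x⟫)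
    (β ν lam : ℝ) (hβ : 0 < β) (hν : 0 < ν) (hl : 0 < lam) :
    ∃ (z ζ z' ζ' q1 q2 : E) (A1 A2 : E →L[ℝ] E), ‖q1‖ ≤ ν ∧ ‖q2‖ ≤ ν ∧
      ‖z' - z‖ ^ 2 ≤ 4 * B / lam ∧ ‖ζ' - ζ‖ ^ 2 ≤ 4 * B / lam ∧
      (∀ w, f1 w + f2 w ≤ f1 z' + f2 ζ' - 1 / 2 * ⟪Λ (z - ζ), z - ζ⟫
        + 2 * β * ‖w‖ ^ 2 - β * (‖z‖ ^ 2 + ‖ζ‖ ^ 2) + ν * (2 * ‖w‖ + ‖z‖ + ‖ζ‖)) ∧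
      (1 / 2 * ⟪Λ (z - ζ), z - ζ⟫ ≤ f1 z' - f1 (z' + (ζ - z)) + β * (‖ζ‖ ^ 2 - ‖z‖ ^ 2)
        + ν * ‖ζ - z‖) ∧
      (∀ κ > 0, ∀ᶠ h in 𝓝 (0 : E), f1 (z' + h) ≤ f1 z' + ⟪Λ (z - ζ) + (2 * β) • z + q1, h⟫
        + 1 / 2 * ⟪A1 h, h⟫ + κ * ‖h‖ ^ 2) ∧
      (∀ κ > 0, ∀ᶠ h in 𝓝 (0 : E), f2 (ζ' + h) ≤ f2 ζ' + ⟪-Λ (z - ζ) + (2 * β) • ζ + q2, h⟫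
        + 1 / 2 * ⟪A2 h, h⟫ + κ * ‖h‖ ^ 2) ∧
      (∀ h k, ⟪A1 h, h⟫ + ⟪A2 k, k⟫ ≤ ⟪Λ (h - k), h - k⟫ + 2 * β * (‖h‖ ^ 2 + ‖k‖ ^ 2)) := by
  obtain ⟨F1, m1, s1, t1⟩ := supconv_exists f1 hc1 B hB1 lam hl
  obtain ⟨F2, m2, s2, t2⟩ := supconv_exists f2 hc2 B hB2 lam hl
  obtain ⟨a1, b1, c1, d1, e1, g1, i1⟩ := supconv_props f1 B hB1 lam hl F1 m1 s1 t1
  obtain ⟨a2, b2, c2, d2, e2, g2, i2⟩ := supconv_props f2 B hB2 lam hl F2 m2 s2 t2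
  obtain ⟨z, ζ, q1, q2, A1, A2, hq1, hq2, hm, hx1, hx2, hA⟩ :=
    theorem_on_sums F1 F2 i1 i2 B c1 c2 lam hl (fun z => ⟨_, e1 z⟩) (fun z => ⟨_, e2 z⟩)
      Λ hsym hpos β ν hβ hν
  have hm' : ∀ Z Z', F1 Z + F2 Z' ≤ F1 z + F2 ζ + (1 / 2 * ⟪Λ (Z - Z'), Z - Z'⟫
      + β * (‖Z‖ ^ 2 + ‖Z'‖ ^ 2)) - (1 / 2 * ⟪Λ (z - ζ), z - ζ⟫ + β * (‖z‖ ^ 2 + ‖ζ‖ ^ 2))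
      + ν * ‖Z - z‖ + ν * ‖Z' - ζ‖ := by
    intro Z Z'
    have h1 := hm (Z - z) (Z' - ζ)
    have h2 := phi_expand Λ hsym β z ζ (Z - z) (Z' - ζ)
    rw [inner_add_left _ q1, inner_add_left _ q2] at h1
    have h3 : ⟪q1, Z - z⟫ ≤ ν * ‖Z - z‖ := (real_inner_le_norm _ _).trans (by gcongr)
    have h4 : ⟪q2, Z' - ζ⟫ ≤ ν * ‖Z' - ζ‖ := (real_inner_le_norm _ _).trans (by gcongr)
    rw [add_sub_cancel, add_sub_cancel] at h1 h2
    linarith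
  refine ⟨z, ζ, m1 z, m2 ζ, q1, q2, A1, A2, hq1, hq2, d1 z, d2 ζ, ?_, ?_, ?_, ?_, hA⟩
  · intro w
    have h1 := hm' w w
    rw [sub_self, map_zero, inner_zero_left] at h1
    have h2 : ν * ‖w - z‖ ≤ ν * (‖w‖ + ‖z‖) := by gcongr; exact norm_sub_le _ _
    have h3 : ν * ‖w - ζ‖ ≤ ν * (‖w‖ + ‖ζ‖) := by gcongr; exact norm_sub_le _ _
    linarith [a1 w, a2 w, b1 z, b2 ζ]
  · have h1 := hm' ζ ζ
    rw [sub_self, map_zero, inner_zero_left, norm_zero] at h1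
    have h2 := g1 z (ζ - z)
    rw [add_sub_cancel] at h2
    linarith
  · intro κ hκ
    filter_upwards [hx1 κ hκ] with h hh
    linarith [g1 z h]
  · intro κ hκ
    filter_upwards [hx2 κ hκ] with h hh
    linarith [g2 ζ h]

/-- One-sided second order jet in `(t,x)`. -/
def UpJet {X : Type*} [NormedAddCommGroup X] [InnerProductSpace ℝ X] (f : ℝ → X → ℝ)
    (t : ℝ) (x : X) (τ : ℝ) (q : X) (A : X →L[ℝ] X) : Prop :=
  ∃ c : ℝ, ∀ᶠ p in nhds ((t, x) : ℝ × X), f p.1 p.2 ≤ f t x + τ * (p.1 - t) + c * (p.1 - t) ^ 2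
    + ⟪q, p.2 - x⟫ + 1 / 2 * ⟪A (p.2 - x), p.2 - x⟫

/-- inclusion of the space variable -/
noncomputable def inX (X : Type*) [NormedAddCommGroup X] [InnerProductSpace ℝ X]
    [FiniteDimensional ℝ X] : X →L[ℝ] WithLp 2 (ℝ × X) := LinearMap.toContinuousLinearMap
    { toFun := fun h => WithLp.toLp 2 (0, h)
      map_add' := fun x y => by simp [← WithLp.toLp_add]
      map_smul' := fun c x => by simp [← WithLp.toLp_smul] }

/-- inclusion of the time variable -/
noncomputable def inT (X : Type*) [NormedAddCommGroup X] [InnerProductSpace ℝ X]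
    [FiniteDimensional ℝ X] : ℝ →L[ℝ] WithLp 2 (ℝ × X) := LinearMap.toContinuousLinearMap
    { toFun := fun h => WithLp.toLp 2 (h, 0)
      map_add' := fun x y => by simp [← WithLp.toLp_add]
      map_smul' := fun c x => by simp [← WithLp.toLp_smul] }

/-- projection to the space variable -/
noncomputable def prX (X : Type*) [NormedAddCommGroup X] [InnerProductSpace ℝ X]
    [FiniteDimensional ℝ X] : WithLp 2 (ℝ × X) →L[ℝ] X := LinearMap.toContinuousLinearMap
    { toFun := fun H => H.snd
      map_add' := fun x y => by simp
      map_smul' := fun c x => by simp }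

/-- the penalisation matrix -/
noncomputable def LamOp (X : Type*) [NormedAddCommGroup X] [InnerProductSpace ℝ X]
    [FiniteDimensional ℝ X] (η ε : ℝ) : WithLp 2 (ℝ × X) →L[ℝ] WithLp 2 (ℝ × X) :=
  LinearMap.toContinuousLinearMap
    { toFun := fun H => WithLp.toLp 2 (η⁻¹ * H.fst, ε⁻¹ • H.snd)
      map_add' := fun x y => by simp [← WithLp.toLp_add, mul_add]
      map_smul' := fun c x => by
        simp only [WithLp.smul_fst, WithLp.smul_snd, ← WithLp.toLp_smul, RingHom.id_apply]
        congr 1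
        ext
        · simp; ring
        · exact smul_comm _ _ _ }

section
variable {X : Type*} [NormedAddCommGroup X] [InnerProductSpace ℝ X] [FiniteDimensional ℝ X]

lemma pInner (P H : WithLp 2 (ℝ × X)) : ⟪P, H⟫ = P.fst * H.fst + ⟪P.snd, H.snd⟫ := by
  rw [WithLp.prod_inner_apply]
  change ⟪P.fst, H.fst⟫ + ⟪P.snd, H.snd⟫ = _
  simp [mul_comm]

lemma pNormSq (P : WithLp 2 (ℝ × X)) : ‖P‖ ^ 2 = P.fst ^ 2 + ‖P.snd‖ ^ 2 := by
  rw [WithLp.prod_norm_sq_eq_of_L2]; simp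

lemma pNorm_fst (P : WithLp 2 (ℝ × X)) : |P.fst| ≤ ‖P‖ := by
  apply abs_le_of_sq_le_sq _ (norm_nonneg _)
  rw [pNormSq]; nlinarith [sq_nonneg ‖P.snd‖]

lemma pNorm_snd (P : WithLp 2 (ℝ × X)) : ‖P.snd‖ ≤ ‖P‖ := by
  apply abs_le_of_sq_le_sq' _ (norm_nonneg _) |>.2
  rw [pNormSq]; nlinarith [sq_nonneg P.fst]

lemma pNorm_le (P : WithLp 2 (ℝ × X)) : ‖P‖ ≤ |P.fst| + ‖P.snd‖ := by
  apply abs_le_of_sq_le_sq' _ (by positivity) |>.2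
  rw [pNormSq, ← sq_abs P.fst]; nlinarith [abs_nonneg P.fst, norm_nonneg P.snd]

lemma upjet_of_expansion (f : ℝ → X → ℝ) (t : ℝ) (x : X) (p : WithLp 2 (ℝ × X))
    (A : WithLp 2 (ℝ × X) →L[ℝ] WithLp 2 (ℝ × X)) (κ : ℝ) (hκ : 0 < κ)
    (hexp : ∀ᶠ h in nhds (0 : WithLp 2 (ℝ × X)), f (t + h.fst) (x + h.snd) ≤ f t x + ⟪p, h⟫
      + 1 / 2 * ⟪A h, h⟫ + κ * ‖h‖ ^ 2) :
    UpJet f t x p.fst p.snd (prX X ∘L A ∘L inX X + (4 * κ) • ContinuousLinearMap.id ℝ X) := by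
  refine ⟨‖A‖ / 2 + ‖A‖ ^ 2 / (4 * κ) + κ, ?_⟩
  have ht : Filter.Tendsto (fun P : ℝ × X => inT X (P.1 - t) + inX X (P.2 - x)) (nhds (t, x)) (nhds 0) := by
    have : Continuous (fun P : ℝ × X => inT X (P.1 - t) + inX X (P.2 - x)) := by fun_prop
    simpa using this.tendsto (t, x)
  filter_upwards [ht.eventually hexp] with P hP
  set a := P.1 - t with ha
  set w := P.2 - x with hw
  have e1 : (inT X a + inX X w).fst = a := by
    change a + 0 = a; simp
  have e2 : (inT X a + inX X w).snd = w := by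
    change 0 + w = w; simp
  rw [e1, e2, pInner, pNormSq, e1, e2, ha, hw, add_sub_cancel, add_sub_cancel, ← ha, ← hw] at hP
  have n1 : ‖inT X a‖ = |a| := by
    have := pNormSq (inT X a)
    rw [show (inT X a).fst = a from rfl, show (inT X a).snd = 0 from rfl] at this
    rw [← abs_of_nonneg (norm_nonneg (inT X a)), ← sq_eq_sq_iff_abs_eq_abs]; simpa using this
  have n2 : ‖inX X w‖ = ‖w‖ := by
    have := pNormSq (inX X w)
    rw [show (inX X w).fst = 0 from rfl, show (inX X w).snd = w from rfl] at this
    rw [← abs_of_nonneg (norm_nonneg (inX X w)), ← abs_of_nonneg (norm_nonneg w), ← sq_eq_sq_iff_abs_eq_abs]; simpa using this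
  have k0 : ⟪A (inX X w), inX X w⟫ = ⟪(prX X ∘L A ∘L inX X) w, w⟫ := by
    rw [pInner, show (inX X w).fst = 0 from rfl, show (inX X w).snd = w from rfl]
    change _ = ⟪(A (inX X w)).snd, w⟫
    simp
  have kk : ∀ u v, ⟪A u, v⟫ ≤ ‖A‖ * ‖u‖ * ‖v‖ := fun u v =>
    (real_inner_le_norm _ _).trans (by gcongr; exact A.le_opNorm _)
  have k1 := kk (inT X a) (inT X a)
  have k2 := kk (inT X a) (inX X w)
  have k3 := kk (inX X w) (inT X a)
  rw [n1] at k1 k2 k3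
  rw [n2] at k2 k3
  have k4 : ⟪A (inT X a + inX X w), inT X a + inX X w⟫ = ⟪A (inT X a), inT X a⟫
     + ⟪A (inT X a), inX X w⟫ + ⟪A (inX X w), inT X a⟫ + ⟪A (inX X w), inX X w⟫ := by
    rw [map_add, inner_add_left, inner_add_right, inner_add_right]; ring
  have k5 : ‖A‖ * |a| * ‖w‖ ≤ κ * ‖w‖ ^ 2 + ‖A‖ ^ 2 / (4 * κ) * |a| ^ 2 := by
    have : κ * ‖w‖ ^ 2 + ‖A‖ ^ 2 / (4 * κ) * |a| ^ 2 - ‖A‖ * |a| * ‖w‖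
        = (2 * κ * ‖w‖ - ‖A‖ * |a|) ^ 2 / (4 * κ) := by field_simp; ring
    have : 0 ≤ (2 * κ * ‖w‖ - ‖A‖ * |a|) ^ 2 / (4 * κ) := by positivity
    linarith
  rw [_root_.add_apply, inner_add_left, ← k0, _root_.smul_apply, inner_smul_left]
  simp only [ContinuousLinearMap.id_apply, real_inner_self_eq_norm_sq, conj_trivial]
  rw [sq_abs] at k5
  have k6 : ‖A‖ * |a| * |a| = ‖A‖ * a ^ 2 := by rw [mul_assoc, abs_mul_abs_self]; ring
  linarith only [hP, k1, k2, k3, k4, k5, k6]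

end

section
variable {X : Type*} [NormedAddCommGroup X] [InnerProductSpace ℝ X] [FiniteDimensional ℝ X]

lemma continuous_of_modulus (f : ℝ → X → ℝ) (C : ℝ)
    (hm : ∀ t x s y, |f t x - f s y| ≤ C * (Real.sqrt |t - s| + ‖x - y‖)) :
    Continuous fun p : ℝ × X => f p.1 p.2 := by
  rw [continuous_iff_continuousAt]
  intro p
  rw [ContinuousAt, tendsto_iff_dist_tendsto_zero]
  have hb : Filter.Tendsto (fun y : ℝ × X => C * (Real.sqrt |y.1 - p.1| + ‖y.2 - p.2‖))
      (nhds p) (nhds 0) := by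
    have : Continuous (fun y : ℝ × X => C * (Real.sqrt |y.1 - p.1| + ‖y.2 - p.2‖)) := by
      fun_prop
    simpa using this.tendsto p
  exact squeeze_zero (fun _ => dist_nonneg) (fun y => hm _ _ _ _) hb

lemma doubling_tx (f1 f2 : ℝ → X → ℝ) (C : ℝ)
    (hm1 : ∀ t x s y, |f1 t x - f1 s y| ≤ C * (Real.sqrt |t - s| + ‖x - y‖))
    (hm2 : ∀ t x s y, |f2 t x - f2 s y| ≤ C * (Real.sqrt |t - s| + ‖x - y‖))
    (B : ℝ) (hB1 : ∀ t x, |f1 t x| ≤ B) (hB2 : ∀ t x, |f2 t x| ≤ B)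
    (η ε β ν lam κ : ℝ) (hη : 0 < η) (hε : 0 < ε) (hβ : 0 < β) (hν : 0 < ν) (hl : 0 < lam)
    (hκ : 0 < κ) :
    ∃ (z ζ q1 q2 : WithLp 2 (ℝ × X)) (t' s' : ℝ) (x' y' : X) (A1 A2 : X →L[ℝ] X),
      ‖q1‖ ≤ ν ∧ ‖q2‖ ≤ ν ∧
      |t' - z.fst| ^ 2 ≤ 4 * B / lam ∧ ‖x' - z.snd‖ ^ 2 ≤ 4 * B / lam ∧
      |s' - ζ.fst| ^ 2 ≤ 4 * B / lam ∧ ‖y' - ζ.snd‖ ^ 2 ≤ 4 * B / lam ∧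
      (∀ w : WithLp 2 (ℝ × X), f1 w.fst w.snd + f2 w.fst w.snd ≤ f1 t' x' + f2 s' y'
        - ((z.fst - ζ.fst) ^ 2 / (2 * η) + ‖z.snd - ζ.snd‖ ^ 2 / (2 * ε))
        + 2 * β * ‖w‖ ^ 2 - β * (‖z‖ ^ 2 + ‖ζ‖ ^ 2) + ν * (2 * ‖w‖ + ‖z‖ + ‖ζ‖)) ∧
      ((z.fst - ζ.fst) ^ 2 / (2 * η) + ‖z.snd - ζ.snd‖ ^ 2 / (2 * ε) ≤
        C * (Real.sqrt |z.fst - ζ.fst| + ‖z.snd - ζ.snd‖) + β * (‖ζ‖ ^ 2 - ‖z‖ ^ 2)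
        + ν * ‖ζ - z‖) ∧
      UpJet f1 t' x' ((z.fst - ζ.fst) / η + 2 * β * z.fst + q1.fst)
        (ε⁻¹ • (z.snd - ζ.snd) + (2 * β) • z.snd + q1.snd) A1 ∧
      UpJet f2 s' y' (-((z.fst - ζ.fst) / η) + 2 * β * ζ.fst + q2.fst)
        (-(ε⁻¹ • (z.snd - ζ.snd)) + (2 * β) • ζ.snd + q2.snd) A2 ∧
      (∀ a a', ⟪A1 a, a⟫ + ⟪A2 a', a'⟫ ≤ ‖a - a'‖ ^ 2 / ε
        + (2 * β + 4 * κ) * (‖a‖ ^ 2 + ‖a'‖ ^ 2)) := by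
  have hfst : ∀ H, (LamOp X η ε H).fst = η⁻¹ * H.fst := fun _ => rfl
  have hsnd : ∀ H, (LamOp X η ε H).snd = ε⁻¹ • H.snd := fun _ => rfl
  have hqf : ∀ H, ⟪LamOp X η ε H, H⟫ = H.fst ^ 2 / η + ‖H.snd‖ ^ 2 / ε := by
    intro H
    rw [pInner, hfst, hsnd, inner_smul_left, real_inner_self_eq_norm_sq]
    simp only [conj_trivial]; field_simp
  have hc1 := continuous_of_modulus f1 C hm1
  have hc2 := continuous_of_modulus f2 C hm2
  have cc : Continuous fun Z : WithLp 2 (ℝ × X) => (Z.fst, Z.snd) := by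
    have c1 : Continuous fun Z : WithLp 2 (ℝ × X) => Z.fst := by fun_prop
    have c2 : Continuous fun Z : WithLp 2 (ℝ × X) => Z.snd := by fun_prop
    fun_prop
  obtain ⟨z, ζ, z', ζ', q1, q2, A1, A2, hq1, hq2, d1, d2, ha, hb, hx1, hx2, hA⟩ :=
    doubling_general (fun Z : WithLp 2 (ℝ × X) => f1 Z.fst Z.snd) (fun Z => f2 Z.fst Z.snd)
      (hc1.comp cc) (hc2.comp cc) B (fun Z => hB1 _ _) (fun Z => hB2 _ _) (LamOp X η ε)
      (by
        intro x y
        rw [pInner, pInner, hfst, hsnd, hfst, hsnd, inner_smul_left, inner_smul_right]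
        simp only [conj_trivial]; ring)
      (by intro x; rw [hqf]; positivity) β ν lam hβ hν hl
  refine ⟨z, ζ, q1, q2, z'.fst, ζ'.fst, z'.snd, ζ'.snd,
    prX X ∘L A1 ∘L inX X + (4 * κ) • ContinuousLinearMap.id ℝ X,
    prX X ∘L A2 ∘L inX X + (4 * κ) • ContinuousLinearMap.id ℝ X, hq1, hq2, ?_, ?_, ?_, ?_, ?_, ?_,
    ?_, ?_, ?_⟩
  · have := pNormSq (z' - z)
    rw [WithLp.sub_fst, WithLp.sub_snd] at this
    rw [sq_abs]; nlinarith [sq_nonneg ‖z'.snd - z.snd‖]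
  · have := pNormSq (z' - z)
    rw [WithLp.sub_fst, WithLp.sub_snd] at this
    nlinarith [sq_nonneg (z'.fst - z.fst)]
  · have := pNormSq (ζ' - ζ)
    rw [WithLp.sub_fst, WithLp.sub_snd] at this
    rw [sq_abs]; nlinarith [sq_nonneg ‖ζ'.snd - ζ.snd‖]
  · have := pNormSq (ζ' - ζ)
    rw [WithLp.sub_fst, WithLp.sub_snd] at this
    nlinarith [sq_nonneg (ζ'.fst - ζ.fst)]
  · intro w
    have := ha w
    rw [hqf, WithLp.sub_fst, WithLp.sub_snd] at this
    have e : 1 / 2 * ((z.fst - ζ.fst) ^ 2 / η + ‖z.snd - ζ.snd‖ ^ 2 / ε)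
      = (z.fst - ζ.fst) ^ 2 / (2 * η) + ‖z.snd - ζ.snd‖ ^ 2 / (2 * ε) := by field_simp
    rw [e] at this
    exact this
  · rw [hqf, WithLp.sub_fst, WithLp.sub_snd] at hb
    have e : 1 / 2 * ((z.fst - ζ.fst) ^ 2 / η + ‖z.snd - ζ.snd‖ ^ 2 / ε)
      = (z.fst - ζ.fst) ^ 2 / (2 * η) + ‖z.snd - ζ.snd‖ ^ 2 / (2 * ε) := by field_simp
    rw [e] at hb
    have h1 := (le_abs_self _).trans (hm1 z'.fst z'.snd (z' + (ζ - z)).fst (z' + (ζ - z)).snd)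
    have e1 : z'.fst - (z' + (ζ - z)).fst = z.fst - ζ.fst := by
      rw [WithLp.add_fst, WithLp.sub_fst]; ring
    have e2 : z'.snd - (z' + (ζ - z)).snd = z.snd - ζ.snd := by
      rw [WithLp.add_snd, WithLp.sub_snd]; abel
    rw [e1, e2] at h1
    linarith
  · have := upjet_of_expansion f1 z'.fst z'.snd _ A1 κ hκ (hx1 κ hκ)
    convert this using 1
    · simp [hfst]; ring
    · simp [hsnd, smul_sub]
  · have := upjet_of_expansion f2 ζ'.fst ζ'.snd _ A2 κ hκ (hx2 κ hκ)
    convert this using 1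
    · simp [hfst]; ring
    · simp [hsnd, smul_sub]
  · intro a a'
    have k0 : ∀ (A : WithLp 2 (ℝ × X) →L[ℝ] WithLp 2 (ℝ × X)) w,
        ⟪(prX X ∘L A ∘L inX X + (4 * κ) • ContinuousLinearMap.id ℝ X) w, w⟫
        = ⟪A (inX X w), inX X w⟫ + 4 * κ * ‖w‖ ^ 2 := by
      intro A w
      rw [_root_.add_apply, inner_add_left, _root_.smul_apply, inner_smul_left, pInner,
        show (inX X w).fst = 0 from rfl, show (inX X w).snd = w from rfl]
      change ⟪(A (inX X w)).snd, w⟫ + _ = _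
      simp [real_inner_self_eq_norm_sq]
    have n2 : ∀ w, ‖inX X w‖ ^ 2 = ‖w‖ ^ 2 := fun w => by
      rw [pNormSq, show (inX X w).fst = 0 from rfl, show (inX X w).snd = w from rfl]; simp
    have := hA (inX X a) (inX X a')
    rw [← map_sub, hqf, n2, n2, show (inX X (a - a')).fst = 0 from rfl,
      show (inX X (a - a')).snd = a - a' from rfl] at this
    rw [k0, k0]
    have e : (0:ℝ) ^ 2 / η = 0 := by simp
    rw [e] at this
    linarith
end

section
variable {X : Type*} [NormedAddCommGroup X] [InnerProductSpace ℝ X] [FiniteDimensional ℝ X]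

lemma small_dt (C2 e ρ : ℝ) (hC2 : 0 < C2) (he : 0 < e) (hρ : 0 < ρ) :
    ∃ d > 0, C2 * (Real.sqrt d + d) ≤ e ∧ d ≤ ρ := by
  set a := min (e / (2 * C2)) 1 with ha
  have ha0 : 0 < a := lt_min (by positivity) one_pos
  refine ⟨min (a ^ 2) ρ, lt_min (by positivity) hρ, ?_, min_le_right _ _⟩
  have h1 : Real.sqrt (min (a ^ 2) ρ) ≤ a := by
    rw [Real.sqrt_le_left ha0.le]; exact min_le_left _ _
  have h2 : min (a ^ 2) ρ ≤ a := (min_le_left _ _).trans (by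
    have : a ≤ 1 := min_le_right _ _
    nlinarith)
  have h3 : a ≤ e / (2 * C2) := min_le_left _ _
  rw [le_div_iff₀ (by positivity)] at h3
  calc C2 * (Real.sqrt (min (a ^ 2) ρ) + min (a ^ 2) ρ) ≤ C2 * (a + a) := by gcongr
    _ ≤ e := by linarith

set_option maxHeartbeats 4000000 in
lemma doubling_final (f1 f2 : ℝ → X → ℝ) (C : ℝ) (hC : 0 ≤ C)
    (hm1 : ∀ t x s y, |f1 t x - f1 s y| ≤ C * (Real.sqrt |t - s| + ‖x - y‖))
    (hm2 : ∀ t x s y, |f2 t x - f2 s y| ≤ C * (Real.sqrt |t - s| + ‖x - y‖))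
    (B : ℝ) (hB : 0 < B) (hB1 : ∀ t x, |f1 t x| ≤ B) (hB2 : ∀ t x, |f2 t x| ≤ B)
    (m : ℝ) (hm : 0 < m) (t1 : ℝ) (x1 : X) (h1 : 4 * m ≤ f1 t1 x1 + f2 t1 x1)
    (e : ℝ) (he : 0 < e) :
    ∃ R ε : ℝ, 0 < ε ∧ ε ≤ 1 ∧ ∀ ρ > 0, ∃ (t s : ℝ) (x y v : X) (τ1 τ2 : ℝ) (q1 q2 : X)
      (A1 A2 : X →L[ℝ] X), ‖x‖ ≤ R ∧ ‖y‖ ≤ R ∧ |t - s| ≤ ρ ∧ ‖x - y‖ ^ 2 / ε ≤ e ∧ ‖x - y‖ ≤ e ∧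
      2 * m ≤ f1 t x + f2 s y ∧ |τ1 + τ2| ≤ e ∧ ‖q1 - v‖ ≤ e ∧ ‖q2 + v‖ ≤ e ∧
      ‖v‖ * ‖x - y‖ ≤ e ∧ ‖v‖ ≤ 1 / ε ∧ UpJet f1 t x τ1 q1 A1 ∧ UpJet f2 s y τ2 q2 A2 ∧
      ∀ a a', ⟪A1 a, a⟫ + ⟪A2 a', a'⟫ ≤ ‖a - a'‖ ^ 2 / ε + e * (‖a‖ ^ 2 + ‖a'‖ ^ 2) := by
  set w : WithLp 2 (ℝ × X) := WithLp.toLp 2 (t1, x1) with hw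
  have hwf : w.fst = t1 := rfl
  have hws : w.snd = x1 := rfl
  set W := ‖w‖ with hW
  have hW0 : 0 ≤ W := norm_nonneg _
  obtain ⟨γ, hγ0, hγ1, hγe⟩ : ∃ γ > 0, γ ≤ 1 / 2 ∧ γ ≤ e / 16 :=
    ⟨min (1 / 2) (e / 16), lt_min (by norm_num) (by positivity), min_le_left _ _, min_le_right _ _⟩
  obtain ⟨β, hβ, hβ1, hβ2, hβ3⟩ : ∃ β > 0, 2 * β * W ^ 2 ≤ m ∧ 4 * B * β ≤ γ ^ 2 ∧ β ≤ e / 4 := by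
    refine ⟨min (m / (2 * W ^ 2 + 1)) (min (γ ^ 2 / (4 * B)) (e / 4)), by positivity, ?_, ?_, ?_⟩
    · have := min_le_left (m / (2 * W ^ 2 + 1)) (min (γ ^ 2 / (4 * B)) (e / 4))
      have h0 : 0 < min (m / (2 * W ^ 2 + 1)) (min (γ ^ 2 / (4 * B)) (e / 4)) := by positivity
      rw [le_div_iff₀ (by positivity)] at this
      linarith
    · have := (min_le_right (m / (2 * W ^ 2 + 1)) (min (γ ^ 2 / (4 * B)) (e / 4))).trans (min_le_left _ _)
      rw [le_div_iff₀ (by positivity)] at this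
      linarith
    · exact (min_le_right _ _).trans (min_le_right _ _)
  obtain ⟨ν, hν, hν1, hνe, hνm⟩ : ∃ ν > 0, ν ≤ 1 ∧ ν ≤ e / 16 ∧ 2 * ν * W + ν ^ 2 / β ≤ m := by
    refine ⟨min 1 (min (e / 16) (m / (2 * W + 1 / β))), by positivity, min_le_left _ _,
      (min_le_right _ _).trans (min_le_left _ _), ?_⟩
    set ν := min 1 (min (e / 16) (m / (2 * W + 1 / β))) with hν
    have h0 : 0 < ν := by positivity
    have h1 : ν ≤ 1 := min_le_left _ _
    have h2 : ν ≤ m / (2 * W + 1 / β) := (min_le_right _ _).trans (min_le_right _ _)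
    rw [le_div_iff₀ (by positivity)] at h2
    have h3 : ν ^ 2 / β ≤ ν * (1 / β) := by
      rw [mul_one_div]; gcongr; nlinarith
    linarith
  set C2 := C + 2 with hC2
  have hC20 : 0 < C2 := by positivity
  obtain ⟨e1, he10, he11, he1e⟩ : ∃ e1 > 0, e1 ≤ 1 / 16 ∧ e1 ≤ e / 16 :=
    ⟨min (1 / 16) (e / 16), lt_min (by norm_num) (by positivity), min_le_left _ _, min_le_right _ _⟩
  obtain ⟨ε, hε, hε1, hεC⟩ : ∃ ε > 0, ε ≤ 1 ∧ 4 * C2 ^ 2 * ε ≤ e1 ^ 2 / 2 := by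
    refine ⟨min 1 (e1 ^ 2 / (8 * C2 ^ 2)), by positivity, min_le_left _ _, ?_⟩
    have := min_le_right 1 (e1 ^ 2 / (8 * C2 ^ 2))
    rw [le_div_iff₀ (by positivity)] at this
    linarith
  refine ⟨γ / β + 1, ε, hε, hε1, fun ρ hρ => ?_⟩
  obtain ⟨d, hd, hd1, hd2⟩ := small_dt C2 (e1 ^ 2 / 8) (ρ / 2) hC20 (by positivity) (by positivity)
  obtain ⟨θ, hθ0, hθρ, hθε⟩ : ∃ θ > 0, θ ≤ ρ / 4 ∧ θ ≤ e1 * ε :=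
    ⟨min (ρ / 4) (e1 * ε), by positivity, min_le_left _ _, min_le_right _ _⟩
  have hθe : θ ≤ e1 := hθε.trans (by nlinarith only [he10, hε1])
  have hη0 : 0 < d ^ 2 / (4 * B) := by positivity
  have hl0 : 0 < 4 * B / θ ^ 2 := by positivity
  have hκ0 : 0 < e / 8 := by positivity
  obtain ⟨z, ζ, q1, q2, t, s, x, y, A1, A2, hq1, hq2, dt, dx, ds, dy, ha, hb, j1, j2, hA⟩ :=
    doubling_tx f1 f2 C hm1 hm2 B hB1 hB2 (d ^ 2 / (4 * B)) ε β ν (4 * B / θ ^ 2) (e / 8)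
      hη0 hε hβ hν hl0 hκ0
  have el : 4 * B / (4 * B / θ ^ 2) = θ ^ 2 := by field_simp
  rw [el] at dt dx ds dy
  replace dt := abs_le_of_sq_le_sq' dt hθ0.le |>.2
  replace dx := abs_le_of_sq_le_sq' dx hθ0.le |>.2
  replace ds := abs_le_of_sq_le_sq' ds hθ0.le |>.2
  replace dy := abs_le_of_sq_le_sq' dy hθ0.le |>.2
  set Δt := z.fst - ζ.fst with hΔt
  set Δx := z.snd - ζ.snd with hΔx
  have hφ0 : 0 ≤ Δt ^ 2 / (2 * (d ^ 2 / (4 * B))) := by positivity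
  have hφ1 : 0 ≤ ‖Δx‖ ^ 2 / (2 * ε) := by positivity
  -- first estimate
  have hS : 2 * m + Δt ^ 2 / (2 * (d ^ 2 / (4 * B))) + ‖Δx‖ ^ 2 / (2 * ε)
      + β / 2 * ‖z‖ ^ 2 + β / 2 * ‖ζ‖ ^ 2 ≤ f1 t x + f2 s y := by
    have h2 := ha w
    rw [hwf, hws] at h2
    have hyoung : ∀ r : ℝ, ν * r ≤ β / 2 * r ^ 2 + ν ^ 2 / β / 2 := by
      intro r
      have : β / 2 * r ^ 2 + ν ^ 2 / β / 2 - ν * r = (β * r - ν) ^ 2 / (2 * β) := by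
        field_simp; ring
      have : 0 ≤ (β * r - ν) ^ 2 / (2 * β) := by positivity
      linarith
    linarith [hyoung ‖z‖, hyoung ‖ζ‖]
  have hS2 : f1 t x + f2 s y ≤ 2 * B := by
    linarith [(abs_le.1 (hB1 t x)).2, (abs_le.1 (hB2 s y)).2]
  have hz0 : 0 ≤ β / 2 * ‖z‖ ^ 2 := by positivity
  have hζ0 : 0 ≤ β / 2 * ‖ζ‖ ^ 2 := by positivity
  have hz : β * ‖z‖ ≤ γ := by
    apply abs_le_of_sq_le_sq' _ hγ0.le |>.2
    have : β / 2 * ‖z‖ ^ 2 ≤ 2 * B := by linarith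
    calc (β * ‖z‖) ^ 2 = 2 * β * (β / 2 * ‖z‖ ^ 2) := by ring
      _ ≤ 2 * β * (2 * B) := by gcongr
      _ ≤ γ ^ 2 := by linarith
  have hζ : β * ‖ζ‖ ≤ γ := by
    apply abs_le_of_sq_le_sq' _ hγ0.le |>.2
    have : β / 2 * ‖ζ‖ ^ 2 ≤ 2 * B := by linarith
    calc (β * ‖ζ‖) ^ 2 = 2 * β * (β / 2 * ‖ζ‖ ^ 2) := by ring
      _ ≤ 2 * β * (2 * B) := by gcongr
      _ ≤ γ ^ 2 := by linarith
  have hdt : |Δt| ≤ d := by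
    apply abs_le_of_sq_le_sq _ hd.le
    have : Δt ^ 2 / (2 * (d ^ 2 / (4 * B))) ≤ 2 * B := by linarith
    rw [div_le_iff₀ (by positivity)] at this
    calc Δt ^ 2 ≤ _ := this
      _ = d ^ 2 := by field_simp; norm_num
  -- second estimate
  have hdx : ‖Δx‖ ^ 2 / ε ≤ e1 ^ 2 := by
    have k1 : ‖ζ - z‖ ≤ |Δt| + ‖Δx‖ := by
      have := pNorm_le (z - ζ)
      rwa [norm_sub_rev, WithLp.sub_fst, WithLp.sub_snd] at this
    have k2 : β * (‖ζ‖ ^ 2 - ‖z‖ ^ 2) ≤ 1 * ‖ζ - z‖ := by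
      have k3 : ‖ζ‖ - ‖z‖ ≤ ‖ζ - z‖ := norm_sub_norm_le _ _
      calc β * (‖ζ‖ ^ 2 - ‖z‖ ^ 2) = (β * ‖ζ‖ + β * ‖z‖) * (‖ζ‖ - ‖z‖) := by ring
        _ ≤ (β * ‖ζ‖ + β * ‖z‖) * ‖ζ - z‖ := by gcongr
        _ ≤ 1 * ‖ζ - z‖ := by gcongr; linarith
    have k4 : ν * ‖ζ - z‖ ≤ 1 * ‖ζ - z‖ := by gcongr
    have k5 : Real.sqrt |Δt| ≤ Real.sqrt d := Real.sqrt_le_sqrt hdt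
    have k6 : C * Real.sqrt |Δt| ≤ C2 * Real.sqrt d := by
      rw [hC2]
      have := mul_le_mul_of_nonneg_left k5 hC
      nlinarith only [this, Real.sqrt_nonneg d]
    have k7 : C2 * ‖Δx‖ ≤ C2 ^ 2 * ε + ‖Δx‖ ^ 2 / ε / 4 := by
      have : C2 ^ 2 * ε + ‖Δx‖ ^ 2 / ε / 4 - C2 * ‖Δx‖ = (2 * C2 * ε - ‖Δx‖) ^ 2 / (4 * ε) := by
        field_simp; ring
      have : 0 ≤ (2 * C2 * ε - ‖Δx‖) ^ 2 / (4 * ε) := by positivity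
      linarith
    have k8 : ‖Δx‖ ^ 2 / (2 * ε) = ‖Δx‖ ^ 2 / ε / 2 := by field_simp
    have k9 : 2 * |Δt| ≤ C2 * d := by nlinarith only [hdt, hC2, hC, hd]
    have k10 : C2 * ‖Δx‖ = C * ‖Δx‖ + 2 * ‖Δx‖ := by rw [hC2]; ring
    rw [k8] at hb hφ1
    linarith
  have hdx1 : ‖Δx‖ ≤ e1 := by
    apply abs_le_of_sq_le_sq' _ he10.le |>.2
    rw [div_le_iff₀ hε] at hdx
    nlinarith only [hdx, hε1, hε, sq_nonneg e1]
  have hxy : ‖x - y‖ ≤ ‖Δx‖ + 2 * θ := by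
    have : x - y = Δx + ((x - z.snd) - (y - ζ.snd)) := by rw [hΔx]; abel
    rw [this]
    have h2 := norm_add_le Δx ((x - z.snd) - (y - ζ.snd))
    have h3 := norm_sub_le (x - z.snd) (y - ζ.snd)
    linarith
  have hθ2 : θ / ε ≤ e1 := by rw [div_le_iff₀ hε]; exact hθε
  have hzβ : ‖z‖ ≤ γ / β := by rw [le_div_iff₀ hβ]; linarith
  have hζβ : ‖ζ‖ ≤ γ / β := by rw [le_div_iff₀ hβ]; linarith
  have hzf := pNorm_fst z
  have hzs := pNorm_snd z
  have hζf := pNorm_fst ζ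
  have hζs := pNorm_snd ζ
  have hq1f := (pNorm_fst q1).trans hq1
  have hq1s := (pNorm_snd q1).trans hq1
  have hq2f := (pNorm_fst q2).trans hq2
  have hq2s := (pNorm_snd q2).trans hq2
  have he1e1 : e1 ^ 2 ≤ e / 256 := by nlinarith only [he10, he11, he1e]
  refine ⟨t, s, x, y, ε⁻¹ • Δx, _, _, _, _, A1, A2, ?_, ?_, ?_, ?_, ?_, ?_, ?_, ?_, ?_, ?_, ?_, j1, j2, ?_⟩
  · have : x = z.snd + (x - z.snd) := by abel
    rw [this]; have := norm_add_le z.snd (x - z.snd)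
    linarith
  · have : y = ζ.snd + (y - ζ.snd) := by abel
    rw [this]; have := norm_add_le ζ.snd (y - ζ.snd)
    linarith
  · have h2 := abs_le.1 dt
    have h3 := abs_le.1 ds
    have h4 := abs_le.1 hdt
    rw [abs_le]; constructor <;> linarith
  · have h2 : ‖x - y‖ ^ 2 ≤ 2 * ‖Δx‖ ^ 2 + 8 * θ ^ 2 := by
      have : ‖x - y‖ ^ 2 ≤ (‖Δx‖ + 2 * θ) ^ 2 := by gcongr
      nlinarith only [this, sq_nonneg (‖Δx‖ - 2 * θ)]
    have h3 : θ ^ 2 / ε ≤ e1 ^ 2 := by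
      calc θ ^ 2 / ε = θ * (θ / ε) := by ring
        _ ≤ e1 * e1 := by gcongr
        _ = e1 ^ 2 := by ring
    calc ‖x - y‖ ^ 2 / ε ≤ (2 * ‖Δx‖ ^ 2 + 8 * θ ^ 2) / ε := by gcongr
      _ = 2 * (‖Δx‖ ^ 2 / ε) + 8 * (θ ^ 2 / ε) := by ring
      _ ≤ e := by linarith
  · linarith
  · linarith
  · have e1 : Δt / (d ^ 2 / (4 * B)) + 2 * β * z.fst + q1.fst + (-(Δt / (d ^ 2 / (4 * B))) + 2 * β * ζ.fst + q2.fst)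
      = 2 * (β * z.fst) + 2 * (β * ζ.fst) + q1.fst + q2.fst := by ring
    rw [e1]
    have b1 : |β * z.fst| ≤ γ := by rw [abs_mul, abs_of_pos hβ]; exact (mul_le_mul_of_nonneg_left hzf hβ.le).trans hz
    have b2 : |β * ζ.fst| ≤ γ := by rw [abs_mul, abs_of_pos hβ]; exact (mul_le_mul_of_nonneg_left hζf hβ.le).trans hζ
    have b1 := abs_le.1 b1
    have b2 := abs_le.1 b2
    have b3 := abs_le.1 hq1f
    have b4 := abs_le.1 hq2f
    rw [abs_le]; constructor <;> linarith
  · have e2 : ε⁻¹ • Δx + (2 * β) • z.snd + q1.snd - ε⁻¹ • Δx = (2 * β) • z.snd + q1.snd := by abel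
    rw [e2]
    have := norm_add_le ((2 * β) • z.snd) q1.snd
    rw [norm_smul, Real.norm_of_nonneg (by positivity)] at this
    linarith only [this, mul_le_mul_of_nonneg_left hzs hβ.le, hz, hq1s, hγe, hνe, he]
  · have e2 : -(ε⁻¹ • Δx) + (2 * β) • ζ.snd + q2.snd + ε⁻¹ • Δx = (2 * β) • ζ.snd + q2.snd := by abel
    rw [e2]
    have := norm_add_le ((2 * β) • ζ.snd) q2.snd
    rw [norm_smul, Real.norm_of_nonneg (by positivity)] at this
    linarith only [this, mul_le_mul_of_nonneg_left hζs hβ.le, hζ, hq2s, hγe, hνe, he]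
  · rw [norm_smul, Real.norm_of_nonneg (by positivity)]
    calc ε⁻¹ * ‖Δx‖ * ‖x - y‖ ≤ ε⁻¹ * ‖Δx‖ * (‖Δx‖ + 2 * θ) := by gcongr
      _ = ‖Δx‖ ^ 2 / ε + 2 * (‖Δx‖ * (θ / ε)) := by field_simp
      _ ≤ e1 ^ 2 + 2 * (e1 * e1) := by gcongr
      _ ≤ e := by linarith
  · rw [norm_smul, Real.norm_of_nonneg (by positivity), one_div]
    have : 0 < ε⁻¹ := by positivity
    nlinarith only [this, hdx1, he11]
  · intro a a'
    have h2 := hA a a'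
    have h3 : (2 * β + 4 * (e / 8)) * (‖a‖ ^ 2 + ‖a'‖ ^ 2) ≤ e * (‖a‖ ^ 2 + ‖a'‖ ^ 2) := by
      gcongr; linarith
    linarith
end

/-- the coefficient assumptions in abstract form (with the columns of `σ`). -/
structure CoefOK {X : Type*} [NormedAddCommGroup X] [InnerProductSpace ℝ X] (d : ℕ) (T L : ℝ)
    (b : ℝ → X → X) (s : ℝ → X → Fin d → X) (g : ℝ → X → ℝ) : Prop where
  modt : ∀ R : ℝ, ∀ e > 0, ∃ ρ > 0, ∀ t ∈ Icc (0:ℝ) T, ∀ t' ∈ Icc (0:ℝ) T, |t - t'| ≤ ρ →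
    ∀ x, ‖x‖ ≤ R → ‖b t x - b t' x‖ ≤ e ∧ ∑ j, ‖s t x j - s t' x j‖ ^ 2 ≤ e ∧ |g t x - g t' x| ≤ e
  lip : ∀ t ∈ Icc (0:ℝ) T, ∀ x y, ‖b t x - b t y‖ ≤ L * ‖x - y‖ ∧
    ∑ j, ‖s t x j - s t y j‖ ^ 2 ≤ L ^ 2 * ‖x - y‖ ^ 2 ∧ |g t x - g t y| ≤ L * ‖x - y‖
  bdd : ∀ t ∈ Icc (0:ℝ) T, ∀ x, ‖b t x‖ ≤ L ∧ ∑ j, ‖s t x j‖ ^ 2 ≤ L ^ 2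

section
variable {X : Type*} [NormedAddCommGroup X] [InnerProductSpace ℝ X] [FiniteDimensional ℝ X]

set_option maxHeartbeats 1000000 in
lemma compare_strict (d : ℕ) (T L : ℝ) (hL : 0 < L) (b : ℝ → X → X) (s : ℝ → X → Fin d → X)
    (g : ℝ → X → ℝ) (hco : CoefOK d T L b s g) (a a' : ℝ) (ha : 0 ≤ a) (ha' : a' ≤ T)
    (u w : ℝ → X → ℝ) (C : ℝ) (hC : 0 ≤ C)
    (hm1 : ∀ t x s y, |u t x - u s y| ≤ C * (Real.sqrt |t - s| + ‖x - y‖))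
    (hm2 : ∀ t x s y, |w t x - w s y| ≤ C * (Real.sqrt |t - s| + ‖x - y‖))
    (B : ℝ) (hB : 0 < B) (hB1 : ∀ t x, |u t x| ≤ B) (hB2 : ∀ t x, |w t x| ≤ B)
    (μ : ℝ) (hμ : 0 < μ)
    (hu : ∀ t ∈ Ioo a a', ∀ x τ q A, UpJet u t x τ q A →
      μ ≤ τ + ⟪b t x, q⟫ + 1 / 2 * ∑ j, ⟪A (s t x j), s t x j⟫ + g t x)
    (hw : ∀ t ∈ Ioo a a', ∀ x τ q A, w t x < u t x → UpJet (fun t x => -w t x) t x τ q A →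
      0 ≤ τ + ⟪b t x, q⟫ + 1 / 2 * ∑ j, ⟪A (s t x j), s t x j⟫ - g t x)
    (hbd : ∀ t, t ∉ Ioo a a' → ∀ x, u t x ≤ w t x) : ∀ t x, u t x ≤ w t x := by
  intro t1 x1
  by_contra hcon
  push Not at hcon
  set m := (u t1 x1 - w t1 x1) / 4 with hmdef
  have hm : 0 < m := by rw [hmdef]; linarith
  set KK := 4 + 4 * L + 2 * L ^ 2 with hKK
  have hKK0 : 0 < KK := by positivity
  obtain ⟨e, he, he1, he2⟩ : ∃ e > 0, e * KK ≤ μ / 2 ∧ C * e ≤ m / 2 := by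
    refine ⟨min (μ / 2 / KK) (m / 2 / (C + 1)), by positivity, ?_, ?_⟩
    · have := min_le_left (μ / 2 / KK) (m / 2 / (C + 1))
      rwa [le_div_iff₀ hKK0] at this
    · have := min_le_right (μ / 2 / KK) (m / 2 / (C + 1))
      have h0 : 0 < min (μ / 2 / KK) (m / 2 / (C + 1)) := by positivity
      rw [le_div_iff₀ (by positivity)] at this
      linarith
  obtain ⟨R, ε, hε, hε1, hD⟩ := doubling_final u (fun t x => -w t x) C hC hm1
    (fun t x s y => by
      have := hm2 t x s y
      rw [← abs_neg] at this; convert this using 2; ring) B hB hB1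
    (fun t x => by rw [abs_neg]; exact hB2 t x) m hm t1 x1 (by rw [hmdef]; linarith) e he
  obtain ⟨ρ1, hρ1, hmod⟩ := hco.modt R (e * ε) (by positivity)
  obtain ⟨ρ, hρ, hρC, hρρ⟩ := small_dt (C + 1) (m / 2) ρ1 (by positivity) (by positivity) hρ1
  obtain ⟨t, t', x, y, v, τ1, τ2, q1, q2, A1, A2, hxR, hyR, htt, hxyε, hxy, h2m, hτ, hq1, hq2, hv,
    hvε, j1, j2, hA⟩ := hD ρ hρ
  have hsmall : C * (Real.sqrt |t - t'| + ‖x - y‖) ≤ m := by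
    have h1 : Real.sqrt |t - t'| ≤ Real.sqrt ρ := Real.sqrt_le_sqrt htt
    have h2 : C * Real.sqrt |t - t'| ≤ C * Real.sqrt ρ := by gcongr
    have h3 : C * ‖x - y‖ ≤ C * e := by gcongr
    have h4 : 0 ≤ C * ρ := by positivity
    linarith only [h2, h3, h4, hρC, he2, hρ, Real.sqrt_nonneg ρ]
  have k1 : w t x < u t x := by
    have := (abs_le.1 (hm2 t x t' y)).2
    linarith
  have k2 : w t' y < u t' y := by
    have := (abs_le.1 (hm1 t x t' y)).2
    linarith
  have ht : t ∈ Ioo a a' := by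
    by_contra h; exact absurd (hbd t h x) (by linarith)
  have ht' : t' ∈ Ioo a a' := by
    by_contra h; exact absurd (hbd t' h y) (by linarith)
  have htT : t ∈ Icc 0 T := ⟨ha.trans ht.1.le, ht.2.le.trans ha'⟩
  have htT' : t' ∈ Icc 0 T := ⟨ha.trans ht'.1.le, ht'.2.le.trans ha'⟩
  have i1 := hu t ht x τ1 q1 A1 j1
  have i2 := hw t' ht' y τ2 q2 A2 k2 j2
  obtain ⟨m1, m2, m3⟩ := hmod t htT t' htT' (htt.trans hρρ) x hxR
  obtain ⟨l1, l2, l3⟩ := hco.lip t' htT' x y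
  obtain ⟨c1, c2⟩ := hco.bdd t htT x
  obtain ⟨c3, c4⟩ := hco.bdd t' htT' y
  -- drift
  have hb : ⟪b t x, q1⟫ + ⟪b t' y, q2⟫ ≤ (3 * L + 1) * e := by
    have e1 : ⟪b t x, q1⟫ + ⟪b t' y, q2⟫ = ⟪b t x - b t' y, v⟫ + ⟪b t x, q1 - v⟫
        + ⟪b t' y, q2 + v⟫ := by
      rw [inner_sub_left, inner_sub_right, inner_add_right]; ring
    have e2 : ‖b t x - b t' y‖ ≤ e * ε + L * ‖x - y‖ := by
      have : b t x - b t' y = (b t x - b t' x) + (b t' x - b t' y) := by abel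
      rw [this]; exact (norm_add_le _ _).trans (add_le_add m1 l1)
    have e3 : ⟪b t x - b t' y, v⟫ ≤ (e * ε + L * ‖x - y‖) * ‖v‖ :=
      (real_inner_le_norm _ _).trans (by gcongr)
    have e4 : ⟪b t x, q1 - v⟫ ≤ L * e := (real_inner_le_norm _ _).trans (by gcongr)
    have e5 : ⟪b t' y, q2 + v⟫ ≤ L * e := (real_inner_le_norm _ _).trans (by gcongr)
    have e6 : e * ε * ‖v‖ ≤ e := by
      rw [le_div_iff₀ hε] at hvε
      nlinarith only [hvε, he]
    have e7 : L * (‖v‖ * ‖x - y‖) ≤ L * e := by gcongr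
    nlinarith only [e1, e3, e4, e5, e6, e7]
  have hσ : ∑ j, ⟪A1 (s t x j), s t x j⟫ + ∑ j, ⟪A2 (s t' y j), s t' y j⟫
      ≤ (2 * L ^ 2 + 2 + 2 * L ^ 2) * e := by
    have e0 : ∑ j, ‖s t x j - s t' y j‖ ^ 2 ≤ 2 * (e * ε) + 2 * (L ^ 2 * ‖x - y‖ ^ 2) := by
      calc ∑ j, ‖s t x j - s t' y j‖ ^ 2
          ≤ ∑ j, (2 * ‖s t x j - s t' x j‖ ^ 2 + 2 * ‖s t' x j - s t' y j‖ ^ 2) := by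
            refine Finset.sum_le_sum fun j _ => ?_
            have : s t x j - s t' y j = (s t x j - s t' x j) + (s t' x j - s t' y j) := by abel
            rw [this]
            have h1 := norm_add_le (s t x j - s t' x j) (s t' x j - s t' y j)
            have h2 := pow_le_pow_left₀ (norm_nonneg _) h1 2
            nlinarith only [h2, sq_nonneg (‖s t x j - s t' x j‖ - ‖s t' x j - s t' y j‖)]
        _ = 2 * ∑ j, ‖s t x j - s t' x j‖ ^ 2 + 2 * ∑ j, ‖s t' x j - s t' y j‖ ^ 2 := by
            rw [Finset.sum_add_distrib, Finset.mul_sum, Finset.mul_sum]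
        _ ≤ _ := by linarith
    rw [← Finset.sum_add_distrib]
    calc ∑ j, (⟪A1 (s t x j), s t x j⟫ + ⟪A2 (s t' y j), s t' y j⟫)
        ≤ ∑ j, (‖s t x j - s t' y j‖ ^ 2 / ε + e * (‖s t x j‖ ^ 2 + ‖s t' y j‖ ^ 2)) :=
          Finset.sum_le_sum fun j _ => hA _ _
      _ = (∑ j, ‖s t x j - s t' y j‖ ^ 2) / ε + e * (∑ j, ‖s t x j‖ ^ 2 + ∑ j, ‖s t' y j‖ ^ 2) := by
          rw [Finset.sum_add_distrib, Finset.sum_div, ← Finset.mul_sum, Finset.sum_add_distrib]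
      _ ≤ (2 * (e * ε) + 2 * (L ^ 2 * ‖x - y‖ ^ 2)) / ε + e * (L ^ 2 + L ^ 2) := by gcongr
      _ = 2 * e + 2 * L ^ 2 * (‖x - y‖ ^ 2 / ε) + e * (L ^ 2 + L ^ 2) := by field_simp
      _ ≤ 2 * e + 2 * L ^ 2 * e + e * (L ^ 2 + L ^ 2) := by gcongr
      _ = _ := by ring
  have hg : g t x - g t' y ≤ (1 + L) * e := by
    have e1 := (abs_le.1 m3).2
    have e2 := (abs_le.1 l3).2
    have e3 : L * ‖x - y‖ ≤ L * e := by gcongr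
    have e4 : e * ε ≤ e := by nlinarith only [he, hε1]
    linarith only [e1, e2, e3, e4]
  have hτ := (abs_le.1 hτ).2
  have : e * KK = e + (3 * L + 1) * e + 1 / 2 * ((2 * L ^ 2 + 2 + 2 * L ^ 2) * e) + (1 + L) * e := by
    rw [hKK]; ring
  linarith only [this, i1, i2, hb, hσ, hg, hτ, he1, hμ]

lemma pos_sq_expand (c c' : ℝ) : (max c' 0) ^ 2 ≤ (max c 0) ^ 2 + 2 * max c 0 * (c' - c) + (c' - c) ^ 2 := by
  have e : (max c 0) ^ 2 + 2 * max c 0 * (c' - c) + (c' - c) ^ 2 = (max c 0 + (c' - c)) ^ 2 := by ring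
  rw [e]
  rcases le_or_gt c' 0 with h | h
  · rw [max_eq_right h]; have := sq_nonneg (max c 0 + (c' - c)); linarith
  · rw [max_eq_left h.le]
    have : c ≤ max c 0 := le_max_left _ _
    gcongr; linarith

lemma upjet_congr (u v : ℝ → X → ℝ) (t : ℝ) (x : X) (τ : ℝ) (q : X) (A : X →L[ℝ] X)
    (h : ∀ᶠ r in nhds t, ∀ y, u r y = v r y) : UpJet u t x τ q A → UpJet v t x τ q A := by
  rintro ⟨c, hc⟩
  refine ⟨c, ?_⟩
  have h1 : ∀ᶠ p in nhds ((t, x) : ℝ × X), ∀ y, u p.1 y = v p.1 y :=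
    (continuous_fst.tendsto (t, x)).eventually h
  have h0 := h.self_of_nhds
  filter_upwards [hc, h1] with p hp hp1
  rw [← hp1, ← h0]; exact hp

end

section
variable {X : Type*} [NormedAddCommGroup X] [InnerProductSpace ℝ X] [FiniteDimensional ℝ X]

lemma clamp_mem (a a' : ℝ) (h : a ≤ a') (t : ℝ) : max a (min t a') ∈ Icc a a' :=
  ⟨le_max_left _ _, max_le h (min_le_right _ _)⟩

lemma clamp_eq (a a' : ℝ) (t : ℝ) (ht : t ∈ Icc a a') : max a (min t a') = t := by
  rw [min_eq_left ht.2, max_eq_right ht.1]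

lemma clamp_lip (a a' t s : ℝ) : |max a (min t a') - max a (min s a')| ≤ |t - s| := by
  rw [max_comm a, max_comm a]
  have h1 : |max (min t a') a - max (min s a') a| ≤ |min t a' - min s a'| := by
    have := abs_max_sub_max_le_max (min t a') a (min s a') a
    simpa using this
  have h2 : |min t a' - min s a'| ≤ |t - s| := by
    have := abs_min_sub_min_le_max t a' s a'
    simpa using this
  exact h1.trans h2

set_option maxHeartbeats 1000000 in
lemma compare_pre (d : ℕ) (T L : ℝ) (hL : 0 < L) (b : ℝ → X → X) (s : ℝ → X → Fin d → X)
    (g : ℝ → X → ℝ) (hco : CoefOK d T L b s g) (a a' : ℝ) (ha : 0 ≤ a) (ha' : a' ≤ T)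
    (haa : a < a')
    (u w : ℝ → X → ℝ) (C : ℝ) (hC : 0 ≤ C)
    (hm1 : ∀ t ∈ Icc a a', ∀ x, ∀ s ∈ Icc a a', ∀ y,
      |u t x - u s y| ≤ C * (Real.sqrt |t - s| + ‖x - y‖))
    (hm2 : ∀ t ∈ Icc a a', ∀ x, ∀ s ∈ Icc a a', ∀ y,
      |w t x - w s y| ≤ C * (Real.sqrt |t - s| + ‖x - y‖))
    (B : ℝ) (hB : 0 < B) (hB1 : ∀ t ∈ Icc a a', ∀ x, |u t x| ≤ B)
    (hB2 : ∀ t ∈ Icc a a', ∀ x, |w t x| ≤ B)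
    (hu : ∀ t ∈ Ioo a a', ∀ x τ q A, UpJet u t x τ q A →
      0 ≤ τ + ⟪b t x, q⟫ + 1 / 2 * ∑ j, ⟪A (s t x j), s t x j⟫ + g t x)
    (hw : ∀ t ∈ Ioo a a', ∀ x τ q A, w t x < u t x → UpJet (fun t x => -w t x) t x τ q A →
      0 ≤ τ + ⟪b t x, q⟫ + 1 / 2 * ∑ j, ⟪A (s t x j), s t x j⟫ - g t x)
    (hend : ∀ x, u a' x ≤ w a' x) (t0 : ℝ) (ht0 : t0 ∈ Ioo a a') (x0 : X) (μ : ℝ) (hμ : 0 < μ) :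
    u t0 x0 - μ * (a' - t0) ≤ w t0 x0 := by
  set t1 := (a + t0) / 2 with ht1
  have hat1 : 0 < t1 - a := by rw [ht1]; linarith [ht0.1]
  set K := 2 * B / (t1 - a) ^ 2 with hK
  have hK0 : 0 < K := by positivity
  let p : ℝ → ℝ := fun t => K * (max (t1 - t) 0) ^ 2 + μ * (a' - t)
  have hp0 : ∀ t ∈ Icc a a', 0 ≤ p t := by
    intro t ht
    have h1 : 0 ≤ μ * (a' - t) := mul_nonneg hμ.le (by linarith [ht.2])
    have h2 : 0 ≤ K * (max (t1 - t) 0) ^ 2 := by positivity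
    exact add_nonneg h2 h1
  have hpexp : ∀ t t', p t' ≤ p t - (2 * K * max (t1 - t) 0 + μ) * (t' - t) + K * (t' - t) ^ 2 := by
    intro t t'
    have := mul_le_mul_of_nonneg_left (pos_sq_expand (t1 - t) (t1 - t')) hK0.le
    simp only [p]
    linarith
  set M := 2 * K * (t1 - a) + μ + K * (a' - a) with hM
  have hM0 : 0 ≤ M := by
    have h1 : 0 ≤ K * (a' - a) := mul_nonneg hK0.le (by linarith)
    have h2 : 0 ≤ K * (t1 - a) := mul_nonneg hK0.le (by linarith)
    rw [hM]; linarith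
  have hplip1 : ∀ t ∈ Icc a a', ∀ t' ∈ Icc a a', p t' - p t ≤ M * |t' - t| := by
    intro t ht t' ht'
    have h1 := hpexp t t'
    have h2 : max (t1 - t) 0 ≤ t1 - a := max_le (by linarith [ht.1]) hat1.le
    have h3 : |t' - t| ≤ a' - a := by
      rw [abs_le]; constructor <;> linarith [ht.1, ht.2, ht'.1, ht'.2]
    have h4 : 0 ≤ max (t1 - t) 0 := le_max_right _ _
    have h5 : -(2 * K * max (t1 - t) 0 + μ) * (t' - t) ≤ (2 * K * (t1 - a) + μ) * |t' - t| := by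
      calc -(2 * K * max (t1 - t) 0 + μ) * (t' - t) ≤ |-(2 * K * max (t1 - t) 0 + μ) * (t' - t)| := le_abs_self _
        _ = (2 * K * max (t1 - t) 0 + μ) * |t' - t| := by
          rw [abs_mul, abs_neg, abs_of_nonneg (by positivity)]
        _ ≤ _ := by gcongr
    have h6 : K * (t' - t) ^ 2 ≤ K * (a' - a) * |t' - t| := by
      rw [← sq_abs, sq, mul_assoc]
      gcongr
    rw [hM]
    linarith
  have hplip : ∀ t ∈ Icc a a', ∀ t' ∈ Icc a a', |p t - p t'| ≤ M * Real.sqrt (a' - a) * Real.sqrt |t - t'| := by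
    intro t ht t' ht'
    have h3 : |t - t'| ≤ a' - a := by
      rw [abs_le]; constructor <;> linarith [ht.1, ht.2, ht'.1, ht'.2]
    have h1 : |p t - p t'| ≤ M * |t - t'| := by
      rw [abs_le]
      have := hplip1 t ht t' ht'
      have := hplip1 t' ht' t ht
      rw [abs_sub_comm t' t] at *
      constructor <;> linarith
    have h2 : |t - t'| ≤ Real.sqrt (a' - a) * Real.sqrt |t - t'| := by
      calc |t - t'| = Real.sqrt |t - t'| * Real.sqrt |t - t'| := (Real.mul_self_sqrt (abs_nonneg _)).symm
        _ ≤ _ := by gcongr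
    calc _ ≤ _ := h1
      _ ≤ M * (Real.sqrt (a' - a) * Real.sqrt |t - t'|) := by gcongr
      _ = _ := by ring
  have hpB : ∀ t ∈ Icc a a', p t ≤ p a := by
    intro t ht
    have : max (t1 - t) 0 ≤ max (t1 - a) 0 := max_le_max (by linarith [ht.1]) le_rfl
    have h4 : 0 ≤ max (t1 - t) 0 := le_max_right _ _
    simp only [p]
    gcongr
    exact ht.1
  let cl : ℝ → ℝ := fun t => max a (min t a')
  have hcl : ∀ t, cl t ∈ Icc a a' := clamp_mem a a' haa.le
  set C' := C + M * Real.sqrt (a' - a) with hC'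
  have hC'0 : 0 ≤ C' := by positivity
  have hCC : C ≤ C' := by
    have : 0 ≤ M * Real.sqrt (a' - a) := by positivity
    linarith
  have hpa : 0 ≤ p a := hp0 a ⟨le_rfl, haa.le⟩
  have hev : ∀ t ∈ Ioo a a', ∀ᶠ r in nhds t, cl r = r := by
    intro t ht
    filter_upwards [isOpen_Ioo.mem_nhds ht] with r hr
    exact clamp_eq a a' r ⟨hr.1.le, hr.2.le⟩
  have hsq : ∀ t r, Real.sqrt |cl t - cl r| ≤ Real.sqrt |t - r| := fun t r =>
    Real.sqrt_le_sqrt (clamp_lip a a' t r)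
  have := compare_strict d T L hL b s g hco a a' ha ha' (fun t x => u (cl t) x - p (cl t))
    (fun t x => w (cl t) x) C' hC'0 ?_ ?_ (B + p a) (by positivity) ?_ ?_ μ hμ ?_ ?_ ?_ t0 x0
  · simp only [cl, clamp_eq a a' t0 ⟨ht0.1.le, ht0.2.le⟩, p] at this
    have e : max (t1 - t0) 0 = 0 := max_eq_right (by rw [ht1]; linarith [ht0.1])
    rw [e] at this
    linarith
  · intro t x r y
    have h1 := hm1 (cl t) (hcl t) x (cl r) (hcl r) y
    have h2 := hplip (cl t) (hcl t) (cl r) (hcl r)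
    have h3 : |u (cl t) x - p (cl t) - (u (cl r) y - p (cl r))|
        ≤ |u (cl t) x - u (cl r) y| + |p (cl t) - p (cl r)| := by
      have e : u (cl t) x - p (cl t) - (u (cl r) y - p (cl r)) = (u (cl t) x - u (cl r) y) - (p (cl t) - p (cl r)) := by ring
      rw [e]; exact abs_sub _ _
    have h4 : C * Real.sqrt |cl t - cl r| ≤ C * Real.sqrt |t - r| :=
      mul_le_mul_of_nonneg_left (hsq t r) hC
    have h5 : M * Real.sqrt (a' - a) * Real.sqrt |cl t - cl r| ≤ M * Real.sqrt (a' - a) * Real.sqrt |t - r| :=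
      mul_le_mul_of_nonneg_left (hsq t r) (by positivity)
    have h6 : C * ‖x - y‖ ≤ C' * ‖x - y‖ := by gcongr
    have h7 : C' * Real.sqrt |t - r| = C * Real.sqrt |t - r| + M * Real.sqrt (a' - a) * Real.sqrt |t - r| := by
      rw [hC']; ring
    linarith
  · intro t x r y
    have h1 := hm2 (cl t) (hcl t) x (cl r) (hcl r) y
    exact h1.trans (mul_le_mul hCC (by linarith [hsq t r]) (by positivity) hC'0)
  · intro t x
    have h1 := hB1 (cl t) (hcl t) x
    have h2 := hpB (cl t) (hcl t)
    have h3 := hp0 (cl t) (hcl t)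
    rw [abs_le] at *
    constructor <;> linarith
  · intro t x
    have h1 := hB2 (cl t) (hcl t) x
    linarith
  · intro t ht x τ q A hj
    have hj1 := upjet_congr _ (fun t x => u t x - p t) t x τ q A
      ((hev t ht).mono fun r hr y => by simp only [hr]) hj
    obtain ⟨c, hc⟩ := hj1
    have hj2 : UpJet u t x (τ - (2 * K * max (t1 - t) 0 + μ)) q A := by
      refine ⟨c + K, ?_⟩
      filter_upwards [hc] with P hP
      have := hpexp t P.1
      linarith
    have h1 := hu t ht x _ q A hj2
    have h4 : 0 ≤ 2 * K * max (t1 - t) 0 := by positivity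
    linarith
  · intro t ht x τ q A hlt hj
    have hct : cl t = t := (hev t ht).self_of_nhds
    have hj1 := upjet_congr _ (fun t x => -w t x) t x τ q A
      ((hev t ht).mono fun r hr y => by simp only [hr]) hj
    refine hw t ht x τ q A ?_ hj1
    simp only [hct] at hlt
    have := hp0 t ⟨ht.1.le, ht.2.le⟩
    linarith
  · intro t ht x
    rcases le_or_gt t a with h | h
    · have e : cl t = a := max_eq_left (by exact (min_le_left _ _).trans h)
      simp only [e]
      have h1 := abs_le.1 (hB1 a ⟨le_rfl, haa.le⟩ x)
      have h2 := abs_le.1 (hB2 a ⟨le_rfl, haa.le⟩ x)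
      have h3 : 2 * B ≤ p a := by
        simp only [p]
        rw [max_eq_left hat1.le, hK]
        have : 2 * B / (t1 - a) ^ 2 * (t1 - a) ^ 2 = 2 * B := by field_simp
        rw [this]
        have : 0 ≤ μ * (a' - a) := mul_nonneg hμ.le (by linarith)
        linarith
      linarith
    · have h' : a' ≤ t := by
        by_contra hh; push Not at hh; exact ht ⟨h, hh⟩
      have e : cl t = a' := by
        simp only [cl]; rw [min_eq_right h', max_eq_right haa.le]
      simp only [e]
      have := hp0 a' ⟨haa.le, le_rfl⟩
      linarith [hend x]

/-- comparison principle on a strip, terminal condition only -/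
lemma compare_strip (d : ℕ) (T L : ℝ) (hL : 0 < L) (b : ℝ → X → X) (s : ℝ → X → Fin d → X)
    (g : ℝ → X → ℝ) (hco : CoefOK d T L b s g) (a a' : ℝ) (ha : 0 ≤ a) (ha' : a' ≤ T)
    (haa : a < a')
    (u w : ℝ → X → ℝ) (C : ℝ) (hC : 0 ≤ C)
    (hm1 : ∀ t ∈ Icc a a', ∀ x, ∀ s ∈ Icc a a', ∀ y,
      |u t x - u s y| ≤ C * (Real.sqrt |t - s| + ‖x - y‖))
    (hm2 : ∀ t ∈ Icc a a', ∀ x, ∀ s ∈ Icc a a', ∀ y,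
      |w t x - w s y| ≤ C * (Real.sqrt |t - s| + ‖x - y‖))
    (B : ℝ) (hB : 0 < B) (hB1 : ∀ t ∈ Icc a a', ∀ x, |u t x| ≤ B)
    (hB2 : ∀ t ∈ Icc a a', ∀ x, |w t x| ≤ B)
    (hu : ∀ t ∈ Ioo a a', ∀ x τ q A, UpJet u t x τ q A →
      0 ≤ τ + ⟪b t x, q⟫ + 1 / 2 * ∑ j, ⟪A (s t x j), s t x j⟫ + g t x)
    (hw : ∀ t ∈ Ioo a a', ∀ x τ q A, w t x < u t x → UpJet (fun t x => -w t x) t x τ q A →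
      0 ≤ τ + ⟪b t x, q⟫ + 1 / 2 * ∑ j, ⟪A (s t x j), s t x j⟫ - g t x)
    (hend : ∀ x, u a' x ≤ w a' x) : ∀ t ∈ Icc a a', ∀ x, u t x ≤ w t x := by
  have key : ∀ t ∈ Ioo a a', ∀ x, u t x ≤ w t x := by
    intro t ht x
    refine le_of_forall_pos_le_add fun e he => ?_
    have hpos : 0 < a' - t := by linarith [ht.2]
    have := compare_pre d T L hL b s g hco a a' ha ha' haa u w C hC hm1 hm2 B hB hB1 hB2 hu hw hend
      t ht x (e / (a' - t)) (by positivity)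
    rw [div_mul_cancel₀ _ hpos.ne'] at this
    linarith
  intro t ht x
  rcases eq_or_lt_of_le ht.2 with h | h
  · rw [h]; exact hend x
  rcases eq_or_lt_of_le ht.1 with h' | h'
  · subst h'
    refine le_of_forall_pos_le_add fun e he => ?_
    obtain ⟨dd, hd, hd1, hd2⟩ := small_dt (C + 1) (e / 2) ((a' - a) / 2) (by positivity) (by positivity)
      (by linarith)
    have hmem : a + dd ∈ Ioo a a' := ⟨by linarith, by linarith⟩
    have h1 := key (a + dd) hmem x
    have h2 := (abs_le.1 (hm1 a ht x (a + dd) ⟨hmem.1.le, hmem.2.le⟩ x)).2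
    have h3 := (abs_le.1 (hm2 a ht x (a + dd) ⟨hmem.1.le, hmem.2.le⟩ x)).1
    rw [show a - (a + dd) = -dd by ring, abs_neg, abs_of_pos hd, sub_self, norm_zero, add_zero] at h2 h3
    have h4 : 0 ≤ C * dd := by positivity
    linarith [Real.sqrt_nonneg dd]
  · exact key t ⟨h', h⟩ x
end

/-- symmetrised matrix of an operator -/
noncomputable def symMat (n : ℕ) (A : EuclideanSpace ℝ (Fin n) →L[ℝ] EuclideanSpace ℝ (Fin n)) :
    Matrix (Fin n) (Fin n) ℝ :=
  (1 / 2 : ℝ) • (Matrix.toEuclideanLin.symm A.toLinearMap + (Matrix.toEuclideanLin.symm A.toLinearMap)ᵀ)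

lemma symMat_symm (n : ℕ) (A : EuclideanSpace ℝ (Fin n) →L[ℝ] EuclideanSpace ℝ (Fin n)) :
    (symMat n A).IsSymm := by
  unfold symMat Matrix.IsSymm
  rw [Matrix.transpose_smul, Matrix.transpose_add, Matrix.transpose_transpose, add_comm]

lemma toEL_transpose (n : ℕ) (M : Matrix (Fin n) (Fin n) ℝ) (x y : EuclideanSpace ℝ (Fin n)) :
    ⟪Matrix.toEuclideanLin Mᵀ x, y⟫ = ⟪x, Matrix.toEuclideanLin M y⟫ := by
  have := Matrix.toEuclideanLin_conjTranspose_eq_adjoint (𝕜 := ℝ) M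
  rw [Matrix.conjTranspose_eq_transpose_of_trivial] at this
  rw [this, LinearMap.adjoint_inner_left]

lemma symMat_inner (n : ℕ) (A : EuclideanSpace ℝ (Fin n) →L[ℝ] EuclideanSpace ℝ (Fin n))
    (w : EuclideanSpace ℝ (Fin n)) :
    ⟪Matrix.toEuclideanLin (symMat n A) w, w⟫ = ⟪A w, w⟫ := by
  unfold symMat
  rw [map_smul, map_add, LinearMap.smul_apply, LinearMap.add_apply, inner_smul_left, inner_add_left,
    toEL_transpose, LinearEquiv.apply_symm_apply]
  have h := real_inner_comm w (A w)
  simp only [ContinuousLinearMap.coe_coe, h]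
  simp; linarith

/-- columns -/
noncomputable def colv (n d : ℕ) (S : Matrix (Fin n) (Fin d) ℝ) (j : Fin d) :
    EuclideanSpace ℝ (Fin n) := WithLp.toLp 2 (fun i => S i j)

lemma trace_eq_cols (n d : ℕ) (S : Matrix (Fin n) (Fin d) ℝ) (M : Matrix (Fin n) (Fin n) ℝ) :
    (Sᵀ * M * S).trace = ∑ j, ⟪Matrix.toEuclideanLin M (colv n d S j), colv n d S j⟫ := by
  unfold Matrix.trace
  refine Finset.sum_congr rfl fun j _ => ?_
  rw [Matrix.mul_assoc, Matrix.diag_apply, Matrix.mul_apply, PiLp.inner_apply]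
  refine Finset.sum_congr rfl fun i _ => ?_
  simp [colv, Matrix.toLpLin_apply, Matrix.mul_apply, Matrix.mulVec, dotProduct]

lemma frob_cols (n d : ℕ) (S : Matrix (Fin n) (Fin d) ℝ) :
    ∑ j, ‖colv n d S j‖ ^ 2 = frobNorm n d S ^ 2 := by
  unfold frobNorm
  rw [Real.sq_sqrt (by positivity), Finset.sum_comm]
  refine Finset.sum_congr rfl fun j _ => ?_
  rw [EuclideanSpace.norm_sq_eq]
  simp [colv]

lemma quad_grad (n : ℕ) (x0 q : EuclideanSpace ℝ (Fin n)) (M : Matrix (Fin n) (Fin n) ℝ)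
    (hM : M.IsSymm) (C : ℝ) (x : EuclideanSpace ℝ (Fin n)) :
    HasGradientAt (fun y => C + (⟪q, y - x0⟫ + 1 / 2 * ⟪Matrix.toEuclideanLin M (y - x0), y - x0⟫))
      (q + Matrix.toEuclideanLin M (x - x0)) x := by
  rw [hasGradientAt_iff_hasFDerivAt]
  set Mc := LinearMap.toContinuousLinearMap (Matrix.toEuclideanLin M) with hMc
  have hMe : ∀ y, Matrix.toEuclideanLin M y = Mc y := fun _ => rfl
  simp only [hMe]
  have hid : HasFDerivAt (fun y : EuclideanSpace ℝ (Fin n) => y - x0)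
    (ContinuousLinearMap.id ℝ (EuclideanSpace ℝ (Fin n))) x := (hasFDerivAt_id x).sub_const x0
  have h2 := Mc.hasFDerivAt (x := x - x0) |>.comp x hid
  have h3 := HasFDerivAt.inner ℝ h2 hid
  have h4 := HasFDerivAt.inner ℝ (hasFDerivAt_const q x) hid
  have h5 := (h4.add (h3.const_mul (1 / 2))).const_add C
  refine h5.congr_fderiv ?_
  ext w
  have hs : ⟪Mc w, x - x0⟫ = ⟪Mc (x - x0), w⟫ := by
    have := toEL_transpose n M w (x - x0)
    rw [hM.eq, hMe, hMe] at this
    rw [this, real_inner_comm]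
  simp only [map_sub, inner_sub_left] at hs
  simp [inner_add_left, fderivInnerCLM_apply, inner_sub_left, inner_sub_right] at hs ⊢
  linarith

/-- the quadratic test functions -/
noncomputable def qTest (n : ℕ) (T δ : ℝ) (t0 τ c2 k cc : ℝ) (x0 q : EuclideanSpace ℝ (Fin n))
    (M : Matrix (Fin n) (Fin n) ℝ) (hM : M.IsSymm) (ρ ρ' : ℝ → ℝ)
    (hρ : ∀ r, HasDerivAt ρ (ρ' r) r) (hρc : Continuous ρ') (hfl : ∀ r, δ ≤ r → ρ r = ρ δ) :
    TestFn n T δ where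
  φ t r x := (τ * (t - t0) + c2 * (t - t0) ^ 2 + k * (t - ρ r - cc) ^ 2)
    + (⟪q, x - x0⟫ + 1 / 2 * ⟪Matrix.toEuclideanLin M (x - x0), x - x0⟫)
  φt t r x := τ + 2 * c2 * (t - t0) + 2 * k * (t - ρ r - cc)
  φr t r x := -(2 * k * (t - ρ r - cc) * ρ' r)
  φx t r x := q + Matrix.toEuclideanLin M (x - x0)
  φxx t r x := M
  cont := by
    have hc : Continuous ρ := continuous_iff_continuousAt.2 fun r => (hρ r).continuousAt
    have h2 : Continuous fun y : EuclideanSpace ℝ (Fin n) => Matrix.toEuclideanLin M y :=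
      LinearMap.continuous_of_finiteDimensional _
    fun_prop
  hasφt t r x := by
    have h1 : HasDerivAt (fun s : ℝ => s - t0) 1 t := (hasDerivAt_id t).sub_const t0
    have h2 : HasDerivAt (fun s : ℝ => s - ρ r - cc) 1 t := ((hasDerivAt_id t).sub_const _).sub_const _
    have := (((h1.const_mul τ).add ((h1.pow 2).const_mul c2)).add ((h2.pow 2).const_mul k)).add_const
      (⟪q, x - x0⟫ + 1 / 2 * ⟪Matrix.toEuclideanLin M (x - x0), x - x0⟫)
    refine this.congr_deriv ?_
    simp; ring
  hasφr t r x := by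
    have h2 : HasDerivAt (fun s : ℝ => t - ρ s - cc) (-ρ' r) r := ((hρ r).const_sub t).sub_const cc
    have := ((((h2.pow 2).const_mul k)).const_add (τ * (t - t0) + c2 * (t - t0) ^ 2)).add_const
      (⟪q, x - x0⟫ + 1 / 2 * ⟪Matrix.toEuclideanLin M (x - x0), x - x0⟫)
    refine this.congr_deriv ?_
    simp; ring
  hasφx t r x := quad_grad n x0 q M hM _ x
  hasφxx t r x := by
    have hid : HasFDerivAt (fun y : EuclideanSpace ℝ (Fin n) => y - x0)
      (ContinuousLinearMap.id ℝ (EuclideanSpace ℝ (Fin n))) x := (hasFDerivAt_id x).sub_const x0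
    have h2 := ((LinearMap.toContinuousLinearMap (Matrix.toEuclideanLin M)).hasFDerivAt (x := x - x0)
      |>.comp x hid).const_add q
    exact h2
  contφt := by
    have hc : Continuous ρ := continuous_iff_continuousAt.2 fun r => (hρ r).continuousAt
    fun_prop
  contφr := by
    have hc : Continuous ρ := continuous_iff_continuousAt.2 fun r => (hρ r).continuousAt
    fun_prop
  contφx := by
    have h2 : Continuous fun y : EuclideanSpace ℝ (Fin n) => Matrix.toEuclideanLin M y :=
      LinearMap.continuous_of_finiteDimensional _
    fun_prop
  contφxx := by fun_prop
  symm t r x := hM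
  flat t r x hr := by rw [hfl r hr]

/-- quadratic test values -/
noncomputable def qF (n : ℕ) (t0 τ c2 k cc : ℝ) (x0 q : EuclideanSpace ℝ (Fin n))
    (M : Matrix (Fin n) (Fin n) ℝ) (ρ : ℝ → ℝ) (t r : ℝ) (x : EuclideanSpace ℝ (Fin n)) : ℝ :=
  (τ * (t - t0) + c2 * (t - t0) ^ 2 + k * (t - ρ r - cc) ^ 2)
    + (⟪q, x - x0⟫ + 1 / 2 * ⟪Matrix.toEuclideanLin M (x - x0), x - x0⟫)

/-- the viscosity property for quadratic test functions from above -/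
def Touch (n d : ℕ) (T δ : ℝ) (b : ℝ → EuclideanSpace ℝ (Fin n) → EuclideanSpace ℝ (Fin n))
    (s : ℝ → EuclideanSpace ℝ (Fin n) → Fin d → EuclideanSpace ℝ (Fin n))
    (G : ℝ → EuclideanSpace ℝ (Fin n) → ℝ) (W : ℝ → ℝ → EuclideanSpace ℝ (Fin n) → ℝ)
    (Q : ℝ → ℝ → EuclideanSpace ℝ (Fin n) → Prop) : Prop :=
  ∀ (t0 τ c2 k cc : ℝ) (x0 q : EuclideanSpace ℝ (Fin n))
    (M : Matrix (Fin n) (Fin n) ℝ) (_ : M.IsSymm) (ρ ρ' : ℝ → ℝ)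
    (_ : ∀ r, HasDerivAt ρ (ρ' r) r) (_ : Continuous ρ') (_ : ∀ r, δ ≤ r → ρ r = ρ δ),
    ∀ t ∈ Ioo 0 T, ∀ r ∈ Ioo 0 T, ∀ x, Q t r x →
    (∀ᶠ p in nhds ((t, r, x) : ℝ × ℝ × EuclideanSpace ℝ (Fin n)),
      W p.1 p.2.1 p.2.2 - qF n t0 τ c2 k cc x0 q M ρ p.1 p.2.1 p.2.2 ≤
        W t r x - qF n t0 τ c2 k cc x0 q M ρ t r x) →
    0 ≤ (τ + 2 * c2 * (t - t0) + 2 * k * (t - ρ r - cc) * (1 - ρ' r))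
      + ⟪b t x, q + Matrix.toEuclideanLin M (x - x0)⟫
      + 1 / 2 * ∑ j, ⟪Matrix.toEuclideanLin M (s t x j), s t x j⟫ + G t x

lemma exists_rho (r1 δ : ℝ) (h : r1 < δ) : ∃ ρ ρ' : ℝ → ℝ, (∀ r, HasDerivAt ρ (ρ' r) r) ∧
    Continuous ρ' ∧ (∀ r, δ ≤ r → ρ r = ρ δ) ∧ (∀ r ≤ r1, ρ r = r) ∧ (∀ r ≤ r1, ρ' r = 1) := by
  set ρ' : ℝ → ℝ := fun r => max 0 (min 1 ((δ - r) / (δ - r1))) with hρ'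
  have hc : Continuous ρ' := by rw [hρ']; fun_prop
  have hpos : 0 < δ - r1 := by linarith
  have h1 : ∀ r ≤ r1, ρ' r = 1 := by
    intro r hr
    have : 1 ≤ (δ - r) / (δ - r1) := by rw [le_div_iff₀ hpos]; linarith
    simp [hρ', min_eq_left this]
  have h0 : ∀ r, δ ≤ r → ρ' r = 0 := by
    intro r hr
    have : (δ - r) / (δ - r1) ≤ 0 := div_nonpos_of_nonpos_of_nonneg (by linarith) hpos.le
    simp only [hρ']
    exact max_eq_left (le_trans (min_le_right _ _) this)
  refine ⟨fun r => r1 + ∫ y in r1..r, ρ' y, ρ', ?_, hc, ?_, ?_, h1⟩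
  · intro r
    exact (hc.integral_hasStrictDerivAt r1 r).hasDerivAt.const_add r1
  · intro r hr
    have h3 : ∫ y in δ..r, ρ' y = 0 := by
      rw [intervalIntegral.integral_congr (g := fun _ => 0)]
      · simp
      · intro y hy
        rw [uIcc_of_le hr] at hy
        exact h0 y hy.1
    have := intervalIntegral.integral_add_adjacent_intervals
      (hc.intervalIntegrable (μ := MeasureTheory.volume) r1 δ)
      (hc.intervalIntegrable (μ := MeasureTheory.volume) δ r)
    show r1 + _ = r1 + _
    linarith
  · intro r hr
    have h3 : ∫ y in r1..r, ρ' y = r - r1 := by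
      rw [intervalIntegral.integral_congr (g := fun _ => 1)]
      · simp
      · intro y hy
        rw [uIcc_of_ge hr] at hy
        exact h1 y hy.2
    show r1 + _ = r
    linarith

lemma touch_flat (n d : ℕ) (T δ : ℝ) (hδ : 0 < δ) (hδT : δ < T)
    (b : ℝ → EuclideanSpace ℝ (Fin n) → EuclideanSpace ℝ (Fin n))
    (s : ℝ → EuclideanSpace ℝ (Fin n) → Fin d → EuclideanSpace ℝ (Fin n))
    (G : ℝ → EuclideanSpace ℝ (Fin n) → ℝ) (W : ℝ → ℝ → EuclideanSpace ℝ (Fin n) → ℝ)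
    (Q : ℝ → ℝ → EuclideanSpace ℝ (Fin n) → Prop) (hW : Touch n d T δ b s G W Q)
    (hfl : ∀ t r x, δ ≤ r → r ≤ T → W t r x = W t δ x)
    (t : ℝ) (ht : t ∈ Ioo 0 T) (x : EuclideanSpace ℝ (Fin n)) (hQ : ∀ r, δ ≤ r → r < T → Q t r x)
    (τ : ℝ) (q : EuclideanSpace ℝ (Fin n)) (A : EuclideanSpace ℝ (Fin n) →L[ℝ] EuclideanSpace ℝ (Fin n))
    (hj : UpJet (fun t x => W t δ x) t x τ q A) :
    0 ≤ τ + ⟪b t x, q⟫ + 1 / 2 * ∑ j, ⟪A (s t x j), s t x j⟫ + G t x := by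
  obtain ⟨c, hc⟩ := hj
  have hr1 : δ < (δ + T) / 2 := by linarith
  have hr2 : (δ + T) / 2 < T := by linarith
  have := hW t τ c 0 0 x q (symMat n A) (symMat_symm n A) (fun _ => 0) (fun _ => 0)
    (fun r => hasDerivAt_const r 0) continuous_const (fun _ _ => rfl) t ht ((δ + T) / 2)
    ⟨by linarith, hr2⟩ x (hQ _ hr1.le hr2) ?_
  · simpa [symMat_inner] using this
  · have hcont : Filter.Tendsto (fun p : ℝ × ℝ × EuclideanSpace ℝ (Fin n) => (p.1, p.2.2))
        (nhds (t, (δ + T) / 2, x)) (nhds (t, x)) := by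
      apply Continuous.tendsto'
      · fun_prop
      · rfl
    have h1 := hcont.eventually hc
    have h2 : ∀ᶠ p in nhds ((t, (δ + T) / 2, x) : ℝ × ℝ × EuclideanSpace ℝ (Fin n)),
        p.2.1 ∈ Ioo δ T := by
      have : Filter.Tendsto (fun p : ℝ × ℝ × EuclideanSpace ℝ (Fin n) => p.2.1)
        (nhds (t, (δ + T) / 2, x)) (nhds ((δ + T) / 2)) := by
        apply Continuous.tendsto'
        · fun_prop
        · rfl
      exact this.eventually (Ioo_mem_nhds hr1 hr2)
    filter_upwards [h1, h2] with p hp1 hp2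
    rw [hfl p.1 p.2.1 p.2.2 hp2.1.le hp2.2.le, hfl t ((δ + T) / 2) x hr1.le hr2.le]
    simp only [qF, symMat_inner]
    simp at hp1 ⊢
    linarith

set_option maxHeartbeats 1000000 in
lemma touch_char_pre (n d : ℕ) (T δ : ℝ) (hδ : 0 < δ) (hδT : δ < T)
    (b : ℝ → EuclideanSpace ℝ (Fin n) → EuclideanSpace ℝ (Fin n))
    (s : ℝ → EuclideanSpace ℝ (Fin n) → Fin d → EuclideanSpace ℝ (Fin n))
    (G : ℝ → EuclideanSpace ℝ (Fin n) → ℝ) (W : ℝ → ℝ → EuclideanSpace ℝ (Fin n) → ℝ)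
    (Q : ℝ → ℝ → EuclideanSpace ℝ (Fin n) → Prop) (hW : Touch n d T δ b s G W Q)
    (hQ : ∀ t ∈ Ioo 0 T, ∀ r ∈ Ioo 0 δ, ∀ x, Q t r x)
    (hWc : ContinuousOn (fun p : ℝ × ℝ × EuclideanSpace ℝ (Fin n) => W p.1 p.2.1 p.2.2) (Dom n T))
    (C : ℝ) (hC : 0 < C)
    (hmod : ∀ t ∈ Icc 0 T, ∀ r ∈ Icc 0 δ, ∀ r' ∈ Icc 0 δ, ∀ x,
      |W t r x - W t r' x| ≤ C * Real.sqrt |r - r'|)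
    (c t : ℝ) (ht : t ∈ Ioo 0 T) (hr : t - c ∈ Ioo 0 δ) (x : EuclideanSpace ℝ (Fin n))
    (τ : ℝ) (q : EuclideanSpace ℝ (Fin n)) (A : EuclideanSpace ℝ (Fin n) →L[ℝ] EuclideanSpace ℝ (Fin n))
    (c0 : ℝ) (hj : ∀ᶠ p in nhds ((t, x) : ℝ × EuclideanSpace ℝ (Fin n)),
      W p.1 (p.1 - c) p.2 ≤ W t (t - c) x + τ * (p.1 - t) + c0 * (p.1 - t) ^ 2
        + ⟪q, p.2 - x⟫ + 1 / 2 * ⟪A (p.2 - x), p.2 - x⟫) (κ : ℝ) (hκ : 0 < κ) (rad : ℝ) (hrad : 0 < rad) :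
    ∃ t' x', |t' - t| < rad ∧ ‖x' - x‖ < rad ∧
    0 ≤ (τ + 2 * (c0 + κ) * (t' - t))
      + ⟪b t' x', q + Matrix.toEuclideanLin (symMat n A + (2 * κ) • (1 : Matrix (Fin n) (Fin n) ℝ)) (x' - x)⟫
      + 1 / 2 * ∑ j, ⟪Matrix.toEuclideanLin (symMat n A + (2 * κ) • (1 : Matrix (Fin n) (Fin n) ℝ))
        (s t' x' j), s t' x' j⟫ + G t' x' := by
  set M := symMat n A + (2 * κ) • (1 : Matrix (Fin n) (Fin n) ℝ) with hM
  have hMs : M.IsSymm := by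
    rw [hM]; unfold Matrix.IsSymm
    rw [Matrix.transpose_add, (symMat_symm n A).eq, Matrix.transpose_smul, Matrix.transpose_one]
  have hMq : ∀ y, 1 / 2 * ⟪Matrix.toEuclideanLin M y, y⟫ = 1 / 2 * ⟪A y, y⟫ + κ * ‖y‖ ^ 2 := by
    intro y
    have e1 : Matrix.toEuclideanLin (1 : Matrix (Fin n) (Fin n) ℝ) y = y := by
      simp
    rw [hM, map_add, map_smul, LinearMap.add_apply, LinearMap.smul_apply, e1, inner_add_left, symMat_inner,
      real_inner_smul_left, real_inner_self_eq_norm_sq]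
    ring
  obtain ⟨ε, hε, hball⟩ := Metric.eventually_nhds_iff.1 hj
  obtain ⟨ht0, htT⟩ := ht
  obtain ⟨hr0, hrδ⟩ := hr
  -- the radius
  obtain ⟨R, hR, hR1, hR2, hR3, hR4, hR5, hR6⟩ : ∃ R > 0, R < rad ∧ R < ε ∧ R < t ∧ R < T - t ∧
      4 * R < t - c ∧ 4 * R < δ - (t - c) := by
    have : ∃ m > 0, m ≤ rad ∧ m ≤ ε ∧ m ≤ t ∧ m ≤ T - t ∧ m ≤ t - c ∧ m ≤ δ - (t - c) :=
      ⟨min rad (min ε (min t (min (T - t) (min (t - c) (δ - (t - c)))))),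
        by simp only [gt_iff_lt, lt_min_iff]; refine ⟨hrad, hε, ht0, ?_, hr0, ?_⟩ <;> linarith,
        by simp, by simp, by simp, by simp, by simp, by simp⟩
    obtain ⟨m, h0, h1, h2, h3, h4, h5, h6⟩ := this
    exact ⟨m / 5, by positivity, by linarith, by linarith, by linarith, by linarith, by linarith, by linarith⟩
  obtain ⟨s0, hs0, hs0e, hs0R⟩ := small_dt C (κ * R ^ 2 / 2) R hC (by positivity) hR
  have hs0' : C * Real.sqrt s0 < κ * R ^ 2 := by
    have : 0 < κ * R ^ 2 := by positivity
    nlinarith only [hs0e, hs0, hC, this, mul_pos hC hs0]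
  obtain ⟨k, hk0, hk⟩ : ∃ k > 0, C * Real.sqrt s0 < k * s0 ^ 2 := by
    refine ⟨(C * Real.sqrt s0 + 1) / s0 ^ 2, by positivity, ?_⟩
    rw [div_mul_cancel₀ _ (by positivity)]; linarith
  set r1 := (t - c + δ) / 2 with hr1
  obtain ⟨ρ, ρ', hρd, hρc, hρfl, hρ1, hρ2⟩ := exists_rho r1 δ (by rw [hr1]; linarith)
  let X := EuclideanSpace ℝ (Fin n)
  let F : ℝ × ℝ × X → ℝ := fun p => W p.1 (p.1 - c + p.2.1) p.2.2 -
    (τ * (p.1 - t) + (c0 + κ) * (p.1 - t) ^ 2 + k * p.2.1 ^ 2 +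
      (⟪q, p.2.2 - x⟫ + 1 / 2 * ⟪Matrix.toEuclideanLin M (p.2.2 - x), p.2.2 - x⟫))
  let S : Set (ℝ × ℝ × X) := Icc (t - R) (t + R) ×ˢ Icc (-s0) s0 ×ˢ Metric.closedBall x R
  have hScomp : IsCompact S := isCompact_Icc.prod (isCompact_Icc.prod (isCompact_closedBall x R))
  have hSne : (t, 0, x) ∈ S := by
    refine ⟨⟨by simp; linarith, by simp; linarith⟩, ⟨by simp; linarith, by simp; linarith⟩, ?_⟩
    simp [hR.le]
  have hFc : ContinuousOn F S := by
    apply ContinuousOn.sub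
    · have h1 : ContinuousOn (fun p : ℝ × ℝ × X => (p.1, p.1 - c + p.2.1, p.2.2)) S := by
        apply Continuous.continuousOn; fun_prop
      refine hWc.comp h1 ?_
      rintro ⟨a, e, y⟩ ⟨⟨h2, h3⟩, ⟨h4, h5⟩, h6⟩
      simp only at h2 h3 h4 h5
      refine ⟨⟨?_, ?_⟩, ⟨?_, ?_⟩, mem_univ _⟩ <;> simp only <;> linarith
    · apply Continuous.continuousOn
      have h2 : Continuous fun y : X => Matrix.toEuclideanLin M y :=
        LinearMap.continuous_of_finiteDimensional _
      fun_prop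
  obtain ⟨⟨t', e', x'⟩, hpS, hmax⟩ := hScomp.exists_isMaxOn ⟨_, hSne⟩ hFc
  obtain ⟨⟨h2, h3⟩, ⟨h4, h5⟩, h6⟩ := hpS
  simp only [Metric.mem_closedBall, dist_eq_norm] at h2 h3 h4 h5 h6
  have hF0 : F (t, 0, x) = W t (t - c) x := by simp [F]
  have hge : W t (t - c) x ≤ F (t', e', x') := hF0 ▸ hmax hSne
  have hjet : W t' (t' - c) x' ≤ W t (t - c) x + τ * (t' - t) + c0 * (t' - t) ^ 2
        + ⟪q, x' - x⟫ + 1 / 2 * ⟪A (x' - x), x' - x⟫ := by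
    apply hball (y := (t', x'))
    rw [Prod.dist_eq, max_lt_iff]
    refine ⟨?_, ?_⟩
    · simp only [Real.dist_eq]; rw [abs_lt]; constructor <;> linarith
    · simp only [dist_eq_norm]; linarith
  have hmo := hmod t' ⟨by linarith, by linarith⟩ (t' - c + e') ⟨by linarith, by linarith⟩ (t' - c)
    ⟨by linarith, by linarith⟩ x'
  have hmo' := (abs_le.1 hmo).2
  rw [show t' - c + e' - (t' - c) = e' by ring] at hmo'
  have habs : |e'| ≤ s0 := abs_le.2 ⟨h4, h5⟩
  have hsq : C * Real.sqrt |e'| ≤ C * Real.sqrt s0 :=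
    mul_le_mul_of_nonneg_left (Real.sqrt_le_sqrt habs) hC.le
  have hkey : κ * (t' - t) ^ 2 + κ * ‖x' - x‖ ^ 2 + k * e' ^ 2 ≤ C * Real.sqrt s0 := by
    have := hMq (x' - x)
    simp only [F] at hge
    rw [this] at hge
    linarith only [hge, hjet, hmo', hsq]
  have p1 : 0 ≤ κ * (t' - t) ^ 2 := by positivity
  have p2 : 0 ≤ κ * ‖x' - x‖ ^ 2 := by positivity
  have p3 : 0 ≤ k * e' ^ 2 := by positivity
  have i1 : |t' - t| < R := by
    apply abs_lt_of_sq_lt_sq _ hR.le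
    have : κ * (t' - t) ^ 2 < κ * R ^ 2 := by linarith
    exact lt_of_mul_lt_mul_left this hκ.le
  have i2 : ‖x' - x‖ < R := by
    have : κ * ‖x' - x‖ ^ 2 < κ * R ^ 2 := by linarith
    exact lt_of_pow_lt_pow_left₀ 2 hR.le (lt_of_mul_lt_mul_left this hκ.le)
  have i3 : |e'| < s0 := by
    apply abs_lt_of_sq_lt_sq _ hs0.le
    have : k * e' ^ 2 < k * s0 ^ 2 := by linarith
    exact lt_of_mul_lt_mul_left this hk0.le
  refine ⟨t', x', by linarith, by linarith, ?_⟩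
  set r' := t' - c + e' with hr'
  have hr'1 : r' < r1 := by rw [hr', hr1]; linarith
  have htT' : t' ∈ Ioo 0 T := ⟨by linarith, by linarith⟩
  have hrT' : r' ∈ Ioo 0 δ := ⟨by rw [hr']; linarith, by rw [hr']; linarith⟩
  have := hW t τ (c0 + κ) k c x q M hMs ρ ρ' hρd hρc hρfl t' htT' r' ⟨hrT'.1, hrT'.2.trans hδT⟩ x'
    (hQ t' htT' r' hrT' x') ?_
  · rw [hρ2 r' hr'1.le] at this
    simpa using this
  · have hco : Filter.Tendsto (fun p : ℝ × ℝ × X => (p.1, p.2.1 - (p.1 - c), p.2.2))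
        (nhds (t', r', x')) (nhds (t', e', x')) := by
      apply Continuous.tendsto'
      · fun_prop
      · simp [hr']
    have hSn : S ∈ nhds (t', e', x') := by
      have a1 := abs_lt.1 i1
      have a3 := abs_lt.1 i3
      refine prod_mem_nhds (Icc_mem_nhds (by linarith) (by linarith))
        (prod_mem_nhds (Icc_mem_nhds (by linarith) (by linarith)) ?_)
      exact Filter.mem_of_superset (Metric.isOpen_ball.mem_nhds (by rwa [Metric.mem_ball, dist_eq_norm]))
        Metric.ball_subset_closedBall
    have hrn : ∀ᶠ p in nhds ((t', r', x') : ℝ × ℝ × X), p.2.1 < r1 := by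
      have : Filter.Tendsto (fun p : ℝ × ℝ × X => p.2.1)
        (nhds (t', r', x')) (nhds r') := by
        apply Continuous.tendsto'
        · fun_prop
        · rfl
      exact this.eventually (gt_mem_nhds hr'1)
    filter_upwards [hco.eventually hSn, hrn] with p hp hpr
    have hm := hmax hp
    simp only [F, mem_setOf_eq] at hm
    simp only [qF]
    rw [hρ1 _ hpr.le, hρ1 _ hr'1.le]
    have e1 : p.1 - c + (p.2.1 - (p.1 - c)) = p.2.1 := by ring
    rw [e1] at hm
    have e2 : (p.2.1 - (p.1 - c)) ^ 2 = (p.1 - p.2.1 - c) ^ 2 := by ring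
    have e3 : (t' - r' - c) ^ 2 = e' ^ 2 := by rw [hr']; ring
    rw [e2] at hm; rw [e3]
    linarith only [hm]

lemma touch_char (n d : ℕ) (T δ : ℝ) (hδ : 0 < δ) (hδT : δ < T)
    (b : ℝ → EuclideanSpace ℝ (Fin n) → EuclideanSpace ℝ (Fin n))
    (s : ℝ → EuclideanSpace ℝ (Fin n) → Fin d → EuclideanSpace ℝ (Fin n))
    (G : ℝ → EuclideanSpace ℝ (Fin n) → ℝ) (W : ℝ → ℝ → EuclideanSpace ℝ (Fin n) → ℝ)
    (Q : ℝ → ℝ → EuclideanSpace ℝ (Fin n) → Prop) (hW : Touch n d T δ b s G W Q)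
    (hQ : ∀ t ∈ Ioo 0 T, ∀ r ∈ Ioo 0 δ, ∀ x, Q t r x)
    (hWc : ContinuousOn (fun p : ℝ × ℝ × EuclideanSpace ℝ (Fin n) => W p.1 p.2.1 p.2.2) (Dom n T))
    (C : ℝ) (hC : 0 < C)
    (hmod : ∀ t ∈ Icc 0 T, ∀ r ∈ Icc 0 δ, ∀ r' ∈ Icc 0 δ, ∀ x,
      |W t r x - W t r' x| ≤ C * Real.sqrt |r - r'|)
    (c t : ℝ) (ht : t ∈ Ioo 0 T) (hr : t - c ∈ Ioo 0 δ) (x : EuclideanSpace ℝ (Fin n))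
    (hbc : ContinuousAt (fun p : ℝ × EuclideanSpace ℝ (Fin n) => b p.1 p.2) (t, x))
    (hsc : ∀ j, ContinuousAt (fun p : ℝ × EuclideanSpace ℝ (Fin n) => s p.1 p.2 j) (t, x))
    (hGc : ContinuousAt (fun p : ℝ × EuclideanSpace ℝ (Fin n) => G p.1 p.2) (t, x))
    (τ : ℝ) (q : EuclideanSpace ℝ (Fin n)) (A : EuclideanSpace ℝ (Fin n) →L[ℝ] EuclideanSpace ℝ (Fin n))
    (hj : UpJet (fun t x => W t (t - c) x) t x τ q A) :
    0 ≤ τ + ⟪b t x, q⟫ + 1 / 2 * ∑ j, ⟪A (s t x j), s t x j⟫ + G t x := by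
  obtain ⟨c0, hj⟩ := hj
  have hκ : ∀ κ > 0, 0 ≤ (τ + ⟪b t x, q⟫ + 1 / 2 * ∑ j, ⟪A (s t x j), s t x j⟫ + G t x)
      + κ * ∑ j, ‖s t x j‖ ^ 2 := by
    intro κ hκ
    set M := symMat n A + (2 * κ) • (1 : Matrix (Fin n) (Fin n) ℝ) with hM
    have hMq : ∀ y, ⟪Matrix.toEuclideanLin M y, y⟫ = ⟪A y, y⟫ + 2 * κ * ‖y‖ ^ 2 := by
      intro y
      have e1 : Matrix.toEuclideanLin (1 : Matrix (Fin n) (Fin n) ℝ) y = y := by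
        simp
      rw [hM, map_add, map_smul, LinearMap.add_apply, LinearMap.smul_apply, e1, inner_add_left, symMat_inner,
        real_inner_smul_left, real_inner_self_eq_norm_sq]
    let Ψ : ℝ × EuclideanSpace ℝ (Fin n) → ℝ := fun p => (τ + 2 * (c0 + κ) * (p.1 - t))
      + ⟪b p.1 p.2, q + Matrix.toEuclideanLin M (p.2 - x)⟫
      + 1 / 2 * ∑ j, ⟪Matrix.toEuclideanLin M (s p.1 p.2 j), s p.1 p.2 j⟫ + G p.1 p.2
    have hMc : Continuous fun y : EuclideanSpace ℝ (Fin n) => Matrix.toEuclideanLin M y :=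
        LinearMap.continuous_of_finiteDimensional _
    have hΨc : ContinuousAt Ψ (t, x) := by
      refine ContinuousAt.add (ContinuousAt.add (ContinuousAt.add ?_ ?_) ?_) hGc
      · apply Continuous.continuousAt; fun_prop
      · refine ContinuousAt.inner hbc ?_
        apply Continuous.continuousAt; fun_prop
      · refine continuousAt_const.mul (tendsto_finsetSum _ fun j _ => ?_)
        exact ContinuousAt.inner (hMc.continuousAt.comp (hsc j)) (hsc j)
    have hval : Ψ (t, x) = (τ + ⟪b t x, q⟫ + 1 / 2 * ∑ j, ⟪A (s t x j), s t x j⟫ + G t x)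
      + κ * ∑ j, ‖s t x j‖ ^ 2 := by
      simp only [Ψ, hMq, Finset.sum_add_distrib, ← Finset.mul_sum]
      simp
      ring
    rw [← hval]
    by_contra hneg
    push Not at hneg
    obtain ⟨ε, hε, hb⟩ := Metric.eventually_nhds_iff.1 (hΨc.eventually (gt_mem_nhds hneg))
    obtain ⟨t', x', a1, a2, a3⟩ := touch_char_pre n d T δ hδ hδT b s G W Q hW hQ hWc C hC hmod c t ht hr x
      τ q A c0 hj κ hκ ε hε
    have := hb (y := (t', x')) (by
      rw [Prod.dist_eq, max_lt_iff]
      exact ⟨by simpa [Real.dist_eq] using a1, by simpa [dist_eq_norm] using a2⟩)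
    simp only [Ψ] at this
    linarith only [this, a3]
  by_contra hneg
  push Not at hneg
  set B := τ + ⟪b t x, q⟫ + 1 / 2 * ∑ j, ⟪A (s t x j), s t x j⟫ + G t x with hB
  have hS : 0 ≤ ∑ j, ‖s t x j‖ ^ 2 := by positivity
  set S := ∑ j, ‖s t x j‖ ^ 2 with hSdef
  have h1 := hκ (-B / (2 * (S + 1))) (by apply div_pos <;> linarith)
  have h2 : -B / (2 * (S + 1)) * S ≤ -B / 2 := by
    rw [div_mul_eq_mul_div, div_le_div_iff₀ (by positivity) (by norm_num)]
    nlinarith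
  linarith

lemma unif_time {X Y : Type*} [NormedAddCommGroup X] [InnerProductSpace ℝ X] [FiniteDimensional ℝ X]
    [PseudoMetricSpace Y] (T : ℝ) (f : ℝ × X → Y) (hf : ContinuousOn f (Icc (0:ℝ) T ×ˢ (univ : Set X)))
    (R e : ℝ) (he : 0 < e) : ∃ ρ > 0, ∀ t ∈ Icc (0:ℝ) T, ∀ t' ∈ Icc (0:ℝ) T, |t - t'| ≤ ρ →
    ∀ x, ‖x‖ ≤ R → dist (f (t, x)) (f (t', x)) ≤ e := by
  haveI : ProperSpace X := FiniteDimensional.proper ℝ X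
  have hcomp : IsCompact (Icc (0:ℝ) T ×ˢ Metric.closedBall (0 : X) R) :=
    isCompact_Icc.prod (isCompact_closedBall 0 R)
  have hu := hcomp.uniformContinuousOn_of_continuous
    (hf.mono (prod_mono le_rfl (subset_univ _)))
  rw [Metric.uniformContinuousOn_iff] at hu
  obtain ⟨ρ, hρ, h⟩ := hu e he
  refine ⟨ρ / 2, by positivity, fun t ht t' ht' htt x hx => ?_⟩
  refine (h (t, x) ⟨ht, by simpa using hx⟩ (t', x) ⟨ht', by simpa using hx⟩ ?_).le
  rw [Prod.dist_eq]
  simp only [dist_self, Real.dist_eq]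
  rw [max_lt_iff]
  exact ⟨by linarith, hρ⟩

lemma colv_sub (n d : ℕ) (S S' : Matrix (Fin n) (Fin d) ℝ) (j : Fin d) :
    colv n d S j - colv n d S' j = colv n d (S - S') j := by
  ext i; simp [colv]

lemma colv_cont (n d : ℕ) : Continuous fun S : Matrix (Fin n) (Fin d) ℝ => colv n d S := by
  refine continuous_pi fun j => ?_
  unfold colv
  refine (PiLp.continuous_toLp 2 _).comp (continuous_pi fun i => ?_)
  exact continuous_id.matrix_elem i j

lemma frob_nonneg (n d : ℕ) (S : Matrix (Fin n) (Fin d) ℝ) : 0 ≤ frobNorm n d S := Real.sqrt_nonneg _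

lemma coefOK_of (n d : ℕ) (T L : ℝ)
    (b : ℝ → EuclideanSpace ℝ (Fin n) → EuclideanSpace ℝ (Fin n))
    (σ : ℝ → EuclideanSpace ℝ (Fin n) → Matrix (Fin n) (Fin d) ℝ)
    (g : ℝ → EuclideanSpace ℝ (Fin n) → ℝ)
    (h : EuclideanSpace ℝ (Fin n) → ℝ)
    (hbcont : ContinuousOn (fun p : ℝ × EuclideanSpace ℝ (Fin n) => b p.1 p.2)
      (Icc (0:ℝ) T ×ˢ (univ : Set (EuclideanSpace ℝ (Fin n)))))
    (hσcont : ContinuousOn (fun p : ℝ × EuclideanSpace ℝ (Fin n) => σ p.1 p.2)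
      (Icc (0:ℝ) T ×ˢ (univ : Set (EuclideanSpace ℝ (Fin n)))))
    (hgcont : ContinuousOn (fun p : ℝ × EuclideanSpace ℝ (Fin n) => g p.1 p.2)
      (Icc (0:ℝ) T ×ˢ (univ : Set (EuclideanSpace ℝ (Fin n)))))
    (hH1lip : ∀ t ∈ Icc (0:ℝ) T, ∀ x xh : EuclideanSpace ℝ (Fin n),
      ‖b t x - b t xh‖ + frobNorm n d (σ t x - σ t xh) ≤ L * ‖x - xh‖)
    (hH1bdd : ∀ t ∈ Icc (0:ℝ) T, ∀ x : EuclideanSpace ℝ (Fin n),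
      ‖b t x‖ + frobNorm n d (σ t x) ≤ L)
    (hH2lip : ∀ t ∈ Icc (0:ℝ) T, ∀ x xh : EuclideanSpace ℝ (Fin n),
      |g t x - g t xh| + |h x - h xh| ≤ L * ‖x - xh‖) :
    CoefOK d T L b (fun t x => colv n d (σ t x)) g where
  modt := by
    intro R e he
    set e' := min 1 (e / (d + 1)) with he'
    have hd1 : (0:ℝ) < d + 1 := by positivity
    have he'0 : 0 < e' := lt_min one_pos (by positivity)
    have he'1 : e' ≤ 1 := min_le_left _ _
    have he'2 : (d + 1) * e' ≤ e := by
      have : e' ≤ e / (d + 1) := min_le_right _ _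
      rw [le_div_iff₀ hd1] at this
      linarith
    obtain ⟨ρ1, h1, f1⟩ := unif_time T _ hbcont R e he
    obtain ⟨ρ2, h2, f2⟩ := unif_time T _ ((colv_cont n d).comp_continuousOn hσcont) R e' he'0
    obtain ⟨ρ3, h3, f3⟩ := unif_time T _ hgcont R e he
    refine ⟨min ρ1 (min ρ2 ρ3), by simp [h1, h2, h3], fun t ht t' ht' htt x hx => ⟨?_, ?_, ?_⟩⟩
    · have := f1 t ht t' ht' (htt.trans (min_le_left _ _)) x hx
      simpa [dist_eq_norm] using this
    · have := f2 t ht t' ht' (htt.trans ((min_le_right _ _).trans (min_le_left _ _))) x hx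
      rw [dist_pi_le_iff he'0.le] at this
      calc ∑ j, ‖colv n d (σ t x) j - colv n d (σ t' x) j‖ ^ 2 ≤ ∑ j : Fin d, e' := by
            refine Finset.sum_le_sum fun j _ => ?_
            have hj := this j
            rw [dist_eq_norm] at hj
            have h0 := norm_nonneg (colv n d (σ t x) j - colv n d (σ t' x) j)
            simp only [Function.comp] at hj
            nlinarith only [hj, h0, he'1, he'0]
        _ = d * e' := by simp
        _ ≤ e := by linarith
    · have := f3 t ht t' ht' (htt.trans ((min_le_right _ _).trans (min_le_right _ _))) x hx
      simpa [Real.dist_eq] using this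
  lip := by
    intro t ht x y
    have h1 := hH1lip t ht x y
    have h2 := hH2lip t ht x y
    refine ⟨by linarith [frob_nonneg n d (σ t x - σ t y)], ?_, by linarith [abs_nonneg (h x - h y)]⟩
    simp only [colv_sub, frob_cols]
    rw [← mul_pow]
    exact pow_le_pow_left₀ (frob_nonneg _ _ _) (by linarith [norm_nonneg (b t x - b t y)]) 2
  bdd := by
    intro t ht x
    have h1 := hH1bdd t ht x
    refine ⟨by linarith [frob_nonneg n d (σ t x)], ?_⟩
    rw [frob_cols]
    exact pow_le_pow_left₀ (frob_nonneg _ _ _) (by linarith [norm_nonneg (b t x)]) 2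

section
variable (n d : ℕ) (T δ L : ℝ) (K : Set (EuclideanSpace ℝ (Fin n)))
    (b : ℝ → EuclideanSpace ℝ (Fin n) → EuclideanSpace ℝ (Fin n))
    (σ : ℝ → EuclideanSpace ℝ (Fin n) → Matrix (Fin n) (Fin d) ℝ)
    (g : ℝ → EuclideanSpace ℝ (Fin n) → ℝ)
    (h : EuclideanSpace ℝ (Fin n) → ℝ)
    (ℓ : ℝ → EuclideanSpace ℝ (Fin n) → ℝ)
    (V : ℝ → ℝ → EuclideanSpace ℝ (Fin n) → ℝ)

lemma sub_obst (hsub : IsSubsol n d T δ L K b σ g h ℓ V)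
    (t0 τ c2 k cc : ℝ) (x0 q : EuclideanSpace ℝ (Fin n))
    (M : Matrix (Fin n) (Fin n) ℝ) (hM : M.IsSymm) (ρ ρ' : ℝ → ℝ)
    (hρ : ∀ r, HasDerivAt ρ (ρ' r) r) (hρc : Continuous ρ') (hfl : ∀ r, δ ≤ r → ρ r = ρ δ)
    (t : ℝ) (ht : t ∈ Ioo 0 T) (r : ℝ) (hr : r ∈ Ioo 0 T) (x : EuclideanSpace ℝ (Fin n))
    (hloc : ∀ᶠ p in nhds ((t, r, x) : ℝ × ℝ × EuclideanSpace ℝ (Fin n)),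
      V p.1 p.2.1 p.2.2 - qF n t0 τ c2 k cc x0 q M ρ p.1 p.2.1 p.2.2 ≤
        V t r x - qF n t0 τ c2 k cc x0 q M ρ t r x) :
    V t r x ≤ Nhat n T δ L K ℓ V t r x ∧ 
    0 ≤ (τ + 2 * c2 * (t - t0) + 2 * k * (t - ρ r - cc) * (1 - ρ' r))
      + ⟪b t x, q + Matrix.toEuclideanLin M (x - x0)⟫
      + 1 / 2 * ∑ j, ⟪Matrix.toEuclideanLin M (colv n d (σ t x) j), colv n d (σ t x) j⟫ + g t x := by
  have := hsub.2 (qTest n T δ t0 τ c2 k cc x0 q M hM ρ ρ' hρ hρc hfl) t ⟨ht.1.le, ht.2⟩ r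
    ⟨hr.1.le, hr.2⟩ x (Filter.Eventually.filter_mono nhdsWithin_le_nhds hloc)
  obtain ⟨h1, h2⟩ := le_min_iff.1 this
  refine ⟨by linarith, ?_⟩
  simp only [qTest, Ham, trace_eq_cols] at h1
  linarith only [h1]

lemma touch_sub (hsub : IsSubsol n d T δ L K b σ g h ℓ V) :
    Touch n d T δ b (fun t x => colv n d (σ t x)) g V (fun _ _ _ => True) := by
  intro t0 τ c2 k cc x0 q M hM ρ ρ' hρ hρc hfl t ht r hr x _ hloc
  exact (sub_obst n d T δ L K b σ g h ℓ V hsub t0 τ c2 k cc x0 q M hM ρ ρ' hρ hρc hfl t ht r hr x hloc).2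

lemma touch_super (hsup : IsSupersol n d T δ L K b σ g h ℓ V) :
    Touch n d T δ b (fun t x => colv n d (σ t x)) (fun t x => -g t x) (fun t r x => -V t r x)
      (fun t r x => V t r x < Nhat n T δ L K ℓ V t r x) := by
  intro t0 τ c2 k cc x0 q M hM ρ ρ' hρ hρc hfl t ht r hr x hQ hloc
  have := hsup.2 (qTest n T δ t0 (-τ) (-c2) (-k) cc x0 (-q) (-M)
    (by unfold Matrix.IsSymm; rw [Matrix.transpose_neg, hM.eq]) ρ ρ' hρ hρc hfl) t ⟨ht.1.le, ht.2⟩ r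
    ⟨hr.1.le, hr.2⟩ x (Filter.Eventually.filter_mono nhdsWithin_le_nhds (by
      filter_upwards [hloc] with p hp
      simp only [qF] at hp
      simp only [qTest, map_neg, LinearMap.neg_apply, inner_neg_left]
      linarith only [hp]))
  rcases min_le_iff.1 this with h1 | h1
  · simp only [qTest, Ham, trace_eq_cols, map_neg, LinearMap.neg_apply, inner_neg_left,
      Finset.sum_neg_distrib] at h1
    rw [← neg_add, inner_neg_right] at h1
    linarith only [h1]
  · linarith only [h1, hQ]

lemma Nop_bdd (hℓpos : ∀ t ∈ Icc (0:ℝ) T, ∀ ξ ∈ K, 0 < ℓ t ξ) (hT : 0 < T)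
    (hS1 : CondS1 n T L V) (t : ℝ) (ht : t ∈ Icc 0 T) (x : EuclideanSpace ℝ (Fin n)) :
    BddBelow {y : ℝ | ∃ ξ ∈ K, y = V t 0 (x + ξ) + ℓ t ξ} := by
  refine ⟨-(L * (T + 1)), ?_⟩
  rintro y ⟨ξ, hξ, rfl⟩
  have h1 := (abs_le.1 (hS1 t ht 0 ⟨le_rfl, hT.le⟩ (x + ξ))).1
  have h2 := hℓpos t ht ξ hξ
  linarith

lemma dom_at {Y : Type*} [TopologicalSpace Y] (f : ℝ × EuclideanSpace ℝ (Fin n) → Y)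
    (hf : ContinuousOn f (Icc (0:ℝ) T ×ˢ (univ : Set (EuclideanSpace ℝ (Fin n)))))
    (t : ℝ) (ht : t ∈ Ioo 0 T) (x : EuclideanSpace ℝ (Fin n)) : ContinuousAt f (t, x) :=
  hf.continuousAt (prod_mem_nhds (Icc_mem_nhds ht.1 ht.2) Filter.univ_mem)

set_option maxHeartbeats 1000000 in
lemma obstacle_le (hT : 0 < T) (hδ : 0 < δ) (hδT : δ < T) (hL : 0 < L) (hKne : K.Nonempty)
    (hℓcont : ContinuousOn (fun p : ℝ × EuclideanSpace ℝ (Fin n) => ℓ p.1 p.2)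
      (Icc (0:ℝ) T ×ˢ K))
    (hℓpos : ∀ t ∈ Icc (0:ℝ) T, ∀ ξ ∈ K, 0 < ℓ t ξ)
    (hVC : InCHat n T δ L V) (hS1 : CondS1 n T L V) (hsub : IsSubsol n d T δ L K b σ g h ℓ V)
    (t : ℝ) (ht : t ∈ Ioo 0 T) (x : EuclideanSpace ℝ (Fin n)) : V t δ x ≤ Nop n K ℓ V t x := by
  have hcδ : ContinuousOn (fun p : ℝ × EuclideanSpace ℝ (Fin n) => V p.1 δ p.2)
      (Icc (0:ℝ) T ×ˢ (univ : Set (EuclideanSpace ℝ (Fin n)))) := by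
    refine hVC.1.comp (f := fun p : ℝ × EuclideanSpace ℝ (Fin n) => (p.1, δ, p.2))
      (Continuous.continuousOn (by fun_prop)) ?_
    rintro ⟨a, y⟩ ⟨h1, _⟩
    exact ⟨h1, ⟨hδ.le, hδT.le⟩, mem_univ _⟩
  have hLT : 0 < L * (T + 1) := by positivity
  -- density
  have dens : ∀ rad > 0, ∃ t' x', t' ∈ Ioo 0 T ∧ dist (t', x') (t, x) < rad ∧
      V t' δ x' ≤ Nop n K ℓ V t' x' := by
    intro rad hrad
    obtain ⟨ht0, htT⟩ := ht
    obtain ⟨R, hR, hR1, hR3, hR4⟩ : ∃ R > 0, R < rad ∧ R < t ∧ R < T - t := by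
      refine ⟨min rad (min t (T - t)) / 2, ?_, ?_, ?_, ?_⟩
      · have : 0 < T - t := by linarith
        positivity
      all_goals
        have h0 : 0 < min rad (min t (T - t)) := by
          have : 0 < T - t := by linarith
          positivity
        have h1 : min rad (min t (T - t)) ≤ rad := by simp
        have h2 : min rad (min t (T - t)) ≤ t := by simp
        have h3 : min rad (min t (T - t)) ≤ T - t := by simp
        linarith
    obtain ⟨k, hk0, hk⟩ : ∃ k > 0, 2 * (L * (T + 1)) < k * R ^ 2 := by
      refine ⟨(2 * (L * (T + 1)) + 1) / R ^ 2, by positivity, ?_⟩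
      rw [div_mul_cancel₀ _ (by positivity)]; linarith
    let X := EuclideanSpace ℝ (Fin n)
    let F : ℝ × X → ℝ := fun p => V p.1 δ p.2 - (k * (p.1 - t) ^ 2 + k * ‖p.2 - x‖ ^ 2)
    let S : Set (ℝ × X) := Icc (t - R) (t + R) ×ˢ Metric.closedBall x R
    have hScomp : IsCompact S := isCompact_Icc.prod (isCompact_closedBall x R)
    have hSne : (t, x) ∈ S := by
      refine ⟨⟨by simp; linarith, by simp; linarith⟩, ?_⟩
      simp [hR.le]
    have hFc : ContinuousOn F S := by
      apply ContinuousOn.sub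
      · refine hcδ.mono ?_
        rintro ⟨a, y⟩ ⟨⟨h2, h3⟩, _⟩
        simp only at h2 h3
        exact ⟨⟨by simp only; linarith, by simp only; linarith⟩, mem_univ _⟩
      · apply Continuous.continuousOn
        fun_prop
    obtain ⟨⟨t', x'⟩, hpS, hmax⟩ := hScomp.exists_isMaxOn ⟨_, hSne⟩ hFc
    obtain ⟨⟨h2, h3⟩, h6⟩ := hpS
    simp only [Metric.mem_closedBall, dist_eq_norm] at h2 h3 h6
    have hF0 : F (t, x) = V t δ x := by simp [F]
    have hge : V t δ x ≤ F (t', x') := hF0 ▸ hmax hSne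
    have hb1 := (abs_le.1 (hS1 t ⟨ht0.le, htT.le⟩ δ ⟨hδ.le, hδT.le⟩ x)).1
    have hb2 := (abs_le.1 (hS1 t' ⟨by linarith, by linarith⟩ δ ⟨hδ.le, hδT.le⟩ x')).2
    simp only [F] at hge
    have p1 : 0 ≤ k * (t' - t) ^ 2 := by positivity
    have p2 : 0 ≤ k * ‖x' - x‖ ^ 2 := by positivity
    have i1 : |t' - t| < R := by
      apply abs_lt_of_sq_lt_sq _ hR.le
      have : k * (t' - t) ^ 2 < k * R ^ 2 := by linarith
      exact lt_of_mul_lt_mul_left this hk0.le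
    have i2 : ‖x' - x‖ < R := by
      have : k * ‖x' - x‖ ^ 2 < k * R ^ 2 := by linarith
      exact lt_of_pow_lt_pow_left₀ 2 hR.le (lt_of_mul_lt_mul_left this hk0.le)
    have htT' : t' ∈ Ioo 0 T := ⟨by linarith, by linarith⟩
    refine ⟨t', x', htT', ?_, ?_⟩
    · rw [Prod.dist_eq, max_lt_iff]
      refine ⟨?_, ?_⟩
      · simp only [Real.dist_eq]; linarith
      · simp only [dist_eq_norm]; linarith
    have hr1 : δ < (δ + T) / 2 := by linarith
    have hr2 : (δ + T) / 2 < T := by linarith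
    have hq : ∀ a r (y : X), qF n t 0 k 0 0 x 0 ((2 * k) • (1 : Matrix (Fin n) (Fin n) ℝ)) (fun _ => 0) a r y
        = k * (a - t) ^ 2 + k * ‖y - x‖ ^ 2 := by
      intro a r y
      have e1 : Matrix.toEuclideanLin (1 : Matrix (Fin n) (Fin n) ℝ) (y - x) = y - x := by
        simp
      simp only [qF]
      rw [map_smul, LinearMap.smul_apply, e1, real_inner_smul_left, real_inner_self_eq_norm_sq]
      simp; ring
    have := (sub_obst n d T δ L K b σ g h ℓ V hsub t 0 k 0 0 x 0 ((2 * k) • (1 : Matrix (Fin n) (Fin n) ℝ))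
      (by unfold Matrix.IsSymm; rw [Matrix.transpose_smul, Matrix.transpose_one])
      (fun _ => 0) (fun _ => 0)
      (fun r => hasDerivAt_const r 0) continuous_const (fun _ _ => rfl) t' htT' ((δ + T) / 2)
      ⟨by linarith, hr2⟩ x' ?_).1
    · rw [hVC.2.2 t' _ x' hr1.le hr2.le, Nhat, if_pos hr1.le] at this
      exact this
    · have hco : Filter.Tendsto (fun p : ℝ × ℝ × X => (p.1, p.2.2))
          (nhds (t', (δ + T) / 2, x')) (nhds (t', x')) := by
        apply Continuous.tendsto'
        · fun_prop
        · rfl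
      have hSn : S ∈ nhds (t', x') := by
        have a1 := abs_lt.1 i1
        refine prod_mem_nhds (Icc_mem_nhds (by linarith) (by linarith)) ?_
        exact Filter.mem_of_superset (Metric.isOpen_ball.mem_nhds (by rwa [Metric.mem_ball, dist_eq_norm]))
          Metric.ball_subset_closedBall
      have hrn : ∀ᶠ p in nhds ((t', (δ + T) / 2, x') : ℝ × ℝ × X), p.2.1 ∈ Ioo δ T := by
        have : Filter.Tendsto (fun p : ℝ × ℝ × X => p.2.1)
          (nhds (t', (δ + T) / 2, x')) (nhds ((δ + T) / 2)) := by
          apply Continuous.tendsto'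
          · fun_prop
          · rfl
        exact this.eventually (Ioo_mem_nhds hr1 hr2)
      filter_upwards [hco.eventually hSn, hrn] with p hp hpr
      have hm := hmax hp
      simp only [F, mem_ofPred_eq] at hm
      rw [hq, hq, hVC.2.2 p.1 _ p.2.2 hpr.1.le hpr.2.le, hVC.2.2 t' _ x' hr1.le hr2.le]
      linarith only [hm]
  refine le_csInf ?_ ?_
  · obtain ⟨ξ, hξ⟩ := hKne
    exact ⟨_, ξ, hξ, rfl⟩
  rintro y ⟨ξ, hξ, rfl⟩
  let f : ℝ × EuclideanSpace ℝ (Fin n) → ℝ := fun p => V p.1 0 (p.2 + ξ) + ℓ p.1 ξ - V p.1 δ p.2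
  have hfc : ContinuousAt f (t, x) := by
    refine dom_at n T f ?_ t ht x
    refine ContinuousOn.sub (ContinuousOn.add ?_ ?_) hcδ
    · refine hVC.1.comp (f := fun p : ℝ × EuclideanSpace ℝ (Fin n) => (p.1, 0, p.2 + ξ))
        (Continuous.continuousOn (by fun_prop)) ?_
      rintro ⟨a, y⟩ ⟨h1, _⟩
      exact ⟨h1, ⟨le_rfl, hT.le⟩, mem_univ _⟩
    · refine hℓcont.comp (f := fun p : ℝ × EuclideanSpace ℝ (Fin n) => (p.1, ξ))
        (Continuous.continuousOn (by fun_prop)) ?_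
      rintro ⟨a, y⟩ ⟨h1, _⟩
      exact ⟨h1, hξ⟩
  by_contra hneg
  have hneg' : f (t, x) < 0 := by simp only [f]; linarith
  obtain ⟨ε, hε, hb⟩ := Metric.eventually_nhds_iff.1 (hfc.eventually (gt_mem_nhds hneg'))
  obtain ⟨t', x', h1, h2, h3⟩ := dens ε hε
  have h4 := hb h2
  have h5 : Nop n K ℓ V t' x' ≤ V t' 0 (x' + ξ) + ℓ t' ξ :=
    csInf_le (Nop_bdd n T L K ℓ V hℓpos hT hS1 t' ⟨h1.1.le, h1.2.le⟩ x') ⟨ξ, hξ, rfl⟩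
  simp only [f] at h4
  linarith

end

set_option maxHeartbeats 1000000 in
theorem main_cmp
    (n d : ℕ) (T δ L : ℝ)
    (hT : 0 < T) (hδ : 0 < δ) (hδT : δ < T) (hL : 0 < L)
    (K : Set (EuclideanSpace ℝ (Fin n))) (hKne : K.Nonempty)
    (b : ℝ → EuclideanSpace ℝ (Fin n) → EuclideanSpace ℝ (Fin n))
    (σ : ℝ → EuclideanSpace ℝ (Fin n) → Matrix (Fin n) (Fin d) ℝ)
    (g : ℝ → EuclideanSpace ℝ (Fin n) → ℝ)
    (h : EuclideanSpace ℝ (Fin n) → ℝ)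
    (ℓ : ℝ → EuclideanSpace ℝ (Fin n) → ℝ)
    (hbcont : ContinuousOn (fun p : ℝ × EuclideanSpace ℝ (Fin n) => b p.1 p.2)
      (Icc (0:ℝ) T ×ˢ (univ : Set (EuclideanSpace ℝ (Fin n)))))
    (hσcont : ContinuousOn (fun p : ℝ × EuclideanSpace ℝ (Fin n) => σ p.1 p.2)
      (Icc (0:ℝ) T ×ˢ (univ : Set (EuclideanSpace ℝ (Fin n)))))
    (hgcont : ContinuousOn (fun p : ℝ × EuclideanSpace ℝ (Fin n) => g p.1 p.2)
      (Icc (0:ℝ) T ×ˢ (univ : Set (EuclideanSpace ℝ (Fin n)))))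
    (hℓcont : ContinuousOn (fun p : ℝ × EuclideanSpace ℝ (Fin n) => ℓ p.1 p.2)
      (Icc (0:ℝ) T ×ˢ K))
    (hH1lip : ∀ t ∈ Icc (0:ℝ) T, ∀ x xh : EuclideanSpace ℝ (Fin n),
      ‖b t x - b t xh‖ + frobNorm n d (σ t x - σ t xh) ≤ L * ‖x - xh‖)
    (hH1bdd : ∀ t ∈ Icc (0:ℝ) T, ∀ x : EuclideanSpace ℝ (Fin n),
      ‖b t x‖ + frobNorm n d (σ t x) ≤ L)
    (hH2lip : ∀ t ∈ Icc (0:ℝ) T, ∀ x xh : EuclideanSpace ℝ (Fin n),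
      |g t x - g t xh| + |h x - h xh| ≤ L * ‖x - xh‖)
    (hℓpos : ∀ t ∈ Icc (0:ℝ) T, ∀ ξ ∈ K, 0 < ℓ t ξ)
    (V Vh : ℝ → ℝ → EuclideanSpace ℝ (Fin n) → ℝ)
    (hVC : InCHat n T δ L V) (hVhC : InCHat n T δ L Vh)
    (hsub : IsSubsol n d T δ L K b σ g h ℓ V)
    (hsuper : IsSupersol n d T δ L K b σ g h ℓ Vh)
    (hS1 : CondS1 n T L V) (hS2 : CondS2 n T δ V)
    (hS1h : CondS1 n T L Vh) (hS2h : CondS2 n T δ Vh) :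
    ∀ t ∈ Icc (0:ℝ) T, ∀ r ∈ Icc (0:ℝ) T, ∀ x : EuclideanSpace ℝ (Fin n),
      V t r x ≤ Vh t r x := by
  have hco := coefOK_of n d T L b σ g h hbcont hσcont hgcont hH1lip hH1bdd hH2lip
  have hTs := touch_sub n d T δ L K b σ g h ℓ V hsub
  have hTh := touch_super n d T δ L K b σ g h ℓ Vh hsuper
  have hB : 0 < L * (T + 1) := by positivity
  have hδI : δ ∈ Icc 0 T := ⟨hδ.le, hδT.le⟩
  have h0I : (0:ℝ) ∈ Icc 0 T := ⟨le_rfl, hT.le⟩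
  -- continuity of the coefficients
  have cb := fun t ht x => dom_at n T _ hbcont t ht x
  have cg := fun t ht x => dom_at n T _ hgcont t ht x
  have cs : ∀ t ∈ Ioo 0 T, ∀ x, ∀ j, ContinuousAt
      (fun p : ℝ × EuclideanSpace ℝ (Fin n) => colv n d (σ p.1 p.2) j) (t, x) := by
    intro t ht x j
    exact ((continuous_apply j).comp (colv_cont n d)).continuousAt.comp (dom_at n T _ hσcont t ht x)
  -- common modulus
  obtain ⟨C, hC, hV2, hVh2⟩ : ∃ C > 0, (∀ t ∈ Icc (0:ℝ) T, ∀ r ∈ Icc (0:ℝ) T, ∀ x : EuclideanSpace ℝ (Fin n),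
      ∀ th ∈ Icc (0:ℝ) T, ∀ rh ∈ Icc (0:ℝ) T, ∀ xh : EuclideanSpace ℝ (Fin n),
      |V t r x - V th rh xh|
      ≤ C * (Real.sqrt |t - th| + Real.sqrt |min r δ - min rh δ| + ‖x - xh‖)) ∧
      (∀ t ∈ Icc (0:ℝ) T, ∀ r ∈ Icc (0:ℝ) T, ∀ x : EuclideanSpace ℝ (Fin n),
      ∀ th ∈ Icc (0:ℝ) T, ∀ rh ∈ Icc (0:ℝ) T, ∀ xh : EuclideanSpace ℝ (Fin n),
      |Vh t r x - Vh th rh xh|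
      ≤ C * (Real.sqrt |t - th| + Real.sqrt |min r δ - min rh δ| + ‖x - xh‖)) := by
    obtain ⟨C1, hC1, h1⟩ := hS2
    obtain ⟨C2, hC2, h2⟩ := hS2h
    refine ⟨C1 + C2, by positivity, ?_, ?_⟩
    · intro t ht r hr x t' ht' r' hr' x'
      refine (h1 t ht r hr x t' ht' r' hr' x').trans ?_
      exact mul_le_mul_of_nonneg_right (by linarith) (by positivity)
    · intro t ht r hr x t' ht' r' hr' x'
      refine (h2 t ht r hr x t' ht' r' hr' x').trans ?_
      exact mul_le_mul_of_nonneg_right (by linarith) (by positivity)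
  have hter : ∀ r ∈ Icc 0 T, ∀ x, V T r x ≤ Vh T r x := fun r hr x =>
    (hsub.1 r hr x).trans (hsuper.1 r hr x)
  -- generic consequences of the modulus
  have rmod : ∀ W : ℝ → ℝ → EuclideanSpace ℝ (Fin n) → ℝ,
      (∀ t ∈ Icc (0:ℝ) T, ∀ r ∈ Icc (0:ℝ) T, ∀ x : EuclideanSpace ℝ (Fin n),
      ∀ th ∈ Icc (0:ℝ) T, ∀ rh ∈ Icc (0:ℝ) T, ∀ xh : EuclideanSpace ℝ (Fin n),
      |W t r x - W th rh xh|
      ≤ C * (Real.sqrt |t - th| + Real.sqrt |min r δ - min rh δ| + ‖x - xh‖)) →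
      ∀ t ∈ Icc 0 T, ∀ r ∈ Icc 0 δ, ∀ r' ∈ Icc 0 δ, ∀ x,
      |W t r x - W t r' x| ≤ C * Real.sqrt |r - r'| := by
    intro W hW t ht r hr r' hr' x
    have := hW t ht r ⟨hr.1, hr.2.trans hδT.le⟩ x t ht r' ⟨hr'.1, hr'.2.trans hδT.le⟩ x
    simpa [min_eq_left hr.2, min_eq_left hr'.2] using this
  have cmod : ∀ W : ℝ → ℝ → EuclideanSpace ℝ (Fin n) → ℝ,
      (∀ t ∈ Icc (0:ℝ) T, ∀ r ∈ Icc (0:ℝ) T, ∀ x : EuclideanSpace ℝ (Fin n),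
      ∀ th ∈ Icc (0:ℝ) T, ∀ rh ∈ Icc (0:ℝ) T, ∀ xh : EuclideanSpace ℝ (Fin n),
      |W t r x - W th rh xh|
      ≤ C * (Real.sqrt |t - th| + Real.sqrt |min r δ - min rh δ| + ‖x - xh‖)) →
      ∀ c t, t ∈ Icc 0 T → t - c ∈ Icc 0 δ → ∀ x s, s ∈ Icc 0 T → s - c ∈ Icc 0 δ → ∀ y,
      |W t (t - c) x - W s (s - c) y| ≤ (2 * C) * (Real.sqrt |t - s| + ‖x - y‖) := by
    intro W hW c t ht htc x s hs hsc y
    have := hW t ht (t - c) ⟨htc.1, htc.2.trans hδT.le⟩ x s hs (s - c) ⟨hsc.1, hsc.2.trans hδT.le⟩ y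
    rw [min_eq_left htc.2, min_eq_left hsc.2, show t - c - (s - c) = t - s by ring] at this
    have h2 : 0 ≤ C * ‖x - y‖ := by positivity
    linarith
  -- comparison along characteristics
  have char_cmp : ∀ c a a', 0 ≤ a → a' ≤ T → a < a' → 0 ≤ a - c → a' - c ≤ δ →
      (∀ x, V a' (a' - c) x ≤ Vh a' (a' - c) x) →
      ∀ t ∈ Icc a a', ∀ x, V t (t - c) x ≤ Vh t (t - c) x := by
    intro c a a' ha ha' haa hac hac' hend
    have hI : ∀ t ∈ Icc a a', t ∈ Icc 0 T := fun t ht => ⟨ha.trans ht.1, ht.2.trans ha'⟩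
    have hI2 : ∀ t ∈ Icc a a', t - c ∈ Icc 0 δ := fun t ht => ⟨by linarith [ht.1], by linarith [ht.2]⟩
    have hI3 : ∀ t ∈ Icc a a', t - c ∈ Icc 0 T := fun t ht => ⟨(hI2 t ht).1, (hI2 t ht).2.trans hδT.le⟩
    have hI4 : ∀ t ∈ Ioo a a', t ∈ Ioo 0 T := fun t ht => ⟨ha.trans_lt ht.1, ht.2.trans_le ha'⟩
    have hI5 : ∀ t ∈ Ioo a a', t - c ∈ Ioo 0 δ := fun t ht => ⟨by linarith [ht.1], by linarith [ht.2]⟩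
    refine compare_strip d T L hL b (fun t x => colv n d (σ t x)) g hco a a' ha ha' haa
      (fun t x => V t (t - c) x) (fun t x => Vh t (t - c) x) (2 * C) (by positivity)
      (fun t ht x s hs y => cmod V hV2 c t (hI t ht) (hI2 t ht) x s (hI s hs) (hI2 s hs) y)
      (fun t ht x s hs y => cmod Vh hVh2 c t (hI t ht) (hI2 t ht) x s (hI s hs) (hI2 s hs) y)
      (L * (T + 1)) hB (fun t ht x => hS1 t (hI t ht) _ (hI3 t ht) x)
      (fun t ht x => hS1h t (hI t ht) _ (hI3 t ht) x) ?_ ?_ hend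
    · intro t ht x τ q A hj
      exact touch_char n d T δ hδ hδT b _ g V _ hTs (fun _ _ _ _ _ => trivial) hVC.1 C hC
        (rmod V hV2) c t (hI4 t ht) (hI5 t ht) x (cb t (hI4 t ht) x) (cs t (hI4 t ht) x)
        (cg t (hI4 t ht) x) τ q A hj
    · intro t ht x τ q A _ hj
      have := touch_char n d T δ hδ hδT b _ _ (fun t r x => -Vh t r x) _ hTh ?_ hVhC.1.neg C hC
        ?_ c t (hI4 t ht) (hI5 t ht) x (cb t (hI4 t ht) x) (cs t (hI4 t ht) x)
        (cg t (hI4 t ht) x).neg τ q A hj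
      · linarith only [this]
      · intro t ht r hr x
        rw [Nhat, if_neg (not_le.2 hr.2)]
        have := hVhC.2.1 t ⟨ht.1.le, ht.2.le⟩ r ⟨hr.1.le, (hr.2.trans hδT).le⟩ x
        linarith
      · intro t ht r hr r' hr' x
        have := rmod Vh hVh2 t ht r hr r' hr' x
        rw [← abs_neg]
        rwa [show -(-Vh t r x - -Vh t r' x) = Vh t r x - Vh t r' x by ring]
  -- comparison on the flat part
  have flat_cmp : ∀ a, 0 ≤ a → a < T → (∀ t ∈ Ioo a T, ∀ x, V t 0 x ≤ Vh t 0 x) →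
      ∀ t ∈ Icc a T, ∀ x, V t δ x ≤ Vh t δ x := by
    intro a ha haT h0
    have hI : ∀ t ∈ Icc a T, t ∈ Icc 0 T := fun t ht => ⟨ha.trans ht.1, ht.2⟩
    have hI4 : ∀ t ∈ Ioo a T, t ∈ Ioo 0 T := fun t ht => ⟨ha.trans_lt ht.1, ht.2⟩
    have fmod : ∀ W : ℝ → ℝ → EuclideanSpace ℝ (Fin n) → ℝ,
      (∀ t ∈ Icc (0:ℝ) T, ∀ r ∈ Icc (0:ℝ) T, ∀ x : EuclideanSpace ℝ (Fin n),
      ∀ th ∈ Icc (0:ℝ) T, ∀ rh ∈ Icc (0:ℝ) T, ∀ xh : EuclideanSpace ℝ (Fin n),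
      |W t r x - W th rh xh|
      ≤ C * (Real.sqrt |t - th| + Real.sqrt |min r δ - min rh δ| + ‖x - xh‖)) →
      ∀ t ∈ Icc a T, ∀ x, ∀ s ∈ Icc a T, ∀ y,
      |W t δ x - W s δ y| ≤ C * (Real.sqrt |t - s| + ‖x - y‖) := by
      intro W hW t ht x s hs y
      simpa using hW t (hI t ht) δ hδI x s (hI s hs) δ hδI y
    refine compare_strip d T L hL b (fun t x => colv n d (σ t x)) g hco a T ha le_rfl haT
      (fun t x => V t δ x) (fun t x => Vh t δ x) C hC.le (fmod V hV2) (fmod Vh hVh2)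
      (L * (T + 1)) hB (fun t ht x => hS1 t (hI t ht) _ hδI x)
      (fun t ht x => hS1h t (hI t ht) _ hδI x) ?_ ?_ (hter δ hδI)
    · intro t ht x τ q A hj
      exact touch_flat n d T δ hδ hδT b _ g V _ hTs hVC.2.2 t (hI4 t ht) x (fun _ _ _ => trivial) τ q A hj
    · intro t ht x τ q A hlt hj
      have := touch_flat n d T δ hδ hδT b _ _ (fun t r x => -Vh t r x) _ hTh
        (fun t r x h1 h2 => by rw [hVhC.2.2 t r x h1 h2]) t (hI4 t ht) x ?_ τ q A hj
      · linarith only [this]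
      · intro r hr hrT
        rw [Nhat, if_pos hr, hVhC.2.2 t r x hr hrT.le]
        have ho := obstacle_le n d T δ L K b σ g h ℓ V hT hδ hδT hL hKne hℓcont hℓpos hVC hS1 hsub
          t (hI4 t ht) x
        have htI : t ∈ Icc 0 T := hI t ⟨ht.1.le, ht.2.le⟩
        have hmono : Nop n K ℓ V t x ≤ Nop n K ℓ Vh t x := by
          refine le_csInf ?_ ?_
          · obtain ⟨ξ, hξ⟩ := hKne
            exact ⟨_, ξ, hξ, rfl⟩
          · rintro y ⟨ξ, hξ, rfl⟩
            refine (csInf_le (Nop_bdd n T L K ℓ V hℓpos hT hS1 t htI x) ⟨ξ, hξ, rfl⟩).trans ?_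
            linarith [h0 t ht (x + ξ)]
        exact lt_of_lt_of_le hlt (ho.trans hmono)
  -- induction step
  have step : ∀ a, (∀ t ∈ Icc 0 T, a ≤ t → ∀ r ∈ Icc 0 T, ∀ x, V t r x ≤ Vh t r x) →
      (∀ t ∈ Icc 0 T, a - δ ≤ t → ∀ r ∈ Icc 0 T, ∀ x, V t r x ≤ Vh t r x) := by
    intro a ih
    have zero : ∀ t ∈ Icc 0 T, a - δ ≤ t → ∀ x, V t 0 x ≤ Vh t 0 x := by
      intro t ht hat x
      rcases eq_or_lt_of_le ht.2 with hh | hh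
      · rw [hh]; exact hter 0 h0I x
      have hlt : t < min (t + δ) T := lt_min (by linarith) hh
      have := char_cmp t t (min (t + δ) T) ht.1 (min_le_right _ _) hlt (by simp)
        (by linarith [min_le_left (t + δ) T]) ?_ t ⟨le_rfl, hlt.le⟩ x
      · simpa using this
      · intro y
        rcases le_total (t + δ) T with h1 | h1
        · rw [min_eq_left h1]
          exact ih _ ⟨by linarith [ht.1], h1⟩ (by linarith) _ ⟨by linarith, by linarith⟩ y
        · rw [min_eq_right h1]
          exact hter _ ⟨by linarith, by linarith [ht.1]⟩ y
    have flat : ∀ t ∈ Icc 0 T, a - δ ≤ t → ∀ x, V t δ x ≤ Vh t δ x := by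
      intro t ht hat x
      rcases eq_or_lt_of_le ht.2 with hh | hh
      · rw [hh]; exact hter δ hδI x
      refine flat_cmp t ht.1 hh (fun s hs y => zero s ⟨ht.1.trans hs.1.le, hs.2.le⟩ (hat.trans hs.1.le) y)
        t ⟨le_rfl, ht.2⟩ x
    intro t ht hat r hr x
    rcases le_or_gt δ r with h1 | h1
    · rw [hVC.2.2 t r x h1 hr.2, hVhC.2.2 t r x h1 hr.2]
      exact flat t ht hat x
    rcases eq_or_lt_of_le ht.2 with hh | hh
    · rw [hh]; exact hter r hr x
    have hlt : t < min (t - r + δ) T := lt_min (by linarith) hh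
    have := char_cmp (t - r) t (min (t - r + δ) T) ht.1 (min_le_right _ _) hlt (by linarith [hr.1])
        (by linarith [min_le_left (t - r + δ) T]) ?_ t ⟨le_rfl, hlt.le⟩ x
    · simpa using this
    · intro y
      rcases le_total (t - r + δ) T with h2 | h2
      · rw [min_eq_left h2, show t - r + δ - (t - r) = δ by ring]
        exact flat _ ⟨by linarith [ht.1], h2⟩ (by linarith) y
      · rw [min_eq_right h2]
        exact hter _ ⟨by linarith [hr.1], by linarith⟩ y
  have all : ∀ k : ℕ, ∀ t ∈ Icc 0 T, T - k * δ ≤ t → ∀ r ∈ Icc 0 T, ∀ x, V t r x ≤ Vh t r x := by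
    intro k
    induction k with
    | zero =>
      intro t ht hTt r hr x
      have : t = T := le_antisymm ht.2 (by simpa using hTt)
      rw [this]; exact hter r hr x
    | succ k ih =>
      have := step _ ih
      intro t ht hTt
      refine this t ht ?_
      push_cast at hTt
      linarith
  obtain ⟨k, hk⟩ := exists_nat_ge (T / δ)
  rw [div_le_iff₀ hδ] at hk
  intro t ht
  exact all k t ht (by linarith [ht.1])

/-- Comparison and uniqueness (paper's Theorem 4.1): a viscosity
subsolution lies below a viscosity supersolution on `D`; consequently any two
viscosity solutions in `Ĉ(D)` satisfying (S1)-(S2) coincide on `D`. -/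
theorem stmt_15
    (n d : ℕ) (hn : 1 ≤ n) (hd : 1 ≤ d) (T δ L ℓ₀ α : ℝ)
    (hT : 0 < T) (hδ : 0 < δ) (hδT : δ < T) (hL : 0 < L)
    (hℓ₀ : 0 < ℓ₀) (hα : 0 < α)
    (K : Set (EuclideanSpace ℝ (Fin n))) (hKne : K.Nonempty) (hKcl : IsClosed K)
    (hKconv : Convex ℝ K) (hKcone : ∀ c : ℝ, 0 ≤ c → ∀ x ∈ K, c • x ∈ K)
    (b : ℝ → EuclideanSpace ℝ (Fin n) → EuclideanSpace ℝ (Fin n))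
    (σ : ℝ → EuclideanSpace ℝ (Fin n) → Matrix (Fin n) (Fin d) ℝ)
    (g : ℝ → EuclideanSpace ℝ (Fin n) → ℝ)
    (h : EuclideanSpace ℝ (Fin n) → ℝ)
    (ℓ : ℝ → EuclideanSpace ℝ (Fin n) → ℝ)
    (hbcont : ContinuousOn (fun p : ℝ × EuclideanSpace ℝ (Fin n) => b p.1 p.2)
      (Icc (0:ℝ) T ×ˢ (univ : Set (EuclideanSpace ℝ (Fin n)))))
    (hσcont : ContinuousOn (fun p : ℝ × EuclideanSpace ℝ (Fin n) => σ p.1 p.2)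
      (Icc (0:ℝ) T ×ˢ (univ : Set (EuclideanSpace ℝ (Fin n)))))
    (hgcont : ContinuousOn (fun p : ℝ × EuclideanSpace ℝ (Fin n) => g p.1 p.2)
      (Icc (0:ℝ) T ×ˢ (univ : Set (EuclideanSpace ℝ (Fin n)))))
    (hhcont : Continuous h)
    (hℓcont : ContinuousOn (fun p : ℝ × EuclideanSpace ℝ (Fin n) => ℓ p.1 p.2)
      (Icc (0:ℝ) T ×ˢ K))
    (hH1lip : ∀ t ∈ Icc (0:ℝ) T, ∀ x xh : EuclideanSpace ℝ (Fin n),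
      ‖b t x - b t xh‖ + frobNorm n d (σ t x - σ t xh) ≤ L * ‖x - xh‖)
    (hH1bdd : ∀ t ∈ Icc (0:ℝ) T, ∀ x : EuclideanSpace ℝ (Fin n),
      ‖b t x‖ + frobNorm n d (σ t x) ≤ L)
    (hH2lip : ∀ t ∈ Icc (0:ℝ) T, ∀ x xh : EuclideanSpace ℝ (Fin n),
      |g t x - g t xh| + |h x - h xh| ≤ L * ‖x - xh‖)
    (hH2bdd : ∀ t ∈ Icc (0:ℝ) T, ∀ x : EuclideanSpace ℝ (Fin n), |g t x| + |h x| ≤ L)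
    (hℓpos : ∀ t ∈ Icc (0:ℝ) T, ∀ ξ ∈ K, 0 < ℓ t ξ)
    (hℓsubadd : ∀ t ∈ Icc (0:ℝ) T, ∀ ξ ∈ K, ∀ ξh ∈ K, ℓ t (ξ + ξh) < ℓ t ξ + ℓ t ξh)
    (hℓmono : ∀ t ∈ Icc (0:ℝ) T, ∀ th ∈ Icc (0:ℝ) T, t ≤ th → ∀ ξ ∈ K, ℓ th ξ ≤ ℓ t ξ)
    (hℓcoer : ∀ t ∈ Icc (0:ℝ) T, ∀ ξ ∈ K, ℓ₀ + α * ‖ξ‖ ≤ ℓ t ξ)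
    (V Vh : ℝ → ℝ → EuclideanSpace ℝ (Fin n) → ℝ)
    (hVC : InCHat n T δ L V) (hVhC : InCHat n T δ L Vh)
    (hsub : IsSubsol n d T δ L K b σ g h ℓ V)
    (hsuper : IsSupersol n d T δ L K b σ g h ℓ Vh)
    (hS1 : CondS1 n T L V) (hS2 : CondS2 n T δ V)
    (hS1h : CondS1 n T L Vh) (hS2h : CondS2 n T δ Vh) :
    (∀ t ∈ Icc (0:ℝ) T, ∀ r ∈ Icc (0:ℝ) T, ∀ x : EuclideanSpace ℝ (Fin n),
      V t r x ≤ Vh t r x) ∧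
    (∀ W₁ W₂ : ℝ → ℝ → EuclideanSpace ℝ (Fin n) → ℝ,
      InCHat n T δ L W₁ → IsSubsol n d T δ L K b σ g h ℓ W₁ →
        IsSupersol n d T δ L K b σ g h ℓ W₁ → CondS1 n T L W₁ → CondS2 n T δ W₁ →
      InCHat n T δ L W₂ → IsSubsol n d T δ L K b σ g h ℓ W₂ →
        IsSupersol n d T δ L K b σ g h ℓ W₂ → CondS1 n T L W₂ → CondS2 n T δ W₂ →
      ∀ t ∈ Icc (0:ℝ) T, ∀ r ∈ Icc (0:ℝ) T, ∀ x : EuclideanSpace ℝ (Fin n),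
        W₁ t r x = W₂ t r x) := by
  refine ⟨main_cmp n d T δ L hT hδ hδT hL K hKne b σ g h ℓ hbcont hσcont hgcont hℓcont hH1lip hH1bdd
    hH2lip hℓpos V Vh hVC hVhC hsub hsuper hS1 hS2 hS1h hS2h, ?_⟩
  intro W₁ W₂ c1 sb1 sp1 a1 m1 c2 sb2 sp2 a2 m2 t ht r hr x
  exact le_antisymm
    (main_cmp n d T δ L hT hδ hδT hL K hKne b σ g h ℓ hbcont hσcont hgcont hℓcont hH1lip hH1bdd
      hH2lip hℓpos W₁ W₂ c1 c2 sb1 sp2 a1 m1 a2 m2 t ht r hr x)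
    (main_cmp n d T δ L hT hδ hδT hL K hKne b σ g h ℓ hbcont hσcont hgcont hℓcont hH1lip hH1bdd
      hH2lip hℓpos W₂ W₁ c2 c1 sb2 sp1 a2 m2 a1 m1 t ht r hr x)
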